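/- arXiv:1305.4262 — 4 statements merged into one kernel-verified Lean document; each statement's English description precedes it below -/
import Mathlib

section
/- Let n ≥ 2, let A(D) be an elliptic homogeneous linear differential operator of order k on ℝⁿ from V to E, let ℓ ∈ {1, …, min(k, n−1)} and q ∈ [1, n/(n−ℓ)]. If there exists a constant C such that for every u ∈ C_c^∞(ℝⁿ; V), (∫_{ℝⁿ} |D^{k−ℓ}u(x)|^q / |x|^{n−(n−ℓ)q} dx)^{1/q} ≤ C ∫_{ℝⁿ} |A(D)u(x)| dx, then A(D) is canceling. -/
open MeasureTheory ENNReal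
open scoped NNReal RealInnerProductSpace

noncomputable section

/-- A homogeneous linear differential operator `A(D)` of order `k` from `V` to `E` on a
Euclidean space `X`, represented through its action `u ↦ A (D^k u)` on the `k`-th
iterated (Fréchet) derivative; this is equivalent to the data of a family of coefficients
`(A_α)_{|α| = k}`, `A_α ∈ 𝓛(V; E)`, acting by `A(D)u = ∑_{|α|=k} A_α (∂^α u)`. -/
abbrev DiffOperator (X : Type*) [NormedAddCommGroup X] [InnerProductSpace ℝ X]
    (k : ℕ) (V E : Type*) [NormedAddCommGroup V] [NormedSpace ℝ V]
    [NormedAddCommGroup E] [NormedSpace ℝ E] :=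
  ContinuousMultilinearMap ℝ (fun _ : Fin k => X) V →L[ℝ] E

namespace DiffOperator

variable {X : Type*} [NormedAddCommGroup X] [InnerProductSpace ℝ X]
  {k : ℕ} {V E : Type*} [NormedAddCommGroup V] [NormedSpace ℝ V]
  [NormedAddCommGroup E] [NormedSpace ℝ E]

/-- The action `A(D)u` of the differential operator on a function `u : X → V`. -/
noncomputable def app (A : DiffOperator X k V E) (u : X → V) (x : X) : E :=
  A (iteratedFDeriv ℝ k u x)

/-- The symbol `A(ξ) = ∑_{|α|=k} ξ^α A_α ∈ 𝓛(V; E)` of the operator: it sends `v : V` to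
`A` applied to the `k`-linear map `(w₁, …, w_k) ↦ (⟪ξ,w₁⟫ ⋯ ⟪ξ,w_k⟫) • v`. -/
noncomputable def symbol (A : DiffOperator X k V E) (ξ : X) : V →L[ℝ] E :=
  A.comp (((ContinuousMultilinearMap.compContinuousLinearMapL
      (fun _ : Fin k => innerSL ℝ ξ)).comp
    (ContinuousMultilinearMap.piFieldEquiv ℝ (Fin k)
      V).toContinuousLinearEquiv.toContinuousLinearMap))

/-- `A(D)` is elliptic if its symbol `A(ξ)` is injective for every `ξ ≠ 0`. -/
def IsElliptic (A : DiffOperator X k V E) : Prop :=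
  ∀ ξ : X, ξ ≠ 0 → Function.Injective (A.symbol ξ)

/-- `A(D)` is canceling if `⋂_{ξ ≠ 0} A(ξ)[V] = {0}`. -/
def IsCanceling (A : DiffOperator X k V E) : Prop :=
  (⋂ (ξ : X) (_ : ξ ≠ 0), Set.range (A.symbol ξ)) = {0}

end DiffOperator

/-- `u ∈ C_c^∞`: a smooth compactly supported function. -/
def IsTestFun {X V : Type*} [NormedAddCommGroup X] [NormedSpace ℝ X]
    [NormedAddCommGroup V] [NormedSpace ℝ V] (u : X → V) : Prop :=
  ContDiff ℝ (⊤ : ℕ∞) u ∧ HasCompactSupport u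

/-- The `k`-linear map `(w₁, …, w_k) ↦ (∏ ⟪ξ, w_i⟫) • v`. -/
def auxT {X V : Type*} [NormedAddCommGroup X] [InnerProductSpace ℝ X]
    [NormedAddCommGroup V] [NormedSpace ℝ V] (k : ℕ) (ξ : X) (v : V) :
    ContinuousMultilinearMap ℝ (fun _ : Fin k => X) V :=
  (ContinuousMultilinearMap.mkPiRing ℝ (Fin k) v).compContinuousLinearMap
    (fun _ : Fin k => innerSL ℝ ξ)

lemma auxT_apply {X V : Type*} [NormedAddCommGroup X] [InnerProductSpace ℝ X]
    [NormedAddCommGroup V] [NormedSpace ℝ V] (k : ℕ) (ξ : X) (v : V) (y : Fin k → X) :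
    auxT k ξ v y = (∏ i, ⟪ξ, y i⟫) • v := by
  simp [auxT]

lemma aux_symbol_apply {X V E : Type*} [NormedAddCommGroup X] [InnerProductSpace ℝ X]
    [NormedAddCommGroup V] [NormedSpace ℝ V] [NormedAddCommGroup E] [NormedSpace ℝ E]
    {k : ℕ} (A : DiffOperator X k V E) (ξ : X) (v : V) :
    A.symbol ξ v = A (auxT k ξ v) := rfl

open Filter Topology in
lemma aux_symbol_contDiff {X V E : Type*} [NormedAddCommGroup X] [InnerProductSpace ℝ X]
    [NormedAddCommGroup V] [NormedSpace ℝ V] [NormedAddCommGroup E] [NormedSpace ℝ E]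
    {k : ℕ} (A : DiffOperator X k V E) : ContDiff ℝ (⊤ : ℕ∞) (fun ξ => A.symbol ξ) := by
  unfold DiffOperator.symbol
  apply ContDiff.clm_comp contDiff_const
  apply ContDiff.clm_comp _ contDiff_const
  have h1 := (ContinuousMultilinearMap.compContinuousLinearMapContinuousMultilinear ℝ
    (fun _ : Fin k => X) (fun _ : Fin k => ℝ) V).contDiff (n := ((⊤ : ℕ∞) : WithTop ℕ∞))
  exact h1.comp (contDiff_pi.2 fun _ => (innerSL ℝ (E := X)).contDiff)

lemma aux_symbol_smul {X V E : Type*} [NormedAddCommGroup X] [InnerProductSpace ℝ X]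
    [NormedAddCommGroup V] [NormedSpace ℝ V] [NormedAddCommGroup E] [NormedSpace ℝ E]
    {k : ℕ} (A : DiffOperator X k V E) (t : ℝ) (ξ : X) (v : V) :
    A.symbol (t • ξ) v = A.symbol ξ (t ^ k • v) := by
  rw [aux_symbol_apply, aux_symbol_apply]
  congr 1
  ext y
  simp [auxT_apply, inner_smul_left, Finset.prod_mul_distrib, smul_smul, mul_comm]

open Filter Topology in
lemma aux_m {X V E : Type*} [NormedAddCommGroup X] [InnerProductSpace ℝ X]
    [NormedAddCommGroup V] [NormedSpace ℝ V] [FiniteDimensional ℝ V]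
    [NormedAddCommGroup E] [NormedSpace ℝ E] [FiniteDimensional ℝ E]
    {k : ℕ} (A : DiffOperator X k V E) (hA : A.IsElliptic) (e : E)
    (he : ∀ ξ : X, ξ ≠ 0 → e ∈ Set.range (A.symbol ξ)) :
    ∃ m : X → V, (∀ ξ, ξ ≠ 0 → A.symbol ξ (m ξ) = e) ∧
      (∀ ξ, ξ ≠ 0 → ContDiffAt ℝ (⊤ : ℕ∞) m ξ) ∧
      (∀ (t : ℝ) (ξ : X), t ≠ 0 → ξ ≠ 0 → m (t • ξ) = (t ^ k)⁻¹ • m ξ) := by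
  classical
  choose m hm using he
  refine ⟨fun ξ => if h : ξ ≠ 0 then m ξ h else 0, ?_, ?_, ?_⟩
  · intro ξ hξ
    simp [hξ, hm]
  · intro ξ hξ
    obtain ⟨L, hL⟩ := LinearMap.exists_leftInverse_of_injective (A.symbol ξ).toLinearMap
      (LinearMap.ker_eq_bot.2 (hA ξ hξ))
    set L' : E →L[ℝ] V := LinearMap.toContinuousLinearMap L with hL'
    have hcd : ContDiff ℝ (⊤ : ℕ∞) (fun η => L'.comp (A.symbol η)) :=
      contDiff_const.clm_comp (aux_symbol_contDiff A)
    have hid : L'.comp (A.symbol ξ) = ((ContinuousLinearEquiv.refl ℝ V : V ≃L[ℝ] V) : V →L[ℝ] V) := by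
      ext v
      have := LinearMap.congr_fun hL v
      simpa [hL'] using this
    have hinv : ContDiffAt ℝ (⊤ : ℕ∞)
        (fun η => ContinuousLinearMap.inverse (L'.comp (A.symbol η)) (L' e)) ξ := by
      have h1 : ContDiffAt ℝ (⊤ : ℕ∞) ContinuousLinearMap.inverse (L'.comp (A.symbol ξ)) := by
        rw [hid]
        exact contDiffAt_map_inverse _
      have h2 := h1.comp ξ hcd.contDiffAt
      exact h2.clm_apply contDiffAt_const
    refine hinv.congr_of_eventuallyEq ?_
    have ho : ∀ᶠ η in 𝓝 ξ, L'.comp (A.symbol η) ∈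
        Set.range ((↑) : (V ≃L[ℝ] V) → V →L[ℝ] V) := by
      apply hcd.continuous.continuousAt
      show _ ∈ 𝓝 (L'.comp (A.symbol ξ))
      rw [hid]
      exact ContinuousLinearEquiv.nhds _
    filter_upwards [ho, isOpen_ne.mem_nhds hξ] with η h1 h2
    obtain ⟨e', he'⟩ := h1
    have h3 : e' (m η h2) = L' e := by
      have : (e' : V →L[ℝ] V) (m η h2) = L' e := by
        rw [he', ContinuousLinearMap.comp_apply, hm]
      exact this
    rw [← he', ContinuousLinearMap.inverse_equiv, ← h3]
    simp [show η ≠ 0 from h2]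
  · intro t ξ ht hξ
    have h1 : t • ξ ≠ 0 := smul_ne_zero ht hξ
    simp only [h1, hξ, ne_eq, not_false_eq_true, dif_pos]
    apply hA ξ hξ
    have := hm (t • ξ) h1
    rw [aux_symbol_smul] at this
    have h2 := hm ξ hξ
    rw [map_smul, inv_eq_one_div, h2, ← this, ← map_smul, smul_smul]
    congr 1
    field_simp
    simp
open Filter Topology in
/-- Schwartz extension of the estimate. -/
lemma aux_schwartz_ext
    {X V E : Type*} [NormedAddCommGroup X] [InnerProductSpace ℝ X] [FiniteDimensional ℝ X]
    [MeasurableSpace X] [BorelSpace X]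
    [NormedAddCommGroup V] [InnerProductSpace ℝ V] [FiniteDimensional ℝ V]
    [NormedAddCommGroup E] [InnerProductSpace ℝ E] [FiniteDimensional ℝ E]
    {k j : ℕ} (A : DiffOperator X k V E) (q a : ℝ) (hq : 1 ≤ q) (C : ℝ)
    (hest : ∀ u : X → V, IsTestFun u →
      (∫⁻ x, (‖iteratedFDeriv ℝ j u x‖₊ : ℝ≥0∞) ^ q / (‖x‖₊ : ℝ≥0∞) ^ a) ^ (1 / q)
        ≤ ENNReal.ofReal C * ∫⁻ x, (‖A.app u x‖₊ : ℝ≥0∞))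
    (u : SchwartzMap X V) :
    (∫⁻ x, (‖iteratedFDeriv ℝ j u x‖₊ : ℝ≥0∞) ^ q / (‖x‖₊ : ℝ≥0∞) ^ a) ^ (1 / q)
        ≤ ENNReal.ofReal C * ∫⁻ x, (‖A.app u x‖₊ : ℝ≥0∞) := by
  let χ : ContDiffBump (0 : X) := ⟨1, 2, one_pos, one_lt_two⟩
  have hχ : ContDiff ℝ (⊤ : ℕ∞) (χ : X → ℝ) := χ.contDiff
  let s : ℕ → ℝ := fun N => ((N : ℝ) + 1)⁻¹
  have hs0 : ∀ N, 0 < s N := fun N => by positivity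
  have hs1 : ∀ N, s N ≤ 1 := fun N => inv_le_one_of_one_le₀ (by simp)
  have hst : Tendsto s atTop (𝓝 0) := by
    simpa [s] using tendsto_one_div_add_atTop_nhds_zero_nat (𝕜 := ℝ)
  let c : ℕ → X → ℝ := fun N x => χ (s N • x)
  have hc : ∀ N, ContDiff ℝ (⊤ : ℕ∞) (c N) := fun N => hχ.comp (contDiff_const_smul _)
  let w : ℕ → X → V := fun N x => c N x • u x
  have hu : ContDiff ℝ (⊤ : ℕ∞) (u : X → V) := u.smooth _
  have hwt : ∀ N, IsTestFun (w N) := by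
    intro N
    refine ⟨(hc N).smul hu, ?_⟩
    apply HasCompactSupport.smul_right
    exact χ.hasCompactSupport.comp_homeomorph (Homeomorph.smulOfNeZero (s N) (hs0 N).ne')
  -- eventual equality
  have hev : ∀ x, ∀ᶠ N in atTop, w N =ᶠ[𝓝 x] u := by
    intro x
    have h1 : Tendsto (fun N => s N • x) atTop (𝓝 0) := by
      simpa using hst.smul_const x
    have h2 : ∀ᶠ N in atTop, s N • x ∈ Metric.ball (0 : X) 1 :=
      h1 (Metric.ball_mem_nhds _ one_pos)
    filter_upwards [h2] with N hN
    have h3 : ∀ᶠ y in 𝓝 x, s N • y ∈ Metric.ball (0 : X) 1 :=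
      (continuous_const_smul (s N)).continuousAt.eventually (Metric.isOpen_ball.mem_nhds hN)
    filter_upwards [h3] with y hy
    have : c N y = 1 := χ.one_of_mem_closedBall (Metric.ball_subset_closedBall hy)
    simp [w, this]
  have hevD : ∀ (i : ℕ) (x), ∀ᶠ N in atTop, iteratedFDeriv ℝ i (w N) x = iteratedFDeriv ℝ i u x := by
    intro i x
    filter_upwards [hev x] with N hN
    exact (hN.iteratedFDeriv ℝ i).eq_of_nhds
  -- bounds of derivatives of cutoffs
  have hB : ∀ i : ℕ, ∃ K : ℝ, ∀ N x, ‖iteratedFDeriv ℝ i (c N) x‖ ≤ K := by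
    intro i
    have hcs : HasCompactSupport (iteratedFDeriv ℝ i (χ : X → ℝ)) :=
      χ.hasCompactSupport.iteratedFDeriv i
    have hco : Continuous (iteratedFDeriv ℝ i (χ : X → ℝ)) :=
      hχ.continuous_iteratedFDeriv (by exact_mod_cast le_top)
    obtain ⟨K, hK⟩ := hcs.exists_bound_of_continuous hco
    refine ⟨K, fun N x => ?_⟩
    have := iteratedFDeriv_comp_const_smul (s N)
      (hχ.of_le (m := (i : WithTop ℕ∞)) (by exact_mod_cast le_top))
    have h2 : iteratedFDeriv ℝ i (c N) x = s N ^ i • iteratedFDeriv ℝ i (χ : X → ℝ) (s N • x) :=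
      congrFun this x
    rw [h2, norm_smul, norm_pow, Real.norm_of_nonneg (hs0 N).le]
    calc s N ^ i * _ ≤ 1 * K := by
          gcongr
          · exact pow_le_one₀ (hs0 N).le (hs1 N)
          · exact hK _
      _ = K := one_mul _
  choose K hK using hB
  let bound : X → ℝ := fun x => ‖A‖ * ∑ i ∈ Finset.range (k + 1),
      (k.choose i : ℝ) * K i * ‖iteratedFDeriv ℝ (k - i) u x‖
  have hbi : Integrable bound := by
    apply Integrable.const_mul
    apply integrable_finsetSum
    intro i _
    apply Integrable.const_mul
    simpa using u.integrable_pow_mul_iteratedFDeriv volume 0 (k - i)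
  have hbd : ∀ N x, ‖A.app (w N) x‖ ≤ bound x := by
    intro N x
    refine (A.le_opNorm _).trans ?_
    apply mul_le_mul_of_nonneg_left _ (norm_nonneg _)
    refine (norm_iteratedFDeriv_smul_le (hc N) hu x (n := k) (by exact_mod_cast le_top)).trans ?_
    gcongr with i hi
    exact hK i N x
  have hmeas : ∀ {f : X → V} (_ : ContDiff ℝ (⊤ : ℕ∞) f) (i : ℕ), Continuous (iteratedFDeriv ℝ i f) :=
    fun hf i => hf.continuous_iteratedFDeriv (by exact_mod_cast le_top)
  have hR : Tendsto (fun N => ∫⁻ x, (‖A.app (w N) x‖₊ : ℝ≥0∞)) atTop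
      (𝓝 (∫⁻ x, (‖A.app u x‖₊ : ℝ≥0∞))) := by
    apply tendsto_lintegral_of_dominated_convergence (fun x => ENNReal.ofReal (bound x))
    · intro N
      have : Continuous (A.app (w N)) := A.continuous.comp (hmeas (hwt N).1 k)
      exact (this.nnnorm.measurable).coe_nnreal_ennreal
    · intro N
      refine Eventually.of_forall fun x => ?_
      show ‖A.app (w N) x‖ₑ ≤ _
      rw [← ofReal_norm]
      exact ENNReal.ofReal_le_ofReal (hbd N x)
    · exact (hbi.lintegral_lt_top).ne
    · refine Eventually.of_forall fun x => ?_
      apply tendsto_const_nhds.congr'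
      filter_upwards [hevD k x] with N hN
      simp [DiffOperator.app, hN]
  have hLm : ∀ N, Measurable fun x => (‖iteratedFDeriv ℝ j (w N) x‖₊ : ℝ≥0∞) ^ q / (‖x‖₊ : ℝ≥0∞) ^ a := by
    intro N
    have h1 := ((hmeas (hwt N).1 j).nnnorm.measurable).coe_nnreal_ennreal
    exact (h1.pow_const q).div ((measurable_nnnorm.coe_nnreal_ennreal).pow_const a)
  have hq0 : 0 < q := by linarith
  have hF : ∫⁻ x, (‖iteratedFDeriv ℝ j u x‖₊ : ℝ≥0∞) ^ q / (‖x‖₊ : ℝ≥0∞) ^ a ≤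
      liminf (fun N => ∫⁻ x, (‖iteratedFDeriv ℝ j (w N) x‖₊ : ℝ≥0∞) ^ q / (‖x‖₊ : ℝ≥0∞) ^ a) atTop := by
    refine le_trans (lintegral_mono fun x => ?_) (lintegral_liminf_le hLm)
    have : Tendsto (fun N => (‖iteratedFDeriv ℝ j (w N) x‖₊ : ℝ≥0∞) ^ q / (‖x‖₊ : ℝ≥0∞) ^ a) atTop
        (𝓝 ((‖iteratedFDeriv ℝ j u x‖₊ : ℝ≥0∞) ^ q / (‖x‖₊ : ℝ≥0∞) ^ a)) := by
      apply tendsto_const_nhds.congr'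
      filter_upwards [hevD j x] with N hN
      rw [hN]
    exact this.liminf_eq.ge
  have hRq : Tendsto (fun N => (ENNReal.ofReal C * ∫⁻ x, (‖A.app (w N) x‖₊ : ℝ≥0∞)) ^ q) atTop
      (𝓝 ((ENNReal.ofReal C * ∫⁻ x, (‖A.app u x‖₊ : ℝ≥0∞)) ^ q)) := by
    apply (ENNReal.continuous_rpow_const).continuousAt.tendsto.comp
    exact ENNReal.Tendsto.const_mul hR (Or.inr ENNReal.ofReal_ne_top)
  have hle : ∀ N, ∫⁻ x, (‖iteratedFDeriv ℝ j (w N) x‖₊ : ℝ≥0∞) ^ q / (‖x‖₊ : ℝ≥0∞) ^ a ≤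
      (ENNReal.ofReal C * ∫⁻ x, (‖A.app (w N) x‖₊ : ℝ≥0∞)) ^ q := by
    intro N
    have := hest (w N) (hwt N)
    rw [one_div] at this
    exact (ENNReal.rpow_inv_le_iff hq0).1 this
  rw [one_div, ENNReal.rpow_inv_le_iff hq0]
  refine hF.trans ?_
  rw [← hRq.liminf_eq]
  exact liminf_le_liminf (Eventually.of_forall hle)
open FourierTransform Complex in
lemma aux_fourier_rep
    {X V : Type*} [NormedAddCommGroup X] [InnerProductSpace ℝ X] [FiniteDimensional ℝ X]
    [MeasurableSpace X] [BorelSpace X]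
    [NormedAddCommGroup V] [InnerProductSpace ℝ V] [FiniteDimensional ℝ V]
    (h : X → V) (hh : ContDiff ℝ (⊤ : ℕ∞) h) (hc : HasCompactSupport h) (c : ℂ) :
    ∃ u : SchwartzMap X V, ∀ (j : ℕ) (x : X) (y : Fin j → X) (v : V),
      ⟪v, iteratedFDeriv ℝ j u x y⟫ =
        (c * ((-(2 * Real.pi * I)) ^ j *
          𝓕 (fun ξ => (((∏ i, ⟪ξ, y i⟫) * ⟪v, h ξ⟫ : ℝ) : ℂ)) x)).re := by
  let b := stdOrthonormalBasis ℝ V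
  have hs : ∀ i, ContDiff ℝ (⊤ : ℕ∞) (fun ξ => ((⟪b i, h ξ⟫ : ℝ) : ℂ)) := fun i =>
    ofRealCLM.contDiff.comp (contDiff_const.inner ℝ hh)
  have hcs : ∀ i, HasCompactSupport (fun ξ => ((⟪b i, h ξ⟫ : ℝ) : ℂ)) := fun i =>
    hc.comp_left (g := fun z => ((⟪b i, z⟫ : ℝ) : ℂ)) (by simp)
  let f : Fin (Module.finrank ℝ V) → SchwartzMap X ℂ := fun i => (hcs i).toSchwartzMap (hs i)
  let T : Fin (Module.finrank ℝ V) → ℂ →L[ℝ] V := fun i =>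
    (reCLM.comp (ContinuousLinearMap.mul ℝ ℂ c)).smulRight (b i)
  let U : Fin (Module.finrank ℝ V) → SchwartzMap X V := fun i =>
    SchwartzMap.postcompCLM (𝕜 := ℝ) (T i) (𝓕 (f i))
  refine ⟨∑ i, U i, fun j x y v => ?_⟩
  have hco : ((∑ i, U i : SchwartzMap X V) : X → V) = fun x => ∑ i, U i x := by
    ext x; simp
  have hUco : ∀ i, (U i : X → V) = T i ∘ 𝓕 (f i : X → ℂ) := by
    intro i; rfl
  have hfs : ∀ i, ContDiff ℝ (⊤ : ℕ∞) (𝓕 (f i : X → ℂ)) := by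
    intro i
    rw [← SchwartzMap.fourier_coe]
    exact (𝓕 (f i)).smooth _
  have hD : ∀ i, iteratedFDeriv ℝ j (𝓕 (f i : X → ℂ)) x y =
      (-(2 * Real.pi * I)) ^ j * ∫ ξ, Real.fourierChar (-⟪ξ, x⟫) •
        (((∏ l, ⟪ξ, y l⟫ : ℝ) : ℂ) * ((⟪b i, h ξ⟫ : ℝ) : ℂ)) := by
    intro i
    have h1 := Real.iteratedFDeriv_fourier (f := (f i : X → ℂ)) (N := ⊤)
      (fun n _ => (f i).integrable_pow_mul volume n) (f i).continuous.aestronglyMeasurable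
      (n := j) (by exact_mod_cast le_top)
    rw [h1, Real.fourier_continuousMultilinearMap_apply, Real.fourier_eq, ← integral_const_mul]
    · congr 1
      ext ξ
      simp only [VectorFourier.fourierPowSMulRight_apply]
      simp only [f, HasCompactSupport.toSchwartzMap_toFun, smul_eq_mul, Circle.smul_def, real_smul]
      rw [show (∏ l, ((innerSL ℝ) ξ) (y l) : ℝ) = ∏ l, ⟪ξ, y l⟫ from rfl]
      ring
    · exact VectorFourier.integrable_fourierPowSMulRight (innerSL ℝ)
        ((f i).integrable_pow_mul volume j) (f i).continuous.aestronglyMeasurable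
  have hL : iteratedFDeriv ℝ j (∑ i, U i : SchwartzMap X V) x =
      ∑ i, (T i).compContinuousMultilinearMap (iteratedFDeriv ℝ j (𝓕 (f i : X → ℂ)) x) := by
    rw [hco]
    rw [iteratedFDeriv_sum (fun i _ => ((U i).smooth j))]
    rw [Finset.sum_apply]
    apply Finset.sum_congr rfl
    intro i _
    rw [hUco, ContinuousLinearMap.iteratedFDeriv_comp_left (n := ((⊤ : ℕ∞) : WithTop ℕ∞)) _ (hfs i).contDiffAt
      (by exact_mod_cast le_top)]
  rw [hL, sum_apply, inner_sum]
  simp only [ContinuousLinearMap.compContinuousMultilinearMap_coe, Function.comp_apply, hD]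
  have hInteg : ∀ i, Integrable (fun ξ => Real.fourierChar (-⟪ξ, x⟫) •
        (((∏ l, ⟪ξ, y l⟫ : ℝ) : ℂ) * ((⟪b i, h ξ⟫ : ℝ) : ℂ))) := by
    intro i
    apply Continuous.integrable_of_hasCompactSupport
    · have := (hs i).continuous
      have h2 : Continuous fun ξ : X => Real.fourierChar (-⟪ξ, x⟫) :=
        Real.continuous_fourierChar.comp (by fun_prop)
      refine h2.smul (Continuous.mul ?_ this)
      exact continuous_ofReal.comp (by fun_prop)
    · exact ((hcs i).mul_left).smul_left
  have hR : 𝓕 (fun ξ => (((∏ i, ⟪ξ, y i⟫) * ⟪v, h ξ⟫ : ℝ) : ℂ)) x =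
      ∑ i, (⟪v, b i⟫ : ℝ) * ∫ ξ, Real.fourierChar (-⟪ξ, x⟫) •
        (((∏ l, ⟪ξ, y l⟫ : ℝ) : ℂ) * ((⟪b i, h ξ⟫ : ℝ) : ℂ)) := by
    simp_rw [← integral_const_mul]
    rw [← integral_finsetSum _ (fun i _ => (hInteg i).const_mul _), Real.fourier_eq]
    congr 1
    ext ξ
    rw [← b.sum_inner_mul_inner v (h ξ)]
    push_cast
    simp only [Circle.smul_def, smul_eq_mul, Finset.mul_sum]
    apply Finset.sum_congr rfl
    intro i _
    ring
  rw [hR, Finset.mul_sum, Finset.mul_sum, re_sum]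
  apply Finset.sum_congr rfl
  intro i _
  simp only [T, ContinuousLinearMap.smulRight_apply, ContinuousLinearMap.comp_apply,
    ContinuousLinearMap.mul_apply', reCLM_apply, inner_smul_right]
  rw [mul_comm, ← re_ofReal_mul]
  congr 1
  ring
lemma aux_lintegral_smul
    {X : Type*} [NormedAddCommGroup X] [InnerProductSpace ℝ X] [FiniteDimensional ℝ X]
    [MeasurableSpace X] [BorelSpace X] (f : X → ℝ≥0∞) {R : ℝ} (hR : 0 < R) :
    ∫⁻ x, f (R • x) = ENNReal.ofReal ((R ^ Module.finrank ℝ X)⁻¹) * ∫⁻ x, f x := by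
  calc ∫⁻ x, f (R • x) = ∫⁻ y, f y ∂Measure.map (fun x => R • x) volume :=
        (lintegral_map_equiv f
          (Homeomorph.smul (isUnit_iff_ne_zero.2 hR.ne').unit).toMeasurableEquiv).symm
    _ = _ := by
      rw [Measure.map_addHaar_smul volume hR.ne', lintegral_smul_measure,
        abs_of_pos (by positivity), smul_eq_mul]

open FourierTransform in
lemma aux_fourier_smul
    {X : Type*} [NormedAddCommGroup X] [InnerProductSpace ℝ X] [FiniteDimensional ℝ X]
    [MeasurableSpace X] [BorelSpace X] (f : X → ℂ) {R : ℝ} (hR : 0 < R) (x : X) :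
    𝓕 (fun ξ => f (R • ξ)) x = (((R ^ Module.finrank ℝ X)⁻¹ : ℝ) : ℂ) * 𝓕 f (R⁻¹ • x) := by
  rw [Real.fourier_eq, Real.fourier_eq]
  have := Measure.integral_comp_smul (volume : Measure X)
    (fun ξ => Real.fourierChar (-⟪ξ, R⁻¹ • x⟫) • f ξ) R
  rw [abs_of_pos (by positivity)] at this
  rw [← Complex.real_smul, ← this]
  congr 1
  ext ξ
  simp only [inner_smul_left, inner_smul_right]
  congr 3
  simp
  field_simp

open FourierTransform in
lemma aux_L1_bound
    {X : Type*} [NormedAddCommGroup X] [InnerProductSpace ℝ X] [FiniteDimensional ℝ X]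
    [MeasurableSpace X] [BorelSpace X] (f : X → ℂ) (hf : Integrable f) {R : ℝ} (hR : 0 < R) :
    ∫⁻ x, ‖𝓕 (fun ξ => f ξ - f (R • ξ)) x‖ₑ ≤ 2 * ∫⁻ x, ‖𝓕 f x‖ₑ := by
  have hfR : Integrable (fun ξ => f (R • ξ)) := hf.comp_smul hR.ne'
  have hcont : Continuous (𝓕 f) := by
    apply VectorFourier.fourierIntegral_continuous Real.continuous_fourierChar
      (by exact continuous_inner) hf
  have h1 : ∀ x, 𝓕 (fun ξ => f ξ - f (R • ξ)) x = 𝓕 f x - 𝓕 (fun ξ => f (R • ξ)) x := by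
    intro x
    rw [Real.fourier_eq, Real.fourier_eq, Real.fourier_eq, ← integral_sub]
    · simp only [smul_sub]
    · exact (Real.fourierIntegral_convergent_iff x).2 hf
    · exact (Real.fourierIntegral_convergent_iff x).2 hfR
  calc ∫⁻ x, ‖𝓕 (fun ξ => f ξ - f (R • ξ)) x‖ₑ
      ≤ ∫⁻ x, (‖𝓕 f x‖ₑ + ‖𝓕 (fun ξ => f (R • ξ)) x‖ₑ) := by
        apply lintegral_mono
        intro x
        simp only [h1]
        exact enorm_sub_le
    _ = (∫⁻ x, ‖𝓕 f x‖ₑ) + ∫⁻ x, ‖𝓕 (fun ξ => f (R • ξ)) x‖ₑ :=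
        lintegral_add_left hcont.enorm.measurable _
    _ = (∫⁻ x, ‖𝓕 f x‖ₑ) + ∫⁻ x, ‖𝓕 f x‖ₑ := by
        congr 1
        simp_rw [aux_fourier_smul f hR, enorm_mul]
        rw [lintegral_const_mul' _ _ (by simp),
          aux_lintegral_smul (fun x => ‖𝓕 f x‖ₑ) (inv_pos.2 hR), ← mul_assoc]
        rw [← ofReal_norm, Complex.norm_real, Real.norm_of_nonneg (by positivity),
          ← ENNReal.ofReal_mul (by positivity)]
        rw [inv_pow, inv_inv, inv_mul_cancel₀ (by positivity)]
        simp
    _ = _ := (two_mul _).symm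

open Filter Topology in
lemma aux_smul_contDiff {X V : Type*} [NormedAddCommGroup X] [InnerProductSpace ℝ X]
    [NormedAddCommGroup V] [NormedSpace ℝ V] (g : X → ℝ) (m : X → V)
    (hg : ContDiff ℝ (⊤ : ℕ∞) g) (hg0 : g =ᶠ[𝓝 0] 0)
    (hm : ∀ ξ, ξ ≠ 0 → ContDiffAt ℝ (⊤ : ℕ∞) m ξ) :
    ContDiff ℝ (⊤ : ℕ∞) (fun ξ => g ξ • m ξ) := by
  rw [contDiff_iff_contDiffAt]
  intro ξ
  by_cases h : ξ = 0
  · subst h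
    have : (fun ξ => g ξ • m ξ) =ᶠ[𝓝 0] fun _ => (0 : V) := by
      filter_upwards [hg0] with ξ hξ
      simp [hξ]
    exact contDiffAt_const.congr_of_eventuallyEq this
  · exact hg.contDiffAt.smul (hm ξ h)

open FourierTransform Complex Filter Topology in
lemma aux_app
    {X V E : Type*} [NormedAddCommGroup X] [InnerProductSpace ℝ X] [FiniteDimensional ℝ X]
    [MeasurableSpace X] [BorelSpace X]
    [NormedAddCommGroup V] [InnerProductSpace ℝ V] [FiniteDimensional ℝ V]
    [NormedAddCommGroup E] [InnerProductSpace ℝ E] [FiniteDimensional ℝ E]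
    {k : ℕ} (A : DiffOperator X k V E) (e : E) (m : X → V)
    (hme : ∀ ξ, ξ ≠ 0 → A.symbol ξ (m ξ) = e)
    (hm : ∀ ξ, ξ ≠ 0 → ContDiffAt ℝ (⊤ : ℕ∞) m ξ)
    (g : X → ℝ) (hg : ContDiff ℝ (⊤ : ℕ∞) g) (hg0 : g =ᶠ[𝓝 0] 0) (hgc : HasCompactSupport g) :
    ∃ u : SchwartzMap X V, (∀ x, A.app u x = (𝓕 (fun ξ => (g ξ : ℂ)) x).re • e) ∧
      ∀ (j : ℕ) (x : X) (y : Fin j → X) (v : V),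
      ⟪v, iteratedFDeriv ℝ j u x y⟫ =
        (((-(2 * Real.pi * I)) ^ k)⁻¹ * ((-(2 * Real.pi * I)) ^ j *
          𝓕 (fun ξ => (((∏ i, ⟪ξ, y i⟫) * ⟪v, g ξ • m ξ⟫ : ℝ) : ℂ)) x)).re := by
  have hh := aux_smul_contDiff g m hg hg0 hm
  have hhc : HasCompactSupport (fun ξ => g ξ • m ξ) := hgc.smul_right
  obtain ⟨u, hu⟩ := aux_fourier_rep _ hh hhc (((-(2 * Real.pi * I)) ^ k)⁻¹)
  refine ⟨u, fun x => ?_, hu⟩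
  have hchar : Continuous fun ξ : X => (Real.fourierChar (-⟪ξ, x⟫) : ℂ) :=
    continuous_subtype_val.comp (Real.continuous_fourierChar.comp (by fun_prop))
  have hTc : Continuous fun ξ => auxT k ξ (g ξ • m ξ) := by
    have h1 := (ContinuousMultilinearMap.compContinuousLinearMapContinuousMultilinear ℝ
      (fun _ : Fin k => X) (fun _ : Fin k => ℝ) V).cont
    have h2 : Continuous fun ξ : X => (fun _ : Fin k => innerSL ℝ ξ) :=
      continuous_pi fun _ => (innerSL ℝ (E := X)).continuous
    have h3 := h1.comp h2
    have h4 := (ContinuousMultilinearMap.piFieldEquiv ℝ (Fin k) V).continuous.comp hh.continuous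
    exact h3.clm_apply h4
  have hInteg : Integrable fun ξ => (Real.fourierChar (-⟪ξ, x⟫) : ℂ).re •
      auxT k ξ (g ξ • m ξ) := by
    apply Continuous.integrable_of_hasCompactSupport
    · exact (continuous_re.comp hchar).smul hTc
    · refine hgc.mono fun ξ hξ => ?_
      contrapose! hξ
      have h0 : g ξ = 0 := by simpa using hξ
      rw [Function.mem_support, not_not]
      ext y
      rw [smul_apply, auxT_apply, h0]
      simp
  have hD : iteratedFDeriv ℝ k u x = ∫ ξ, (Real.fourierChar (-⟪ξ, x⟫) : ℂ).re •
      auxT k ξ (g ξ • m ξ) := by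
    ext y
    apply ext_inner_left ℝ
    intro v
    rw [hu, ContinuousMultilinearMap.integral_apply hInteg, ← integral_inner]
    · have hne : (-(2 * Real.pi * I)) ^ k ≠ 0 := by
        apply pow_ne_zero
        simp [Real.pi_ne_zero]
      rw [inv_mul_cancel_left₀ hne, Real.fourier_eq, ← reCLM_apply,
        ← ContinuousLinearMap.integral_comp_comm]
      · congr 1
        ext ξ
        simp only [reCLM_apply, smul_apply, auxT_apply, inner_smul_right,
          Circle.smul_def, smul_eq_mul, re_mul_ofReal]
      · rw [Real.fourierIntegral_convergent_iff]
        apply Continuous.integrable_of_hasCompactSupport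
        · have := hh.continuous
          exact continuous_ofReal.comp (by fun_prop)
        · apply hgc.mono
          intro ξ hξ
          contrapose! hξ
          have : g ξ = 0 := by simpa using hξ
          simp [this]
    · exact (ContinuousMultilinearMap.apply ℝ (fun _ : Fin k => X) V y).integrable_comp hInteg
  rw [DiffOperator.app, hD, ← ContinuousLinearMap.integral_comp_comm _ hInteg, Real.fourier_eq,
    ← reCLM_apply, ← ContinuousLinearMap.integral_comp_comm, ← integral_smul_const]
  · congr 1
    ext ξ
    rw [map_smul, ← aux_symbol_apply, map_smul]
    by_cases h : ξ = 0
    · have : g ξ = 0 := by rw [h]; exact hg0.eq_of_nhds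
      simp [this]
    · rw [hme ξ h, smul_smul]
      simp [Circle.smul_def]
  · rw [Real.fourierIntegral_convergent_iff]
    exact (hg.continuous.integrable_of_hasCompactSupport hgc).ofReal
lemma aux_int_base
    {X : Type*} [NormedAddCommGroup X] [InnerProductSpace ℝ X] [FiniteDimensional ℝ X]
    [MeasurableSpace X] [BorelSpace X] {p : ℕ} (hp : p < Module.finrank ℝ X) :
    Integrable (fun x : X => (Set.Iio (1 : ℝ)).indicator (fun y => (y ^ p)⁻¹) ‖x‖) := by
  have : Nontrivial X := Module.nontrivial_of_finrank_pos (R := ℝ) (by omega)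
  rw [integrable_fun_norm_addHaar volume (f := (Set.Iio (1 : ℝ)).indicator (fun y => (y ^ p)⁻¹))]
  have h1 : IntegrableOn (fun _ : ℝ => (1 : ℝ)) (Set.Ioo 0 1) := by simp
  have h2 : Integrable ((Set.Ioo (0 : ℝ) 1).indicator (fun _ : ℝ => (1 : ℝ))) :=
    h1.integrable_indicator measurableSet_Ioo
  refine (h2.integrableOn (s := Set.Ioi 0)).mono' ?_ ?_
  · apply Measurable.aestronglyMeasurable
    have hm : Measurable ((Set.Iio (1 : ℝ)).indicator (fun y => (y ^ p)⁻¹)) :=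
      Measurable.indicator (by fun_prop) measurableSet_Iio
    exact (measurable_id.pow_const _).mul hm
  · refine (ae_restrict_mem measurableSet_Ioi).mono fun y hy => ?_
    have hy0 : (0 : ℝ) < y := hy
    by_cases h : y < 1
    · rw [Set.indicator_of_mem (show y ∈ Set.Iio 1 from h),
        Set.indicator_of_mem (show y ∈ Set.Ioo 0 1 from ⟨hy0, h⟩), smul_eq_mul,
        Real.norm_of_nonneg (by positivity), ← div_eq_mul_inv, div_le_one (by positivity)]
      exact pow_le_pow_of_le_one hy0.le h.le (by omega)
    · rw [Set.indicator_of_notMem (show y ∉ Set.Iio 1 from h)]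
      simp only [smul_zero, norm_zero]
      exact Set.indicator_nonneg (by simp) _

lemma aux_int_p
    {X F : Type*} [NormedAddCommGroup X] [InnerProductSpace ℝ X] [FiniteDimensional ℝ X]
    [MeasurableSpace X] [BorelSpace X] [NormedAddCommGroup F]
    {p : ℕ} (hp : p < Module.finrank ℝ X)
    (φ : X → F) (hφ : Integrable φ) (K : ℝ) (hK : ∀ x, ‖φ x‖ ≤ K) :
    Integrable (fun x => (‖x‖ ^ p)⁻¹ * ‖φ x‖) := by
  have hK0 : 0 ≤ K := (norm_nonneg _).trans (hK 0)
  refine (((aux_int_base hp).const_mul K).add hφ.norm).mono' ?_ (Filter.Eventually.of_forall fun x => ?_)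
  · exact (Measurable.aestronglyMeasurable (by fun_prop)).mul hφ.1.norm
  · simp only [Pi.add_apply]
    rw [Real.norm_of_nonneg (by positivity)]
    by_cases h : ‖x‖ < 1
    · rw [Set.indicator_of_mem (show ‖x‖ ∈ Set.Iio 1 from h)]
      have : (‖x‖ ^ p)⁻¹ * ‖φ x‖ ≤ (‖x‖ ^ p)⁻¹ * K := by gcongr; exact hK x
      nlinarith [norm_nonneg (φ x)]
    · rw [Set.indicator_of_notMem (show ‖x‖ ∉ Set.Iio 1 from h)]
      have h1 : (1 : ℝ) ≤ ‖x‖ ^ p := one_le_pow₀ (not_lt.1 h)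
      have h2 : (‖x‖ ^ p)⁻¹ ≤ 1 := inv_le_one_of_one_le₀ h1
      have := mul_le_mul_of_nonneg_right h2 (norm_nonneg (φ x))
      linarith

lemma aux_M_bound
    {X : Type*} [NormedAddCommGroup X] [InnerProductSpace ℝ X] [FiniteDimensional ℝ X]
    {l : ℕ} (M : X → ℝ) (hMc : ContinuousOn M {0}ᶜ)
    (hMh : ∀ (t : ℝ) (ξ : X), t ≠ 0 → ξ ≠ 0 → M (t • ξ) = (t ^ l)⁻¹ * M ξ) :
    ∃ K : ℝ, 0 ≤ K ∧ ∀ ξ, ξ ≠ 0 → |M ξ| ≤ K * (‖ξ‖ ^ l)⁻¹ := by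
  have hs : IsCompact (Metric.sphere (0 : X) 1) := isCompact_sphere _ _
  have hc : ContinuousOn M (Metric.sphere (0 : X) 1) := hMc.mono fun x hx => by
    have : ‖x‖ = 1 := by simpa using hx
    simp only [Set.mem_compl_iff, Set.mem_singleton_iff]
    rintro rfl
    simp at this
  obtain ⟨K, hK⟩ := hs.exists_bound_of_continuousOn hc
  refine ⟨max K 0, le_max_right _ _, fun ξ hξ => ?_⟩
  have hn : 0 < ‖ξ‖ := norm_pos_iff.2 hξ
  have h1 := hMh ‖ξ‖⁻¹ ξ (by positivity) hξ
  have h2 := hK (‖ξ‖⁻¹ • ξ) (by simp [norm_smul, hn.ne'])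
  rw [h1, Real.norm_eq_abs, abs_mul, abs_of_pos (by positivity), inv_pow, inv_inv] at h2
  rw [← div_eq_mul_inv, le_div_iff₀ (by positivity), mul_comm]
  exact h2.trans (le_max_left _ _)

lemma aux_etaM_int
    {X : Type*} [NormedAddCommGroup X] [InnerProductSpace ℝ X] [FiniteDimensional ℝ X]
    [MeasurableSpace X] [BorelSpace X] {l : ℕ} (hl : l < Module.finrank ℝ X)
    (M : X → ℝ) (hMc : ContinuousOn M {0}ᶜ)
    (hMh : ∀ (t : ℝ) (ξ : X), t ≠ 0 → ξ ≠ 0 → M (t • ξ) = (t ^ l)⁻¹ * M ξ)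
    (η : X → ℝ) (hη : Continuous η) (hηc : HasCompactSupport η) :
    Integrable (fun ξ => η ξ * M ξ) := by
  have : Nontrivial X := Module.nontrivial_of_finrank_pos (R := ℝ) (by omega)
  obtain ⟨K, hK0, hK⟩ := aux_M_bound M hMc hMh
  obtain ⟨B, hB⟩ := hηc.exists_bound_of_continuous hη
  have hi := aux_int_p hl η (hη.integrable_of_hasCompactSupport hηc) B hB
  have hae : ∀ᵐ ξ : X, ξ ≠ 0 := by
    simp [ae_iff]
  refine (hi.const_mul K).mono' ?_ ?_
  · refine hη.aestronglyMeasurable.mul ?_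
    have h1 : AEStronglyMeasurable M (volume.restrict ({0}ᶜ : Set X)) :=
      hMc.aestronglyMeasurable (measurableSet_singleton _).compl
    rwa [restrict_compl_singleton] at h1
  · filter_upwards [hae] with ξ hξ
    rw [norm_mul, Real.norm_eq_abs (M ξ)]
    have := mul_le_mul_of_nonneg_left (hK ξ hξ) (norm_nonneg (η ξ))
    linarith
lemma aux_young {t ε q : ℝ} (ht : 0 ≤ t) (hε : 0 < ε) (hq : 1 ≤ q) :
    t ≤ ε + ε ^ (1 - q) * t ^ q := by
  by_cases h : t ≤ ε
  · have : 0 ≤ ε ^ (1 - q) * t ^ q := by positivity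
    linarith
  · push Not at h
    have ht0 : 0 < t := hε.trans h
    have h1 : t ^ (1 - q) ≤ ε ^ (1 - q) := Real.rpow_le_rpow_of_nonpos hε h.le (by linarith)
    have h2 : t = t ^ (1 - q) * t ^ q := by
      rw [← Real.rpow_add ht0]; simp
    have h3 : t ^ (1 - q) * t ^ q ≤ ε ^ (1 - q) * t ^ q := by gcongr
    linarith

/-- pointwise inequality -/
lemma aux_pointwise {d l : ℕ} (hl : l ≤ d) {q ε r W lam : ℝ} (hq : 1 ≤ q) (hε : 0 < ε) (hr : 0 < r)
    (hW : 0 ≤ W) (hlam : 0 < lam) :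
    lam ^ (d - l) * W ≤ ε * (r ^ (d - l))⁻¹ + ε ^ (1 - q) *
      (lam ^ d * (W ^ q / (lam * r) ^ ((d : ℝ) - ((d : ℝ) - l) * q)) * r ^ l) := by
  have hlr : 0 < lam * r := by positivity
  have hy := aux_young (t := W * (lam * r) ^ (d - l)) (by positivity) hε hq
  have h1 : (W * (lam * r) ^ (d - l)) ^ q =
      (lam ^ d * (W ^ q / (lam * r) ^ ((d : ℝ) - ((d : ℝ) - l) * q)) * r ^ l) * r ^ (d - l) := by
    have e1 : ((lam * r) ^ (d - l)) ^ q = (lam * r) ^ (((d : ℝ) - l) * q) := by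
      rw [← Real.rpow_natCast, ← Real.rpow_mul hlr.le, Nat.cast_sub hl]
    have e2 : r ^ l * r ^ (d - l) = r ^ d := by
      rw [← pow_add]; congr 1; omega
    rw [Real.mul_rpow hW (by positivity), e1, Real.rpow_sub hlr, Real.rpow_natCast]
    rw [mul_assoc _ (r ^ l), e2]
    have : (lam * r) ^ (((d : ℝ) - l) * q) ≠ 0 := (Real.rpow_pos_of_pos hlr _).ne'
    rw [mul_pow]
    field_simp
  rw [h1, mul_pow] at hy
  have hrp : 0 < r ^ (d - l) := by positivity
  refine le_of_mul_le_mul_right ?_ hrp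
  rw [add_mul, mul_assoc ε, inv_mul_cancel₀ hrp.ne', mul_assoc (ε ^ (1 - q))]
  linarith

open FourierTransform Filter Topology in
lemma aux_final
    {X : Type*} [NormedAddCommGroup X] [InnerProductSpace ℝ X] [FiniteDimensional ℝ X]
    [MeasurableSpace X] [BorelSpace X] {l d : ℕ} (hd : Module.finrank ℝ X = d)
    (hl1 : 1 ≤ l) (hl : l < d) {q : ℝ} (hq : 1 ≤ q)
    (M : X → ℝ) (hMc : ContinuousOn M {0}ᶜ)
    (hMh : ∀ (t : ℝ) (ξ : X), t ≠ 0 → ξ ≠ 0 → M (t • ξ) = (t ^ l)⁻¹ * M ξ)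
    (η : X → ℝ) (hη : Continuous η) (hηc : HasCompactSupport η) (hη1 : ∀ ξ, ‖ξ‖ ≤ 1 → η ξ = 1)
    (hfin : ∫⁻ x, ‖𝓕 (fun ξ => ((η ξ * M ξ : ℝ) : ℂ)) x‖ₑ ^ q
      / ‖x‖ₑ ^ ((d : ℝ) - ((d : ℝ) - l) * q) < ∞)
    (θ : SchwartzMap X ℂ) (hθ : HasCompactSupport θ) :
    ∫ ξ, (M ξ : ℂ) * θ ξ = 0 := by
  subst hd
  set d := Module.finrank ℝ X with hd
  set a : ℝ := (d : ℝ) - ((d : ℝ) - l) * q with ha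
  have : Nontrivial X := Module.nontrivial_of_finrank_pos (R := ℝ) (by omega)
  have hae : ∀ᵐ ξ : X, ξ ≠ 0 := by simp [ae_iff]
  set h : X → ℂ := fun ξ => ((η ξ * M ξ : ℝ) : ℂ) with hh
  have hInteg : Integrable h := (aux_etaM_int hl M hMc hMh η hη hηc).ofReal
  set W : X → ℂ := 𝓕 h with hWdef
  have hWc : Continuous W :=
    VectorFourier.fourierIntegral_continuous Real.continuous_fourierChar
      (by exact continuous_inner) hInteg
  have hq0 : 0 < q := by linarith
  let Fr : X → ℝ := fun y => ‖W y‖ ^ q / ‖y‖ ^ a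
  have hFrm : Measurable Fr := (hWc.norm.measurable.pow_const q).div (measurable_norm.pow_const a)
  have hFr : Integrable Fr := by
    refine ⟨hFrm.aestronglyMeasurable, ?_⟩
    refine lt_of_le_of_lt (le_of_eq ?_) hfin
    apply lintegral_congr_ae
    filter_upwards [hae] with y hy
    have hy' : 0 < ‖y‖ := norm_pos_iff.2 hy
    rw [← ofReal_norm (Fr y), Real.norm_of_nonneg (by positivity),
      ENNReal.ofReal_div_of_pos (by positivity),
      ← ENNReal.ofReal_rpow_of_nonneg (norm_nonneg _) hq0.le,
      ← ENNReal.ofReal_rpow_of_pos hy', ofReal_norm, ofReal_norm]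
  set φ : SchwartzMap X ℂ := 𝓕⁻ θ with hφ
  have hφθ : 𝓕 φ = θ := FourierTransform.fourier_fourierInv_eq θ
  -- boundedness
  obtain ⟨B, hB⟩ : ∃ B : ℝ, ∀ x, ‖φ x‖ ≤ B := by
    obtain ⟨C, _, hC⟩ := φ.decay 0 0
    exact ⟨C, by simpa using hC⟩
  obtain ⟨G0, hG0⟩ : ∃ B : ℝ, ∀ x, ‖x‖ ^ l * ‖φ x‖ ≤ B := by
    obtain ⟨C, _, hC⟩ := φ.decay l 0
    exact ⟨C, by simpa using hC⟩
  let G : X → ℝ := fun x => ‖x‖ ^ l * ‖φ x‖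
  have hGc : Continuous G := by
    have := φ.continuous
    fun_prop
  have hc0 : Integrable (fun x => (‖x‖ ^ (d - l))⁻¹ * ‖φ x‖) :=
    aux_int_p (by omega) φ φ.integrable B hB
  -- pairing identity
  have hpair : ∀ᶠ N : ℕ in atTop, ∫ ξ, (M ξ : ℂ) * θ ξ =
      ∫ x, ((((N : ℝ) + 1) ^ (d - l) : ℝ) : ℂ) * W (((N : ℝ) + 1) • x) * φ x := by
    obtain ⟨R, hR⟩ := hθ.isBounded.exists_norm_le
    obtain ⟨N0, hN0⟩ := exists_nat_ge R
    filter_upwards [eventually_ge_atTop N0] with N hN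
    set lam : ℝ := (N : ℝ) + 1 with hlam
    have hlam0 : 0 < lam := by positivity
    have h1 : ∀ x, 𝓕 (fun ξ => h (lam⁻¹ • ξ)) x = ((lam ^ d : ℝ) : ℂ) * W (lam • x) := by
      intro x
      rw [aux_fourier_smul h (inv_pos.2 hlam0), inv_inv, inv_pow, inv_inv]
    have h2 : ∫ x, 𝓕 (fun ξ => h (lam⁻¹ • ξ)) x * φ x = ∫ ξ, h (lam⁻¹ • ξ) * 𝓕 (φ : X → ℂ) ξ := by
      have := VectorFourier.integral_bilin_fourierIntegral_eq_flip (ContinuousLinearMap.mul ℂ ℂ)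
        (L := innerₗ X) (μ := volume) (ν := volume)
        Real.continuous_fourierChar continuous_inner (hInteg.comp_smul (inv_pos.2 hlam0).ne') φ.integrable
      simpa using! this
    have h3 : ∀ᵐ ξ : X, h (lam⁻¹ • ξ) * 𝓕 (φ : X → ℂ) ξ = ((lam ^ l : ℝ) : ℂ) * ((M ξ : ℂ) * θ ξ) := by
      filter_upwards [hae] with ξ hξ
      rw [← SchwartzMap.fourier_coe, hφθ]
      by_cases hz : θ ξ = 0
      · simp [hz]
      · have hb : ‖ξ‖ ≤ R := hR ξ (subset_tsupport _ hz)
        have hb2 : ‖lam⁻¹ • ξ‖ ≤ 1 := by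
          rw [norm_smul, Real.norm_of_nonneg (inv_pos.2 hlam0).le, inv_mul_le_iff₀ hlam0]
          have : (N0 : ℝ) ≤ N := by exact_mod_cast hN
          linarith
        simp only [hh]
        rw [hη1 _ hb2, hMh _ _ (inv_pos.2 hlam0).ne' hξ]
        rw [inv_pow, inv_inv]
        push_cast
        ring
    rw [integral_congr_ae h3, integral_const_mul] at h2
    have hl0 : ((lam ^ l : ℝ) : ℂ) ≠ 0 := by exact_mod_cast (pow_pos hlam0 l).ne'
    rw [← mul_right_inj' hl0, ← h2, ← integral_const_mul]
    congr 1
    ext x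
    rw [h1, ← mul_assoc, ← mul_assoc, ← Complex.ofReal_mul, ← pow_add]
    congr 5
    omega
  set P : ℝ := ‖∫ ξ, (M ξ : ℂ) * θ ξ‖ with hP
  set c0 : ℝ := ∫ x, (‖x‖ ^ (d - l))⁻¹ * ‖φ x‖ with hc0def
  let J : ℕ → ℝ := fun N => ∫ y, Fr y * G (((N : ℝ) + 1)⁻¹ • y)
  have hJ : Tendsto J atTop (𝓝 0) := by
    have h0 : (0 : ℝ) = ∫ y : X, (0 : ℝ) := by simp
    rw [h0]
    apply tendsto_integral_of_dominated_convergence (fun y => |Fr y| * G0)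
    · intro N
      exact (hFrm.mul (hGc.comp (continuous_const_smul _)).measurable).aestronglyMeasurable
    · exact hFr.abs.mul_const G0
    · intro N
      refine Eventually.of_forall fun y => ?_
      rw [norm_mul, Real.norm_eq_abs]
      apply mul_le_mul_of_nonneg_left _ (abs_nonneg _)
      rw [Real.norm_of_nonneg (by positivity)]
      exact hG0 _
    · refine Eventually.of_forall fun y => ?_
      have h1 : Tendsto (fun N : ℕ => ((N : ℝ) + 1)⁻¹ • y) atTop (𝓝 0) := by
        have := (tendsto_one_div_add_atTop_nhds_zero_nat (𝕜 := ℝ)).smul_const y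
        simpa using this
      have h2 := (hGc.tendsto 0).comp h1
      have h3 : G 0 = 0 := by simp [G, show l ≠ 0 by omega]
      rw [h3] at h2
      simpa using h2.const_mul (Fr y)
  have hbound : ∀ ε : ℝ, 0 < ε → P ≤ ε * c0 := by
    intro ε hε
    have hlim : Tendsto (fun N => ε * c0 + ε ^ (1 - q) * J N) atTop (𝓝 (ε * c0)) := by
      simpa using (hJ.const_mul (ε ^ (1 - q))).const_add (ε * c0)
    refine ge_of_tendsto hlim ?_
    filter_upwards [hpair] with N hN
    rw [hP, hN]
    set lam : ℝ := (N : ℝ) + 1 with hlam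
    have hlam0 : 0 < lam := by positivity
    have hi2 : Integrable (fun y => Fr y * G (lam⁻¹ • y)) := by
      refine hFr.mul_bdd (c := G0) ((hGc.comp (continuous_const_smul _)).aestronglyMeasurable) ?_
      refine Eventually.of_forall fun y => ?_
      rw [Real.norm_of_nonneg (by positivity)]
      exact hG0 _
    have hi3 : Integrable (fun x => Fr (lam • x) * G x) := by
      have := hi2.comp_smul hlam0.ne'
      simpa [smul_smul, hlam0.ne'] using this
    have hJN : J N = ∫ x, lam ^ d * (Fr (lam • x) * G x) := by
      rw [integral_const_mul]
      have := Measure.integral_comp_smul (volume : Measure X) (fun y => Fr y * G (lam⁻¹ • y)) lam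
      simp only [smul_smul, inv_mul_cancel₀ hlam0.ne', one_smul] at this
      rw [this, abs_of_pos (by positivity), smul_eq_mul, ← hd, mul_inv_cancel_left₀ (by positivity)]
    have hi4 : Integrable (fun x => ε * ((‖x‖ ^ (d - l))⁻¹ * ‖φ x‖)) := hc0.const_mul ε
    have hi5 : Integrable (fun x => ε ^ (1 - q) * (lam ^ d * (Fr (lam • x) * G x))) :=
      (hi3.const_mul _).const_mul _
    rw [hJN, hc0def, ← integral_const_mul, ← integral_const_mul, ← integral_add hi4 hi5]
    apply norm_integral_le_of_norm_le (hi4.add hi5)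
    filter_upwards [hae] with x hx
    have hx' : 0 < ‖x‖ := norm_pos_iff.2 hx
    have hpw := aux_pointwise (d := d) (l := l) hl.le hq hε hx' (norm_nonneg (W (lam • x))) hlam0
    rw [norm_mul, norm_mul, Complex.norm_real, Real.norm_of_nonneg (by positivity)]
    have := mul_le_mul_of_nonneg_right hpw (norm_nonneg (φ x))
    refine this.trans (le_of_eq ?_)
    simp only [Pi.add_apply, Fr, G, norm_smul, Real.norm_of_nonneg hlam0.le, ← ha]
    ring
  have hP0 : P ≤ 0 := by
    have hlim : Tendsto (fun ε : ℝ => ε * c0) (𝓝[>] 0) (𝓝 0) := by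
      have : Tendsto (fun ε : ℝ => ε * c0) (𝓝 0) (𝓝 (0 * c0)) := tendsto_id.mul_const c0
      rw [zero_mul] at this
      exact this.mono_left nhdsWithin_le_nhds
    refine ge_of_tendsto hlim ?_
    filter_upwards [self_mem_nhdsWithin] with ε hε
    exact hbound ε hε
  exact norm_le_zero_iff.1 hP0
open FourierTransform Complex in
/-- Fourier transforms of real functions with a parity. -/
lemma aux_parity
    {X : Type*} [NormedAddCommGroup X] [InnerProductSpace ℝ X] [FiniteDimensional ℝ X]
    [MeasurableSpace X] [BorelSpace X] {l : ℕ} (f : X → ℝ)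
    (hf : ∀ ξ, f (-ξ) = (-1) ^ l * f ξ) (x : X) :
    ‖𝓕 (fun ξ => (f ξ : ℂ)) x‖ ≤ (2 * Real.pi) ^ l *
      |(((-(2 * Real.pi * I)) ^ l)⁻¹ * 𝓕 (fun ξ => (f ξ : ℂ)) x).re| := by
  set F := 𝓕 (fun ξ => (f ξ : ℂ)) x with hF
  have h1 : (starRingEnd ℂ) F = (-1) ^ l * F := by
    rw [hF, Real.fourier_eq', ← integral_conj, ← integral_neg_eq_self, ← integral_const_mul]
    congr 1
    ext ξ
    rw [smul_eq_mul, smul_eq_mul, map_mul, ← Complex.exp_conj, hf]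
    simp [Complex.conj_ofNat]
    ring_nf
  set z := ((-(2 * Real.pi * I)) ^ l)⁻¹ * F with hz
  have hc : (-(2 * Real.pi * I)) ^ l ≠ 0 := by
    apply pow_ne_zero
    simp [Real.pi_ne_zero]
  have hFz : F = (-(2 * Real.pi * I)) ^ l * z := by rw [hz, mul_inv_cancel_left₀ hc]
  have h2 : (starRingEnd ℂ) z = z := by
    rw [hz, map_mul, map_inv₀, map_pow, h1]
    have : (starRingEnd ℂ) (-(2 * Real.pi * I)) = (-1) * (-(2 * Real.pi * I)) := by
      simp [Complex.conj_ofNat]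
    rw [this, mul_pow, mul_inv]
    have h3 : ((-1 : ℂ) ^ l)⁻¹ * (-1) ^ l = 1 := inv_mul_cancel₀ (by simp)
    linear_combination (((-(2 * Real.pi * I)) ^ l)⁻¹ * F) * h3
  have h3 : ‖z‖ = |z.re| := by
    conv_lhs => rw [← Complex.conj_eq_iff_re.1 h2]
    rw [Complex.norm_real, Real.norm_eq_abs]
  rw [hFz, norm_mul, norm_pow, h3]
  simp [abs_of_pos Real.pi_pos]

open FourierTransform Complex Filter Topology in
lemma aux_hfin
    {X V E : Type*} [NormedAddCommGroup X] [InnerProductSpace ℝ X] [FiniteDimensional ℝ X]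
    [MeasurableSpace X] [BorelSpace X]
    [NormedAddCommGroup V] [InnerProductSpace ℝ V] [FiniteDimensional ℝ V]
    [NormedAddCommGroup E] [InnerProductSpace ℝ E] [FiniteDimensional ℝ E]
    {k l : ℕ} (hlk : l ≤ k) (hl : l < Module.finrank ℝ X)
    (A : DiffOperator X k V E) (q a : ℝ) (hq : 1 ≤ q) (C : ℝ)
    (hest : ∀ u : X → V, IsTestFun u →
      (∫⁻ x, (‖iteratedFDeriv ℝ (k - l) u x‖₊ : ℝ≥0∞) ^ q / (‖x‖₊ : ℝ≥0∞) ^ a) ^ (1 / q)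
        ≤ ENNReal.ofReal C * ∫⁻ x, (‖A.app u x‖₊ : ℝ≥0∞))
    (e : E) (m : X → V)
    (hme : ∀ ξ, ξ ≠ 0 → A.symbol ξ (m ξ) = e)
    (hm : ∀ ξ, ξ ≠ 0 → ContDiffAt ℝ (⊤ : ℕ∞) m ξ)
    (z : X) (v : V) (M : X → ℝ) (hM : ∀ ξ, M ξ = ⟪ξ, z⟫ ^ (k - l) * ⟪v, m ξ⟫)
    (hMc : ContinuousOn M {0}ᶜ)
    (hMh : ∀ (t : ℝ) (ξ : X), t ≠ 0 → ξ ≠ 0 → M (t • ξ) = (t ^ l)⁻¹ * M ξ)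
    (η : ContDiffBump (0 : X)) (hη2 : η.rOut ≤ 2 * η.rIn) :
    ∫⁻ x, ‖𝓕 (fun ξ => ((η ξ * M ξ : ℝ) : ℂ)) x‖ₑ ^ q / ‖x‖ₑ ^ a < ∞ := by
  have hq0 : 0 < q := by linarith
  have : Nontrivial X := Module.nontrivial_of_finrank_pos (R := ℝ) (by omega)
  have hae : ∀ᵐ ξ : X, ξ ≠ 0 := by simp [ae_iff]
  have hηs : ContDiff ℝ (⊤ : ℕ∞) (η : X → ℝ) := η.contDiff
  have hηc : HasCompactSupport (η : X → ℝ) := η.hasCompactSupport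
  have hηe : ∀ ξ, η (-ξ) = η ξ := fun ξ => η.neg ξ
  have hInteg : Integrable (fun ξ => η ξ * M ξ) := aux_etaM_int hl M hMc hMh η hηs.continuous hηc
  let R : ℕ → ℝ := fun N => (N : ℝ) + 2
  have hR : ∀ N, 0 < R N := fun N => by positivity
  let g : ℕ → X → ℝ := fun N ξ => η ξ - η (R N • ξ)
  have hgs : ∀ N, ContDiff ℝ (⊤ : ℕ∞) (g N) := fun N => hηs.sub (hηs.comp (contDiff_const_smul _))
  have hgc : ∀ N, HasCompactSupport (g N) := fun N =>
    hηc.sub (hηc.comp_homeomorph (Homeomorph.smulOfNeZero (R N) (hR N).ne'))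
  have hg0 : ∀ N, g N =ᶠ[𝓝 0] 0 := by
    intro N
    have h1 : ∀ᶠ ξ in 𝓝 (0 : X), η ξ = 1 := η.eventuallyEq_one
    have h2 : Tendsto (fun ξ : X => R N • ξ) (𝓝 0) (𝓝 0) := by
      have := (continuous_const_smul (T := X) (R N)).tendsto 0
      simpa using this
    filter_upwards [h1, h2.eventually h1] with ξ a1 a2
    simp [g, a1, a2]
  have hgle : ∀ N ξ, |g N ξ| ≤ η ξ := by
    intro N ξ
    have h3 : η (R N • ξ) ≤ η ξ := by
      by_cases hb : ‖ξ‖ ≤ η.rIn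
      · rw [η.one_of_mem_closedBall (x := ξ) (by simpa using hb)]
        exact η.le_one
      · push Not at hb
        have : η (R N • ξ) = 0 := by
          apply η.zero_of_le_dist
          rw [dist_zero_right, norm_smul, Real.norm_of_nonneg (hR N).le]
          have h4 : 2 ≤ R N := by simp [R]
          have h5 : 0 < η.rIn := η.rIn_pos
          nlinarith
        rw [this]
        exact η.nonneg
    have := η.nonneg (x := R N • ξ)
    rw [abs_of_nonneg (by simp only [g]; linarith)]
    simp only [g]; linarith
  let I0 : ℝ≥0∞ := ∫⁻ x, ‖𝓕 (fun ξ => (η ξ : ℂ)) x‖ₑ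
  have hηcs : ContDiff ℝ (⊤ : ℕ∞) (fun ξ => (η ξ : ℂ)) := Complex.ofRealCLM.contDiff.comp hηs
  have hηcc : HasCompactSupport (fun ξ => (η ξ : ℂ)) := hηc.comp_left (g := ((↑) : ℝ → ℂ)) (by simp)
  have hI0 : I0 < ∞ := by
    have h1 := (𝓕 (hηcc.toSchwartzMap hηcs)).integrable (μ := volume)
    have h2 := h1.hasFiniteIntegral
    rw [SchwartzMap.fourier_coe] at h2
    exact h2
  let K : ℝ := (2 * Real.pi) ^ l * (‖v‖ * ‖z‖ ^ (k - l))
  let B : ℝ≥0∞ := ENNReal.ofReal K ^ q * (ENNReal.ofReal C * (2 * I0 * ‖e‖ₑ)) ^ q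
  have hB : B < ∞ := by
    apply ENNReal.mul_lt_top
    · exact ENNReal.rpow_lt_top_of_nonneg hq0.le ENNReal.ofReal_ne_top
    · apply ENNReal.rpow_lt_top_of_nonneg hq0.le
      finiteness
  let F : ℕ → X → ℝ≥0∞ := fun N x => ‖𝓕 (fun ξ => ((g N ξ * M ξ : ℝ) : ℂ)) x‖ₑ ^ q / ‖x‖ₑ ^ a
  have hFB : ∀ N, ∫⁻ x, F N x ≤ B := by
    intro N
    obtain ⟨u, hu1, hu2⟩ := aux_app A e m hme hm (g N) (hgs N) (hg0 N) (hgc N)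
    have hs := aux_schwartz_ext A q a hq C hest u
    have hL : ∫⁻ x, (‖A.app u x‖₊ : ℝ≥0∞) ≤ 2 * I0 * ‖e‖ₑ := by
      have h1 := aux_L1_bound (fun ξ => (η ξ : ℂ))
        (hηcs.continuous.integrable_of_hasCompactSupport hηcc) (hR N)
      calc ∫⁻ x, (‖A.app u x‖₊ : ℝ≥0∞) ≤ ∫⁻ x, ‖𝓕 (fun ξ => (g N ξ : ℂ)) x‖ₑ * ‖e‖ₑ := by
            apply lintegral_mono
            intro x
            change ‖A.app u x‖ₑ ≤ _
            rw [hu1, enorm_smul]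
            refine mul_le_mul_left ?_ _
            rw [enorm_le_iff_norm_le]
            exact Complex.abs_re_le_norm _
        _ = (∫⁻ x, ‖𝓕 (fun ξ => (g N ξ : ℂ)) x‖ₑ) * ‖e‖ₑ := lintegral_mul_const' _ _ (by simp)
        _ ≤ 2 * I0 * ‖e‖ₑ := by
            gcongr
            simpa [g] using h1
    have hpt : ∀ x, ‖𝓕 (fun ξ => ((g N ξ * M ξ : ℝ) : ℂ)) x‖ₑ ≤
        ENNReal.ofReal K * ‖iteratedFDeriv ℝ (k - l) u x‖ₑ := by
      intro x
      have hpar := aux_parity (l := l) (fun ξ => g N ξ * M ξ) (by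
        intro ξ
        by_cases h0 : ξ = 0
        · have : g N 0 = 0 := (hg0 N).self_of_nhds
          simp [h0, this]
        · have h1 := hMh (-1) ξ (by norm_num) h0
          have h2 : ((-1 : ℝ) ^ l)⁻¹ = (-1) ^ l := by
            rw [← inv_pow]; norm_num
          rw [neg_one_smul, h2] at h1
          simp only [h1, g, smul_neg, hηe]
          ring) x
      have h2 := hu2 (k - l) x (fun _ => z) v
      have h3 : (fun ξ => (((∏ i : Fin (k - l), ⟪ξ, z⟫) * ⟪v, g N ξ • m ξ⟫ : ℝ) : ℂ)) =
          fun ξ => ((g N ξ * M ξ : ℝ) : ℂ) := by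
        ext ξ
        rw [hM, Finset.prod_const, Finset.card_univ, Fintype.card_fin, inner_smul_right]
        congr 1
        ring
      rw [h3] at h2
      have h4 : ((-(2 * Real.pi * I)) ^ k)⁻¹ * ((-(2 * Real.pi * I)) ^ (k - l) *
          𝓕 (fun ξ => ((g N ξ * M ξ : ℝ) : ℂ)) x) =
          ((-(2 * Real.pi * I)) ^ l)⁻¹ * 𝓕 (fun ξ => ((g N ξ * M ξ : ℝ) : ℂ)) x := by
        have hc : (-(2 * Real.pi * I)) ≠ 0 := by simp [Real.pi_ne_zero]
        obtain ⟨j, rfl⟩ := Nat.exists_eq_add_of_le hlk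
        rw [Nat.add_sub_cancel_left, pow_add, mul_inv, mul_assoc, inv_mul_cancel_left₀ (pow_ne_zero _ hc)]
      rw [h4] at h2
      rw [← h2] at hpar
      have h5 : |⟪v, iteratedFDeriv ℝ (k - l) u x (fun _ => z)⟫| ≤
          ‖v‖ * (‖iteratedFDeriv ℝ (k - l) u x‖ * ‖z‖ ^ (k - l)) := by
        refine (abs_real_inner_le_norm _ _).trans ?_
        gcongr
        refine (ContinuousMultilinearMap.le_opNorm _ _).trans ?_
        simp
      rw [← ofReal_norm, ← ofReal_norm, ← ENNReal.ofReal_mul (by positivity)]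
      apply ENNReal.ofReal_le_ofReal
      refine hpar.trans ?_
      calc _ ≤ (2 * Real.pi) ^ l * (‖v‖ * (‖iteratedFDeriv ℝ (k - l) u x‖ * ‖z‖ ^ (k - l))) := by
            gcongr
        _ = _ := by simp only [K]; ring
    have hs2 : ∫⁻ x, (‖iteratedFDeriv ℝ (k - l) u x‖₊ : ℝ≥0∞) ^ q / (‖x‖₊ : ℝ≥0∞) ^ a ≤
        (ENNReal.ofReal C * (2 * I0 * ‖e‖ₑ)) ^ q := by
      rw [one_div, ENNReal.rpow_inv_le_iff hq0] at hs
      refine hs.trans ?_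
      gcongr
    calc ∫⁻ x, F N x ≤ ∫⁻ x, ENNReal.ofReal K ^ q *
          ((‖iteratedFDeriv ℝ (k - l) u x‖₊ : ℝ≥0∞) ^ q / (‖x‖₊ : ℝ≥0∞) ^ a) := by
          apply lintegral_mono
          intro x
          simp only [F]
          rw [← mul_div_assoc, ← ENNReal.mul_rpow_of_nonneg _ _ hq0.le]
          exact ENNReal.div_le_div_right (ENNReal.rpow_le_rpow (hpt x) hq0.le) _
      _ = ENNReal.ofReal K ^ q * ∫⁻ x,
          ((‖iteratedFDeriv ℝ (k - l) u x‖₊ : ℝ≥0∞) ^ q / (‖x‖₊ : ℝ≥0∞) ^ a) :=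
          lintegral_const_mul' _ _ (ENNReal.rpow_lt_top_of_nonneg hq0.le ENNReal.ofReal_ne_top).ne
      _ ≤ B := by
          simp only [B]
          gcongr
  have hgm : ∀ N, AEStronglyMeasurable (fun ξ => g N ξ * M ξ) volume := by
    intro N
    have h1 := (aux_etaM_int hl M hMc hMh (g N) (hgs N).continuous (hgc N)).aestronglyMeasurable
    exact h1
  have hgint : ∀ N, Integrable (fun ξ => g N ξ * M ξ) := fun N =>
    aux_etaM_int hl M hMc hMh (g N) (hgs N).continuous (hgc N)
  have hFm : ∀ N, Measurable (F N) := by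
    intro N
    have h1 : Continuous (𝓕 (fun ξ => ((g N ξ * M ξ : ℝ) : ℂ))) :=
      VectorFourier.fourierIntegral_continuous Real.continuous_fourierChar
      (by exact continuous_inner) (hgint N).ofReal
    exact (h1.enorm.measurable.pow_const q).div (measurable_enorm.pow_const a)
  have hFt : ∀ x, Tendsto (fun N => 𝓕 (fun ξ => ((g N ξ * M ξ : ℝ) : ℂ)) x) atTop
      (𝓝 (𝓕 (fun ξ => ((η ξ * M ξ : ℝ) : ℂ)) x)) := by
    intro x
    simp only [Real.fourier_eq]
    apply tendsto_integral_of_dominated_convergence (fun ξ => ‖η ξ * M ξ‖)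
    · intro N
      exact ((Real.fourierIntegral_convergent_iff x).2 (hgint N).ofReal).aestronglyMeasurable
    · exact hInteg.norm
    · intro N
      refine Eventually.of_forall fun ξ => ?_
      rw [Circle.norm_smul, Complex.norm_real, norm_mul, norm_mul]
      gcongr
      rw [Real.norm_eq_abs, Real.norm_eq_abs]
      exact (hgle N ξ).trans (le_abs_self _)
    · filter_upwards [hae] with ξ hξ
      have hξ' : 0 < ‖ξ‖ := norm_pos_iff.2 hξ
      obtain ⟨N0, hN0⟩ := exists_nat_ge (η.rOut / ‖ξ‖)
      apply tendsto_const_nhds.congr'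
      filter_upwards [eventually_ge_atTop N0] with N hN
      have : η (R N • ξ) = 0 := by
        apply η.zero_of_le_dist
        rw [dist_zero_right, norm_smul, Real.norm_of_nonneg (hR N).le, ← div_le_iff₀ hξ']
        have : (N0 : ℝ) ≤ N := by exact_mod_cast hN
        simp only [R]
        linarith
      simp [g, this]
  calc ∫⁻ x, ‖𝓕 (fun ξ => ((η ξ * M ξ : ℝ) : ℂ)) x‖ₑ ^ q / ‖x‖ₑ ^ a
      = ∫⁻ x, liminf (fun N => F N x) atTop := by
        apply lintegral_congr_ae
        filter_upwards [hae] with x hx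
        symm
        apply Tendsto.liminf_eq
        apply ENNReal.Tendsto.div_const
        · exact ((ENNReal.continuous_rpow_const).tendsto _).comp (hFt x).enorm
        · right
          have h1 : ‖x‖ₑ ≠ 0 := by simpa using hx
          have := ENNReal.rpow_pos (p := a) (pos_iff_ne_zero.2 h1) enorm_ne_top
          exact this.ne'
    _ ≤ liminf (fun N => ∫⁻ x, F N x) atTop := lintegral_liminf_le hFm
    _ ≤ B := by
        refine (liminf_le_liminf (v := fun _ => B) (Eventually.of_forall hFB)).trans ?_
        simp
    _ < ∞ := hB

/-- Proposition: necessity of the cancellation condition.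
If `A(D)` is elliptic, `ℓ ∈ {1, …, min(k, n−1)}`, `q ∈ [1, n/(n−ℓ)]`, and the estimate
`(∫ |D^{k−ℓ}u|^q / |x|^{n−(n−ℓ)q} dx)^{1/q} ≤ C ∫ |A(D)u|` holds for all
`u ∈ C_c^∞(ℝⁿ; V)`, then `A(D)` is canceling. -/
theorem statement7
    {V E : Type*} [NormedAddCommGroup V] [InnerProductSpace ℝ V] [FiniteDimensional ℝ V]
    [NormedAddCommGroup E] [InnerProductSpace ℝ E] [FiniteDimensional ℝ E]
    {n k ℓ : ℕ} (hn : 2 ≤ n) (hℓ1 : 1 ≤ ℓ) (hℓk : ℓ ≤ k) (hℓn : ℓ ≤ n - 1)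
    (A : DiffOperator (EuclideanSpace ℝ (Fin n)) k V E) (hA : A.IsElliptic)
    (q : ℝ) (hq1 : 1 ≤ q) (hq2 : q ≤ (n : ℝ) / ((n : ℝ) - ℓ))
    (C : ℝ)
    (hest : ∀ u : EuclideanSpace ℝ (Fin n) → V, IsTestFun u →
      (∫⁻ x, (‖iteratedFDeriv ℝ (k - ℓ) u x‖₊ : ℝ≥0∞) ^ q
            / (‖x‖₊ : ℝ≥0∞) ^ ((n : ℝ) - ((n : ℝ) - ℓ) * q)) ^ (1 / q)
        ≤ ENNReal.ofReal C * ∫⁻ x, (‖A.app u x‖₊ : ℝ≥0∞)) :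
    A.IsCanceling := by
  have hln : ℓ < n := by omega
  have hfr : Module.finrank ℝ (EuclideanSpace ℝ (Fin n)) = n := finrank_euclideanSpace_fin
  have : Nontrivial (EuclideanSpace ℝ (Fin n)) :=
    Module.nontrivial_of_finrank_pos (R := ℝ) (by omega)
  unfold DiffOperator.IsCanceling
  refine Set.Subset.antisymm ?_ ?_
  swap
  · rintro _ rfl
    simp only [Set.mem_iInter]
    intro ξ _
    exact ⟨0, map_zero _⟩
  intro e he
  simp only [Set.mem_iInter] at he
  by_contra hne
  have hne : e ≠ 0 := hne
  obtain ⟨m, hme, hm, hmh⟩ := aux_m A hA e he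
  obtain ⟨z, hz⟩ := exists_ne (0 : EuclideanSpace ℝ (Fin n))
  have hzz : 0 < ⟪z, z⟫ := real_inner_self_pos.2 hz
  have hmz : m z ≠ 0 := by
    intro h
    have := hme z hz
    rw [h, map_zero] at this
    exact hne this.symm
  let M : EuclideanSpace ℝ (Fin n) → ℝ := fun ξ => ⟪ξ, z⟫ ^ (k - ℓ) * ⟪m z, m ξ⟫
  have hMc : ContinuousOn M {0}ᶜ := by
    intro ξ hξ
    have h1 : ContinuousAt m ξ := (hm ξ hξ).continuousAt
    have h2 : ContinuousAt M ξ := by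
      simp only [M]
      fun_prop
    exact h2.continuousWithinAt
  have hMh : ∀ (t : ℝ) (ξ : EuclideanSpace ℝ (Fin n)), t ≠ 0 → ξ ≠ 0 →
      M (t • ξ) = (t ^ ℓ)⁻¹ * M ξ := by
    intro t ξ ht hξ
    simp only [M]
    rw [hmh t ξ ht hξ, real_inner_smul_left, inner_smul_right, mul_pow]
    obtain ⟨j, rfl⟩ := Nat.exists_eq_add_of_le hℓk
    rw [Nat.add_sub_cancel_left, pow_add]
    field_simp
  have hMz : 0 < M z := by
    have := real_inner_self_pos.2 hmz
    simp only [M]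
    positivity
  let η : ContDiffBump (0 : EuclideanSpace ℝ (Fin n)) := ⟨1, 2, one_pos, one_lt_two⟩
  have hfin := aux_hfin hℓk (by omega) A q _ hq1 C hest e m hme hm z (m z) M (fun _ => rfl)
    hMc hMh η (by simp [η])
  have hfinal := aux_final hfr hℓ1 hln hq1 M hMc hMh η η.continuous η.hasCompactSupport
    (fun ξ hξ => η.one_of_mem_closedBall (by simpa [η] using hξ)) hfin
  -- a bump function where the multiplier is positive
  have hcz : ContinuousAt M z := hMc.continuousAt (isOpen_compl_singleton.mem_nhds hz)
  have hpos : ∀ᶠ ξ in nhds z, 0 < M ξ ∧ ξ ≠ 0 :=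
    (hcz.eventually (lt_mem_nhds hMz)).and (isOpen_compl_singleton.mem_nhds hz)
  obtain ⟨r, hr, hball⟩ := Metric.eventually_nhds_iff_ball.1 hpos
  let θ : ContDiffBump z := ⟨r / 4, r / 2, by positivity, by linarith⟩
  have hθs : ContDiff ℝ (⊤ : ℕ∞) (fun ξ => (θ ξ : ℂ)) := Complex.ofRealCLM.contDiff.comp θ.contDiff
  have hθc : HasCompactSupport (fun ξ => (θ ξ : ℂ)) :=
    θ.hasCompactSupport.comp_left (g := ((↑) : ℝ → ℂ)) (by simp)
  have h0 := hfinal (hθc.toSchwartzMap hθs) hθc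
  have h1 : ∫ ξ, M ξ * θ ξ = 0 := by
    have : ∫ ξ, (((M ξ * θ ξ : ℝ)) : ℂ) = 0 := by
      rw [← h0]
      congr 1
      ext ξ
      push_cast
      rfl
    rw [integral_complex_ofReal] at this
    exact_mod_cast this
  have hin : ∀ ξ, θ ξ ≠ 0 → ξ ∈ Metric.ball z r := by
    intro ξ hξ
    have : ξ ∈ Function.support θ := hξ
    rw [θ.support_eq] at this
    exact Metric.ball_subset_ball (by simp only [θ]; linarith) this
  have hnn : ∀ ξ, 0 ≤ M ξ * θ ξ := by
    intro ξ
    by_cases hξ : θ ξ = 0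
    · simp [hξ]
    · exact mul_nonneg (hball ξ (hin ξ hξ)).1.le θ.nonneg
  have hcont : Continuous fun ξ => M ξ * θ ξ := by
    rw [continuous_iff_continuousAt]
    intro ξ
    by_cases hξ : ξ ∈ Metric.closedBall z (r / 2)
    · have hb : ξ ∈ Metric.ball z r := Metric.closedBall_subset_ball (by linarith) hξ
      have hc : ContinuousAt M ξ :=
        hMc.continuousAt (isOpen_compl_singleton.mem_nhds (hball ξ hb).2)
      exact hc.mul θ.continuous.continuousAt
    · have hev : (fun ξ => M ξ * θ ξ) =ᶠ[nhds ξ] fun _ => 0 := by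
        filter_upwards [Metric.isClosed_closedBall.isOpen_compl.mem_nhds hξ] with y hy
        have : θ y = 0 := by
          apply θ.zero_of_le_dist
          simp only [Set.mem_compl_iff, Metric.mem_closedBall, not_le] at hy
          exact hy.le
        simp [this]
      exact continuousAt_const.congr hev.symm
  have hcs : HasCompactSupport fun ξ => M ξ * θ ξ := θ.hasCompactSupport.mul_left
  have hp := hcont.integral_pos_of_hasCompactSupport_nonneg_nonzero (μ := volume) hcs
    (fun ξ => hnn ξ) (x := z) (by
      have : θ z = 1 := θ.one_of_mem_closedBall (Metric.mem_closedBall_self θ.rIn_pos.le)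
      simp [this, hMz.ne'])
  exact hp.ne' h1
end
end

section
/- Let A(D) be a homogeneous linear differential operator of order k on ℝⁿ from V to E, let p ∈ [1, n) and q ∈ (p, np/(n−p)]. If there exists a constant C such that for every u ∈ C_c^∞(ℝⁿ; V), (∫_{ℝⁿ} |D^{k−1}u(x)|^q / |x|^{n−(n/p−1)q} dx)^{p/q} ≤ C ∫_{ℝⁿ} |A(D)u(x)|^p dx, then A(D) is elliptic. -/
open MeasureTheory ENNReal
open scoped NNReal RealInnerProductSpace

noncomputable section

section Aux

variable {X : Type*} [NormedAddCommGroup X] [InnerProductSpace ℝ X]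

/-- The dilation by the factor `d` along `ξ`. -/
def dil (ξ : X) (d : ℝ) : X →L[ℝ] X :=
  ContinuousLinearMap.id ℝ X + ((d - 1) / ‖ξ‖ ^ 2) • (innerSL ℝ ξ).smulRight ξ

lemma dil_apply (ξ : X) (d : ℝ) (w : X) :
    dil ξ d w = w + ((d - 1) / ‖ξ‖ ^ 2) • (⟪ξ, w⟫ • ξ) := by
  simp [dil]

lemma dil_self (ξ : X) (hξ : ξ ≠ 0) (d : ℝ) : dil ξ d ξ = d • ξ := by
  have h : ‖ξ‖ ≠ 0 := norm_ne_zero_iff.2 hξ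
  rw [dil_apply, real_inner_self_eq_norm_sq, smul_smul, div_mul_cancel₀ _ (pow_ne_zero 2 h),
    sub_smul, one_smul]
  abel

lemma norm_le_dil (ξ : X) (d : ℝ) (hd : 1 ≤ d) (w : X) : ‖w‖ ≤ ‖dil ξ d w‖ := by
  have hc : 0 ≤ (d - 1) / ‖ξ‖ ^ 2 := div_nonneg (by linarith) (by positivity)
  have h1 : ‖w‖ ^ 2 ≤ ‖dil ξ d w‖ ^ 2 := by
    rw [dil_apply, norm_add_sq_real, inner_smul_right, inner_smul_right, real_inner_comm w ξ]
    have := mul_nonneg hc (mul_self_nonneg ⟪w, ξ⟫)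
    have h3 := sq_nonneg ‖((d - 1) / ‖ξ‖ ^ 2) • (⟪w, ξ⟫ • ξ)‖
    linarith
  exact le_of_sq_le_sq h1 (norm_nonneg _)

lemma det_dil [FiniteDimensional ℝ X] (ξ : X) (hξ : ξ ≠ 0) (d : ℝ) :
    LinearMap.det (dil ξ d : X →ₗ[ℝ] X) = d := by
  have h : ‖ξ‖ ≠ 0 := norm_ne_zero_iff.2 hξ
  have : (dil ξ d : X →ₗ[ℝ] X) =
      LinearMap.transvection (((d - 1) / ‖ξ‖ ^ 2) • (innerSL ℝ ξ : X →ₗ[ℝ] ℝ)) ξ := by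
    ext w
    simp [dil_apply, LinearMap.transvection.apply, smul_smul]
  rw [this, LinearMap.transvection.det]
  simp
  field_simp
  ring

lemma norm_dil_le (ξ : X) (d : ℝ) (hd : 1 ≤ d) :
    ‖dil ξ d‖ ≤ d * (1 + ‖(innerSL ℝ ξ).smulRight ξ‖ / ‖ξ‖ ^ 2) := by
  have hc : 0 ≤ (d - 1) / ‖ξ‖ ^ 2 := div_nonneg (by linarith) (by positivity)
  refine (norm_add_le _ _).trans ?_
  rw [norm_smul, Real.norm_of_nonneg hc]
  have h1 := ContinuousLinearMap.norm_id_le (𝕜 := ℝ) (E := X)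
  have h2 : 0 ≤ ‖(innerSL ℝ ξ).smulRight ξ‖ / ‖ξ‖ ^ 2 := by positivity
  have : (d - 1) / ‖ξ‖ ^ 2 * ‖(innerSL ℝ ξ).smulRight ξ‖
    = (d - 1) * (‖(innerSL ℝ ξ).smulRight ξ‖ / ‖ξ‖ ^ 2) := by ring
  rw [this]
  nlinarith

lemma lintegral_dil [FiniteDimensional ℝ X] [MeasurableSpace X] [BorelSpace X]
    (ξ : X) (hξ : ξ ≠ 0) (d : ℝ) (hd : 1 ≤ d)
    (F : X → ℝ≥0∞) (hF : Measurable F) :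
    ∫⁻ x, F (dil ξ d x) = (ENNReal.ofReal d)⁻¹ * ∫⁻ y, F y := by
  have h0 : 0 < d := by linarith
  have h := Measure.map_linearMap_addHaar_eq_smul_addHaar (volume : Measure X)
    (f := (dil ξ d : X →ₗ[ℝ] X)) (by rw [det_dil ξ hξ]; exact h0.ne')
  rw [det_dil ξ hξ, abs_of_pos (inv_pos.2 h0), ENNReal.ofReal_inv_of_pos h0] at h
  have h2 := lintegral_map (μ := (volume : Measure X)) hF (dil ξ d).continuous.measurable
  rw [← h2]
  have : Measure.map (dil ξ d) (volume : Measure X) = _ := h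
  rw [this, lintegral_smul_measure, smul_eq_mul]

/-- A test function whose iterated derivative along `ξ` does not vanish at the origin. -/
lemma exists_test [FiniteDimensional ℝ X] (ξ : X) (hξ : ξ ≠ 0) (j : ℕ) :
    ∃ φ : X → ℝ, ContDiff ℝ (⊤ : ℕ∞) φ ∧ HasCompactSupport φ ∧
      iteratedFDeriv ℝ j φ 0 (fun _ => ξ) ≠ 0 := by
  let b : ContDiffBump (0 : X) := ⟨1, 2, by norm_num, by norm_num⟩
  have hb : ContDiff ℝ (⊤ : ℕ∞) (b : X → ℝ) := b.contDiff
  have hs : ContDiff ℝ (⊤ : ℕ∞) (fun x : X => b x * Real.exp ⟪ξ, x⟫) :=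
    hb.mul (Real.contDiff_exp.comp (contDiff_const.inner ℝ contDiff_id))
  refine ⟨_, hs, b.hasCompactSupport.mul_right, ?_⟩
  set φ : X → ℝ := fun x => b x * Real.exp ⟪ξ, x⟫
  let g : ℝ →L[ℝ] X := ContinuousLinearMap.toSpanSingleton ℝ ξ
  have h1 := g.iteratedFDeriv_comp_right hs (0 : ℝ) (i := j) (by exact_mod_cast le_top)
  have h2 : iteratedDeriv j (φ ∘ g) 0 = iteratedFDeriv ℝ j φ 0 (fun _ => ξ) := by
    rw [iteratedDeriv_eq_iteratedFDeriv, h1]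
    simp [g]
  rw [← h2]
  have h3 : (φ ∘ g) =ᶠ[nhds 0] fun t : ℝ => Real.exp (‖ξ‖ ^ 2 * t) := by
    have : ∀ᶠ t in nhds (0 : ℝ), b (g t) = 1 := by
      have hg : Filter.Tendsto g (nhds 0) (nhds 0) := by
        have := g.continuous.tendsto 0
        rwa [map_zero] at this
      exact hg.eventually b.eventuallyEq_one
    filter_upwards [this] with t ht
    simp only [Function.comp, φ, ht, one_mul]
    simp [g, inner_smul_right, mul_comm]
  rw [h3.iteratedDeriv_eq]
  have h4 := congrFun (iteratedDeriv_comp_const_mul (n := j) (f := Real.exp)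
    (Real.contDiff_exp) (‖ξ‖ ^ 2)) 0
  rw [h4, iteratedDeriv_eq_iterate, Real.iter_deriv_exp]
  have h : ‖ξ‖ ≠ 0 := norm_ne_zero_iff.2 hξ
  simp [h]

variable {V E : Type*} [NormedAddCommGroup V] [NormedSpace ℝ V]
  [NormedAddCommGroup E] [NormedSpace ℝ E]

/-- Algebraic estimate: the top order term in `d` vanishes. -/
lemma app_bound {k : ℕ} (A : DiffOperator X k V E) (ξ : X) (v : V)
    (hv : A.symbol ξ v = 0) :
    ∃ K : ℝ, 0 ≤ K ∧ ∀ d : ℝ, 1 ≤ d → ∀ M : ContinuousMultilinearMap ℝ (fun _ : Fin k => X) ℝ,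
      ‖A ((ContinuousLinearMap.toSpanSingleton ℝ v).compContinuousMultilinearMap
        (M.compContinuousLinearMap fun _ => dil ξ d))‖ ≤ K * d ^ (k - 1) * ‖M‖ := by
  let Q : X →L[ℝ] X := (innerSL ℝ ξ).smulRight ξ
  let L : ℝ →L[ℝ] V := ContinuousLinearMap.toSpanSingleton ℝ v
  let B := ContinuousMultilinearMap.compContinuousLinearMapContinuousMultilinear ℝ
    (fun _ : Fin k => X) (fun _ : Fin k => X) ℝ
  let N : ℝ := 1 + ‖Q‖ / ‖ξ‖ ^ 2
  have hN : 0 ≤ N := by positivity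
  refine ⟨‖A‖ * ‖L‖ * (‖B‖ * k * N ^ (k - 1)), by positivity, fun d hd M => ?_⟩
  let c : ℝ := (d - 1) / ‖ξ‖ ^ 2
  have hc : 0 ≤ c := div_nonneg (by linarith) (by positivity)
  have hz : A (L.compContinuousMultilinearMap
      (M.compContinuousLinearMap fun _ => c • Q)) = 0 := by
    have : L.compContinuousMultilinearMap (M.compContinuousLinearMap fun _ => c • Q) =
        (c ^ k * M (fun _ => ξ)) • (((ContinuousMultilinearMap.compContinuousLinearMapL
          (fun _ : Fin k => innerSL ℝ ξ)).comp
          (ContinuousMultilinearMap.piFieldEquiv ℝ (Fin k)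
            V).toContinuousLinearEquiv.toContinuousLinearMap) v) := by
      ext w
      have e : M (fun i => (c * ⟪ξ, w i⟫) • ξ) = (∏ i, c * ⟪ξ, w i⟫) * M (fun _ => ξ) := by
        simpa using M.map_smul_univ (fun i => c * ⟪ξ, w i⟫) (fun _ => ξ)
      rw [Finset.prod_mul_distrib, Finset.prod_const, Finset.card_univ, Fintype.card_fin] at e
      simp [L, Q, ContinuousMultilinearMap.piFieldEquiv, smul_smul]
      congr 1
      rw [e]
      ring
    rw [this, map_smul]
    have h5 : A (((ContinuousMultilinearMap.compContinuousLinearMapL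
          (fun _ : Fin k => innerSL ℝ ξ)).comp
          (ContinuousMultilinearMap.piFieldEquiv ℝ (Fin k)
            V).toContinuousLinearEquiv.toContinuousLinearMap) v) = 0 := hv
    rw [h5, smul_zero]
  have hsub : A (L.compContinuousMultilinearMap (M.compContinuousLinearMap fun _ => dil ξ d))
      = A (L.compContinuousMultilinearMap
        ((B (fun _ => dil ξ d) - B (fun _ => c • Q)) M)) := by
    have e : L.compContinuousMultilinearMap ((B (fun _ => dil ξ d) - B (fun _ => c • Q)) M)
      = L.compContinuousMultilinearMap (M.compContinuousLinearMap fun _ => dil ξ d)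
        - L.compContinuousMultilinearMap (M.compContinuousLinearMap fun _ => c • Q) := by
      ext w
      have e1 : B (fun _ => dil ξ d) M = M.compContinuousLinearMap fun _ => dil ξ d := rfl
      have e2 : B (fun _ => c • Q) M = M.compContinuousLinearMap fun _ => c • Q := rfl
      rw [sub_apply, e1, e2]
      simp
    rw [e, map_sub, hz, sub_zero]
  change ‖A (L.compContinuousMultilinearMap (M.compContinuousLinearMap fun _ => dil ξ d))‖ ≤ _
  rw [hsub]
  have hdN : ‖dil ξ d‖ ≤ d * N := norm_dil_le ξ d hd
  have hQN : ‖c • Q‖ ≤ d * N := by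
    rw [norm_smul, Real.norm_of_nonneg hc]
    have : c * ‖Q‖ = (d - 1) * (‖Q‖ / ‖ξ‖ ^ 2) := by simp only [c]; ring
    have h2 : 0 ≤ ‖Q‖ / ‖ξ‖ ^ 2 := by positivity
    rw [this]
    simp only [N]
    nlinarith
  have hdn : 0 ≤ d * N := by positivity
  have hB := B.norm_image_sub_le (fun _ => dil ξ d) (fun _ => c • Q)
  have hB' : ‖B (fun _ => dil ξ d) - B (fun _ => c • Q)‖ ≤ ‖B‖ * k * (d * N) ^ (k - 1) := by
    refine hB.trans ?_
    have h1 : ‖(fun _ : Fin k => dil ξ d) - (fun _ : Fin k => c • Q)‖ ≤ 1 := by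
      refine (pi_norm_le_iff_of_nonneg zero_le_one).2 fun i => ?_
      have : dil ξ d - c • Q = ContinuousLinearMap.id ℝ X := by
        simp [dil, c, Q]
      simp only [Pi.sub_apply, this]
      exact ContinuousLinearMap.norm_id_le
    have h2 : max ‖(fun _ : Fin k => dil ξ d)‖ ‖(fun _ : Fin k => c • Q)‖ ≤ d * N :=
      max_le ((pi_norm_le_iff_of_nonneg hdn).2 fun _ => hdN)
        ((pi_norm_le_iff_of_nonneg hdn).2 fun _ => hQN)
    rw [Fintype.card_fin]
    calc _ ≤ ‖B‖ * k * (d * N) ^ (k - 1) * 1 := by gcongr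
      _ = _ := mul_one _
  calc _ ≤ ‖A‖ * (‖L‖ * (‖B (fun _ => dil ξ d) - B (fun _ => c • Q)‖ * ‖M‖)) := by
        refine (A.le_opNorm _).trans ?_
        gcongr
        refine (ContinuousLinearMap.norm_compContinuousMultilinearMap_le _ _).trans ?_
        gcongr
        exact ContinuousLinearMap.le_opNorm _ _
    _ ≤ ‖A‖ * (‖L‖ * ((‖B‖ * k * (d * N) ^ (k - 1)) * ‖M‖)) := by gcongr
    _ = _ := by rw [mul_pow]; ring

/-- The final comparison of powers of `δ`. -/
lemma no_uniform_bound (a R : ℝ≥0∞) (ha : a ≠ 0) (hR : R ≠ ∞) (s : ℝ) (hs : 0 < s)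
    (h : ∀ d : ℝ, 1 ≤ d → a * (ENNReal.ofReal d) ^ s ≤ R) : False := by
  obtain ⟨b, hb0, hba⟩ : ∃ b : ℝ, 0 < b ∧ ENNReal.ofReal b ≤ a := by
    refine ⟨(min a 1).toReal, ENNReal.toReal_pos ?_ ?_, ?_⟩
    · simp [ha]
    · simp
    · rw [ENNReal.ofReal_toReal (by simp)]
      exact min_le_left _ _
  let m : ℝ := max 1 ((R.toReal + 1) / b)
  have hm1 : 1 ≤ m := le_max_left _ _
  have hm0 : 0 ≤ m := by linarith
  have hd : 1 ≤ m ^ (1 / s) := Real.one_le_rpow hm1 (by positivity)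
  have h1 := h _ hd
  rw [ENNReal.ofReal_rpow_of_nonneg (by linarith) hs.le, ← Real.rpow_mul hm0,
    one_div_mul_cancel hs.ne', Real.rpow_one] at h1
  have h2 : ENNReal.ofReal (b * m) ≤ R := by
    rw [ENNReal.ofReal_mul hb0.le]
    exact (mul_le_mul_left hba _).trans h1
  have h3 : b * m ≤ R.toReal := (ENNReal.ofReal_le_iff_le_toReal hR).1 h2
  have h4 : R.toReal + 1 ≤ b * m := by
    have : (R.toReal + 1) / b ≤ m := le_max_right _ _
    rw [div_le_iff₀ hb0] at this
    linarith
  linarith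

lemma exponent_bookkeeping (δ D I R : ℝ≥0∞) (p q : ℝ) (hp : 0 < p) (hq : p < q)
    (hδ1 : 1 ≤ δ) (hδ : δ ≠ ∞) (hD0 : D ≠ 0) (hD : D ≠ ∞)
    (h : (D ^ q * (δ⁻¹ * I)) ^ (p / q) ≤ D ^ p * (δ⁻¹ * R)) :
    I ^ (p / q) * δ ^ (1 - p / q) ≤ R := by
  have hq0 : 0 < q := hp.trans hq
  have hr : 0 ≤ p / q := by positivity
  have hδ0 : δ ≠ 0 := fun h => by simp [h] at hδ1
  rw [ENNReal.mul_rpow_of_nonneg _ _ hr, ENNReal.mul_rpow_of_nonneg _ _ hr,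
    ← ENNReal.rpow_mul, mul_div_cancel₀ _ hq0.ne'] at h
  have hDp0 : D ^ p ≠ 0 := by simp [hD0, hD]
  have hDp : D ^ p ≠ ∞ := by simp [hD0, hD]
  rw [ENNReal.mul_le_mul_iff_right hDp0 hDp] at h
  have h2 : δ * (δ⁻¹ ^ (p / q) * I ^ (p / q)) ≤ δ * (δ⁻¹ * R) := by gcongr
  rw [← mul_assoc δ δ⁻¹, ENNReal.mul_inv_cancel hδ0 hδ, one_mul] at h2
  refine le_trans (le_of_eq ?_) h2
  rw [ENNReal.rpow_sub _ _ hδ0 hδ, ENNReal.rpow_one, ENNReal.inv_rpow, ENNReal.div_eq_inv_mul]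
  ring

end Aux
/-- Proposition: necessity of the ellipticity condition for Hardy–Sobolev
inequalities. If `p ∈ [1, n)`, `q ∈ (p, np/(n−p)]`, and
`(∫ |D^{k−1}u|^q / |x|^{n−(n/p−1)q} dx)^{p/q} ≤ C ∫ |A(D)u|^p` for every
`u ∈ C_c^∞(ℝⁿ; V)`, then `A(D)` is elliptic. -/
theorem statement8
    {V E : Type*} [NormedAddCommGroup V] [InnerProductSpace ℝ V] [FiniteDimensional ℝ V]
    [NormedAddCommGroup E] [InnerProductSpace ℝ E] [FiniteDimensional ℝ E]
    {n k : ℕ} (hn : 0 < n) (hk : 0 < k)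
    (A : DiffOperator (EuclideanSpace ℝ (Fin n)) k V E)
    (p q : ℝ) (hp1 : 1 ≤ p) (hpn : p < n) (hq1 : p < q) (hq2 : q ≤ (n : ℝ) * p / ((n : ℝ) - p))
    (C : ℝ)
    (hest : ∀ u : EuclideanSpace ℝ (Fin n) → V, IsTestFun u →
      (∫⁻ x, (‖iteratedFDeriv ℝ (k - 1) u x‖₊ : ℝ≥0∞) ^ q
            / (‖x‖₊ : ℝ≥0∞) ^ ((n : ℝ) - ((n : ℝ) / p - 1) * q)) ^ (p / q)
        ≤ ENNReal.ofReal C * ∫⁻ x, (‖A.app u x‖₊ : ℝ≥0∞) ^ p) :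
    A.IsElliptic := by
  have hp0 : 0 < p := by linarith
  have hq0 : 0 < q := hp0.trans hq1
  have hnp : 0 < (n : ℝ) - p := by linarith
  have hγ : 0 ≤ (n : ℝ) - ((n : ℝ) / p - 1) * q := by
    rw [le_div_iff₀ hnp] at hq2
    have : ((n : ℝ) / p - 1) * q = q * (n - p) / p := by field_simp
    rw [this, sub_nonneg, div_le_iff₀ hp0]
    exact hq2
  generalize (n : ℝ) - ((n : ℝ) / p - 1) * q = γ at hγ hest
  intro ξ hξ
  rw [injective_iff_map_eq_zero]
  intro v hv
  by_contra hv0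
  obtain ⟨K, hK0, hK⟩ := app_bound A ξ v hv
  obtain ⟨φ, hφ, hφc, hφ0⟩ := exists_test ξ hξ (k - 1)
  let L : ℝ →L[ℝ] V := ContinuousLinearMap.toSpanSingleton ℝ v
  have hξn : 0 < ‖ξ‖ := norm_pos_iff.2 hξ
  have hvn : 0 < ‖v‖ := norm_pos_iff.2 hv0
  have hcont : ∀ j : ℕ, Continuous (iteratedFDeriv ℝ j φ) := fun j =>
    hφ.continuous_iteratedFDeriv (by exact_mod_cast le_top)
  let g : EuclideanSpace ℝ (Fin n) → ℝ := fun y =>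
    ‖iteratedFDeriv ℝ (k - 1) φ y (fun _ => ξ)‖ * ‖v‖ / ‖ξ‖ ^ (k - 1)
  have hg : Continuous g := by
    have : Continuous fun y => iteratedFDeriv ℝ (k - 1) φ y (fun _ => ξ) :=
      (ContinuousMultilinearMap.apply ℝ (fun _ : Fin (k - 1) => EuclideanSpace ℝ (Fin n)) ℝ
        (fun _ => ξ)).continuous.comp (hcont (k - 1))
    exact (this.norm.mul continuous_const).div_const _
  let F : EuclideanSpace ℝ (Fin n) → ℝ≥0∞ := fun y =>
    ENNReal.ofReal (g y) ^ q / (‖y‖₊ : ℝ≥0∞) ^ γ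
  have hF : Measurable F := by
    have : Measurable g := hg.measurable
    fun_prop
  let H : EuclideanSpace ℝ (Fin n) → ℝ≥0∞ := fun y =>
    ENNReal.ofReal ‖iteratedFDeriv ℝ k φ y‖ ^ p
  have hH : Measurable H := by
    have : Measurable fun y => ‖iteratedFDeriv ℝ k φ y‖ := (hcont k).norm.measurable
    fun_prop
  -- positivity of the weighted integral
  have hI : ∫⁻ y, F y ≠ 0 := by
    intro h0
    rw [lintegral_eq_zero_iff hF] at h0
    have h1 : g =ᵐ[volume] fun _ => 0 := by
      filter_upwards [h0] with y hy
      have hy' : ENNReal.ofReal (g y) ^ q / (‖y‖₊ : ℝ≥0∞) ^ γ = 0 := hy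
      rw [ENNReal.div_eq_zero_iff] at hy'
      rcases hy' with h | h
      · rw [ENNReal.rpow_eq_zero_iff_of_pos hq0, ENNReal.ofReal_eq_zero] at h
        exact le_antisymm h (by positivity)
      · exact absurd h (ENNReal.rpow_ne_top_of_nonneg hγ ENNReal.coe_ne_top)
    have h2 := congrFun (Continuous.ae_eq_iff_eq volume hg continuous_const |>.1 h1) 0
    have h3 : 0 < g 0 := by
      have := norm_pos_iff.2 hφ0
      positivity
    exact absurd h2 (ne_of_gt h3)
  -- finiteness of the right-hand side
  have hJ : ∫⁻ y, H y ≠ ∞ := by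
    have hc : Continuous fun y => ‖iteratedFDeriv ℝ k φ y‖ ^ p :=
      (hcont k).norm.rpow_const fun _ => Or.inr hp0.le
    have hs : HasCompactSupport fun y => ‖iteratedFDeriv ℝ k φ y‖ ^ p :=
      (hφc.iteratedFDeriv k).comp_left (g := fun M => ‖M‖ ^ p) (by simp [hp0.ne'])
    have := (hc.integrable_of_hasCompactSupport (μ := volume) hs).lintegral_lt_top.ne
    refine fun h => this (Eq.trans (lintegral_congr fun y => ?_) h)
    rw [← ENNReal.ofReal_rpow_of_nonneg (norm_nonneg _) hp0.le]
  refine no_uniform_bound ((∫⁻ y, F y) ^ (p / q))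
    (ENNReal.ofReal C * (ENNReal.ofReal K ^ p * ∫⁻ y, H y)) ?_ ?_ (1 - p / q) ?_ ?_
  · rw [Ne, ENNReal.rpow_eq_zero_iff_of_pos (by positivity)]
    exact hI
  · exact ENNReal.mul_ne_top ENNReal.ofReal_ne_top (ENNReal.mul_ne_top
      (ENNReal.rpow_ne_top_of_nonneg hp0.le ENNReal.ofReal_ne_top) hJ)
  · rw [sub_pos, div_lt_one hq0]
    exact hq1
  intro d hd
  have hd0 : 0 < d := by linarith
  let T := dil ξ d
  let u : EuclideanSpace ℝ (Fin n) → V := L ∘ (φ ∘ T)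
  have hφT : ContDiff ℝ (⊤ : ℕ∞) (φ ∘ T) := hφ.comp T.contDiff
  have hu : IsTestFun u := by
    refine ⟨L.contDiff.comp hφT, ?_⟩
    have hT : AntilipschitzWith 1 T := by
      refine AddMonoidHomClass.antilipschitz_of_bound T fun x => ?_
      simpa using norm_le_dil ξ d hd x
    exact (hφc.comp_isClosedEmbedding (hT.isClosedEmbedding T.uniformContinuous)).comp_left
      (map_zero L)
  have hDu : ∀ j : ℕ, ∀ x, iteratedFDeriv ℝ j u x = L.compContinuousMultilinearMap
      ((iteratedFDeriv ℝ j φ (T x)).compContinuousLinearMap fun _ => T) := by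
    intro j x
    rw [L.iteratedFDeriv_comp_left hφT.contDiffAt (by exact_mod_cast le_top),
      T.iteratedFDeriv_comp_right hφ x (by exact_mod_cast le_top)]
  have hD : 0 < d ^ (k - 1) := by positivity
  -- lower bound
  have hlow : ∀ x, ENNReal.ofReal (d ^ (k - 1)) ^ q * F (T x) ≤
      (‖iteratedFDeriv ℝ (k - 1) u x‖₊ : ℝ≥0∞) ^ q / (‖x‖₊ : ℝ≥0∞) ^ γ := by
    intro x
    have h1 : d ^ (k - 1) * g (T x) ≤ ‖iteratedFDeriv ℝ (k - 1) u x‖ := by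
      have h2 := (iteratedFDeriv ℝ (k - 1) u x).le_opNorm (fun _ => ξ)
      rw [Finset.prod_const, Finset.card_univ, Fintype.card_fin] at h2
      have h3 : iteratedFDeriv ℝ (k - 1) u x (fun _ => ξ) =
          (d ^ (k - 1) * iteratedFDeriv ℝ (k - 1) φ (T x) (fun _ => ξ)) • v := by
        rw [hDu]
        have h4 := (iteratedFDeriv ℝ (k - 1) φ (T x)).map_smul_univ (fun _ => d) (fun _ => ξ)
        have h5 : T ξ = d • ξ := dil_self ξ hξ d
        simp only [ContinuousLinearMap.compContinuousMultilinearMap_coe, Function.comp,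
          ContinuousMultilinearMap.compContinuousLinearMap_apply, h5]
        rw [h4]
        simp [L]
      rw [h3, norm_smul, norm_mul, Real.norm_of_nonneg hD.le] at h2
      simp only [g]
      rw [← mul_div_assoc, div_le_iff₀ (by positivity)]
      linarith
    have h2 : ENNReal.ofReal (d ^ (k - 1)) * ENNReal.ofReal (g (T x)) ≤
        (‖iteratedFDeriv ℝ (k - 1) u x‖₊ : ℝ≥0∞) := by
      rw [← ENNReal.ofReal_mul hD.le, ← enorm_eq_nnnorm, ← ofReal_norm]
      exact ENNReal.ofReal_le_ofReal h1
    have h3 : (‖x‖₊ : ℝ≥0∞) ≤ (‖T x‖₊ : ℝ≥0∞) := by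
      have : ‖x‖ ≤ ‖T x‖ := norm_le_dil ξ d hd x
      exact_mod_cast this
    calc _ = (ENNReal.ofReal (d ^ (k - 1)) * ENNReal.ofReal (g (T x))) ^ q /
          (‖T x‖₊ : ℝ≥0∞) ^ γ := by
          rw [ENNReal.mul_rpow_of_nonneg _ _ hq0.le, mul_div_assoc]
      _ ≤ _ := ENNReal.div_le_div (ENNReal.rpow_le_rpow h2 hq0.le) (ENNReal.rpow_le_rpow h3 hγ)
  -- upper bound
  have hupp : ∀ x, (‖A.app u x‖₊ : ℝ≥0∞) ^ p ≤
      ENNReal.ofReal (K * d ^ (k - 1)) ^ p * H (T x) := by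
    intro x
    have h1 := hK d hd (iteratedFDeriv ℝ k φ (T x))
    have h2 : ‖A.app u x‖ ≤ K * d ^ (k - 1) * ‖iteratedFDeriv ℝ k φ (T x)‖ := by
      rw [DiffOperator.app, hDu]
      exact h1
    simp only [H]
    rw [← ENNReal.mul_rpow_of_nonneg _ _ hp0.le, ← ENNReal.ofReal_mul (by positivity),
      ← enorm_eq_nnnorm, ← ofReal_norm]
    exact ENNReal.rpow_le_rpow (ENNReal.ofReal_le_ofReal h2) hp0.le
  have hTm : Measurable T := T.continuous.measurable
  have hL : ENNReal.ofReal (d ^ (k - 1)) ^ q * ((ENNReal.ofReal d)⁻¹ * ∫⁻ y, F y) ≤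
      ∫⁻ x, (‖iteratedFDeriv ℝ (k - 1) u x‖₊ : ℝ≥0∞) ^ q / (‖x‖₊ : ℝ≥0∞) ^ γ := by
    rw [← lintegral_dil ξ hξ d hd F hF, ← lintegral_const_mul _ (show Measurable fun x => F (dil ξ d x) from hF.comp hTm)]
    exact lintegral_mono hlow
  have hR : ∫⁻ x, (‖A.app u x‖₊ : ℝ≥0∞) ^ p ≤
      ENNReal.ofReal (K * d ^ (k - 1)) ^ p * ((ENNReal.ofReal d)⁻¹ * ∫⁻ y, H y) := by
    rw [← lintegral_dil ξ hξ d hd H hH, ← lintegral_const_mul _ (show Measurable fun x => H (dil ξ d x) from hH.comp hTm)]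
    exact lintegral_mono hupp
  refine exponent_bookkeeping (ENNReal.ofReal d) (ENNReal.ofReal (d ^ (k - 1))) _ _ p q hp0 hq1
    (by simpa using hd) ENNReal.ofReal_ne_top (by simpa using hD) ENNReal.ofReal_ne_top ?_
  calc _ ≤ _ := ENNReal.rpow_le_rpow hL (by positivity)
    _ ≤ _ := hest u hu
    _ ≤ _ := mul_le_mul_right hR _
    _ = _ := by
      rw [ENNReal.ofReal_mul hK0, ENNReal.mul_rpow_of_nonneg _ _ hp0.le]
      ring
end
end

section
/- Let A(D) be a homogeneous linear differential operator of order k on ℝⁿ from V to E and let p ∈ [1, n). If there exists a constant C > 0 such that for every u ∈ C_c^∞(ℝⁿ; V), ∫_{ℝⁿ} |D^{k−1}u(x)|^p / |x|^p dx ≤ C ∫_{ℝⁿ} |A(D)u(x)|^p dx, then for every linear subspace Π ⊆ ℝⁿ with dim Π ≥ n − p there exists ξ ∈ Π such that A(ξ) is injective. -/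
open MeasureTheory ENNReal
open scoped NNReal RealInnerProductSpace

noncomputable section

section PartOne

variable {Y : Type*} [NormedAddCommGroup Y] [InnerProductSpace ℝ Y]

/-- Scalar test functions. -/
def TestSp (Y : Type*) [NormedAddCommGroup Y] [InnerProductSpace ℝ Y] : Submodule ℝ (Y → ℝ) where
  carrier := {f | IsTestFun f}
  add_mem' := fun {a b} ha hb => ⟨ha.1.add hb.1, ha.2.add hb.2⟩
  zero_mem' := ⟨contDiff_const, HasCompactSupport.zero⟩
  smul_mem' := fun c f hf => ⟨hf.1.const_smul c, hf.2.smul_left (f := fun _ => c)⟩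

lemma TestSp.contDiff (f : TestSp Y) : ContDiff ℝ (⊤ : ℕ∞) (f : Y → ℝ) := f.2.1

lemma TestSp.differentiable (f : TestSp Y) : Differentiable ℝ (f : Y → ℝ) :=
  (TestSp.contDiff f).differentiable (by simp)

/-- Directional derivative on test functions. -/
def dirD (v : Y) : Module.End ℝ (TestSp Y) where
  toFun f := ⟨fun x => fderiv ℝ (f : Y → ℝ) x v, by
    refine ⟨?_, ?_⟩
    · exact ((TestSp.contDiff f).fderiv_right (m := (⊤ : ℕ∞)) (by simp)).clm_apply contDiff_const
    · exact f.2.2.fderiv_apply (𝕜 := ℝ) v⟩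
  map_add' f g := by
    ext x
    simp [fderiv_add (TestSp.differentiable f x) (TestSp.differentiable g x)]
  map_smul' c f := by
    ext x
    simp [fderiv_const_smul (TestSp.differentiable f x) c]

lemma dirD_apply (v : Y) (f : TestSp Y) (x : Y) :
    (dirD v f : Y → ℝ) x = fderiv ℝ (f : Y → ℝ) x v := rfl

lemma dirD_comm (v w : Y) : dirD v * dirD w = dirD w * dirD v := by
  ext f x
  have key : ∀ v w : Y, ((dirD v * dirD w) f : Y → ℝ) x
      = fderiv ℝ (fderiv ℝ (f : Y → ℝ)) x v w := by
    intro v w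
    change fderiv ℝ (fun y => fderiv ℝ (f : Y → ℝ) y w) x v = _
    rw [fderiv_clm_apply]
    · simp
    · exact ((TestSp.contDiff f).fderiv_right (m := 1) (by norm_cast)).differentiable (by simp) x
    · simp
  rw [key, key]
  have := ((TestSp.contDiff f).contDiffAt (x := x)).isSymmSndFDerivAt (by simpa using WithTop.coe_le_coe.2 (le_top : (2 : ℕ∞) ≤ ⊤))
  exact this v w

open scoped IsMulCommutative in
lemma exists_action {m : ℕ} (e : Fin m → Y) :
    ∃ ρ : MvPolynomial (Fin m) ℝ →ₐ[ℝ] Module.End ℝ (TestSp Y),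
      ∀ i, ρ (MvPolynomial.X i) = dirD (e i) := by
  have hcomm : ∀ a ∈ Set.range (fun i => dirD (e i)), ∀ b ∈ Set.range (fun i => dirD (e i)),
      a * b = b * a := by
    rintro _ ⟨i, rfl⟩ _ ⟨j, rfl⟩
    exact dirD_comm _ _
  have := Algebra.isMulCommutative_adjoin ℝ hcomm
  let g : Fin m → Algebra.adjoin ℝ (Set.range (fun i => dirD (e i))) :=
    fun i => ⟨dirD (e i), Algebra.subset_adjoin ⟨i, rfl⟩⟩
  refine ⟨(Subalgebra.val _).comp (MvPolynomial.aeval g), fun i => ?_⟩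
  simp [g]

lemma iteratedFDeriv_eq_action {m : ℕ} (e : Fin m → Y)
    (ρ : MvPolynomial (Fin m) ℝ →ₐ[ℝ] Module.End ℝ (TestSp Y))
    (hρ : ∀ i, ρ (MvPolynomial.X i) = dirD (e i)) (k : ℕ) (r : Fin k → Fin m)
    (f : TestSp Y) (x : Y) :
    iteratedFDeriv ℝ k (f : Y → ℝ) x (fun s => e (r s))
      = (ρ (∏ s, MvPolynomial.X (r s)) f : Y → ℝ) x := by
  induction k generalizing x with
  | zero => simp
  | succ k ih =>
    rw [iteratedFDeriv_succ_apply_left, Fin.prod_univ_succ, map_mul, hρ, Module.End.mul_apply,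
      dirD_apply]
    have : ((ρ (∏ s : Fin k, MvPolynomial.X (r s.succ)) f : TestSp Y) : Y → ℝ)
        = fun y => iteratedFDeriv ℝ k (f : Y → ℝ) y (fun s => e (r s.succ)) := by
      funext y
      rw [ih]
    rw [this]
    have hd : DifferentiableAt ℝ (iteratedFDeriv ℝ k (f : Y → ℝ)) x :=
      ((TestSp.contDiff f).differentiable_iteratedFDeriv (by exact_mod_cast WithTop.coe_lt_top k)) x
    rw [fderiv_continuousMultilinear_apply_const_apply hd]
    rfl

lemma exists_action_ne_zero [FiniteDimensional ℝ Y] {m : ℕ} (e : OrthonormalBasis (Fin m) ℝ Y)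
    (ρ : MvPolynomial (Fin m) ℝ →ₐ[ℝ] Module.End ℝ (TestSp Y))
    (hρ : ∀ i, ρ (MvPolynomial.X i) = dirD (e i)) (P : MvPolynomial (Fin m) ℝ) (hP : P ≠ 0) :
    ∃ f : TestSp Y, ρ P f ≠ 0 := by
  obtain ⟨a, ha⟩ : ∃ a : Fin m → ℝ, MvPolynomial.eval a P ≠ 0 := by
    by_contra! h
    exact hP (MvPolynomial.funext (by simpa using h))
  let χ : ContDiffBump (0 : Y) := ⟨1, 2, by norm_num, by norm_num⟩
  let ξ : Y := ∑ i, a i • e i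
  have hξ : ∀ i, inner ℝ ξ (e i) = a i := by
    intro i
    simp [ξ, sum_inner, inner_smul_left, e.inner_eq_ite]
  let f : TestSp Y := ⟨fun x => χ x * Real.exp (inner ℝ ξ x), by
    refine ⟨χ.contDiff.mul ?_, χ.hasCompactSupport.mul_right⟩
    exact Real.contDiff_exp.comp (contDiff_const.inner ℝ contDiff_id)⟩
  have key : ∀ Q : MvPolynomial (Fin m) ℝ, ∀ x ∈ Metric.ball (0 : Y) 1,
      (ρ Q f : Y → ℝ) x = MvPolynomial.eval a Q * Real.exp (inner ℝ ξ x) := by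
    intro Q
    induction Q using MvPolynomial.induction_on with
    | C c =>
      intro x hx
      have : χ x = 1 := χ.one_of_mem_closedBall (Metric.ball_subset_closedBall hx)
      have h2 : ρ (MvPolynomial.C c) = algebraMap ℝ _ c := by
        rw [← MvPolynomial.algebraMap_eq, AlgHom.commutes]
      rw [h2]
      simp [f, this, Module.algebraMap_end_apply]
    | add p q hp hq =>
      intro x hx
      simp [hp x hx, hq x hx, add_mul]
    | mul_X p i hp =>
      intro x hx
      rw [mul_comm, map_mul, hρ, Module.End.mul_apply, dirD_apply]
      have : ((ρ p f : TestSp Y) : Y → ℝ) =ᶠ[nhds x]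
          fun y => MvPolynomial.eval a p * Real.exp (inner ℝ ξ y) := by
        filter_upwards [Metric.isOpen_ball.mem_nhds hx] with y hy using hp y hy
      rw [this.fderiv_eq]
      have h1 : HasFDerivAt (fun y => inner ℝ ξ y) (innerSL ℝ ξ) x :=
        (innerSL ℝ ξ).hasFDerivAt
      rw [(h1.exp.const_mul _).fderiv]
      simp [hξ]
      ring
  refine ⟨f, fun h0 => ?_⟩
  have := key P 0 (by simp)
  rw [h0] at this
  simp at this
  exact ha this.symm

end PartOne

section PartTwo

variable {Y V E : Type*} [NormedAddCommGroup Y] [InnerProductSpace ℝ Y]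
  [NormedAddCommGroup V] [InnerProductSpace ℝ V]
  [NormedAddCommGroup E] [InnerProductSpace ℝ E]

/-- The multilinear map `(w₁, …, w_k) ↦ (∏ ⟪ζ s, w_s⟫) • v`. -/
def elemMap {k : ℕ} (ζ : Fin k → Y) (v : V) : ContinuousMultilinearMap ℝ (fun _ : Fin k => Y) V :=
  (ContinuousMultilinearMap.mkPiRing ℝ (Fin k) v).compContinuousLinearMap
    (fun s => innerSL ℝ (ζ s))

lemma elemMap_apply {k : ℕ} (ζ : Fin k → Y) (v : V) (w : Fin k → Y) :
    elemMap ζ v w = (∏ s, inner ℝ (ζ s) (w s)) • v := by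
  simp [elemMap]

lemma symbol_eq {k : ℕ} (A : DiffOperator Y k V E) (ξ : Y) (v : V) :
    A.symbol ξ v = A (elemMap (fun _ => ξ) v) := rfl

lemma multilinear_expand {k m : ℕ} (e : OrthonormalBasis (Fin m) ℝ Y)
    (M : ContinuousMultilinearMap ℝ (fun _ : Fin k => Y) V) :
    M = ∑ r : Fin k → Fin m, elemMap (fun s => e (r s)) (M (fun s => e (r s))) := by
  ext w
  have h1 : w = fun s => ∑ i, inner ℝ (e i) (w s) • e i := by
    funext s
    exact (e.sum_repr' (w s)).symm
  conv_lhs => rw [h1]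
  rw [M.map_sum]
  simp only [ContinuousMultilinearMap.sum_apply, elemMap_apply]
  refine Finset.sum_congr rfl fun r _ => ?_
  rw [M.map_smul_univ]

lemma elemMap_sum {k : ℕ} {ι : Type*} (t : Finset ι) (ζ : Fin k → Y) (c : ι → ℝ) (v : ι → V) :
    elemMap ζ (∑ j ∈ t, c j • v j) = ∑ j ∈ t, c j • elemMap ζ (v j) := by
  ext w
  simp only [ContinuousMultilinearMap.sum_apply, elemMap_apply,
    ContinuousMultilinearMap.smul_apply, Finset.smul_sum]
  refine Finset.sum_congr rfl fun r _ => ?_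
  rw [smul_comm]

open Matrix in
lemma exists_poly_kernel {m d q : ℕ} (M : Matrix (Fin q) (Fin d) (MvPolynomial (Fin m) ℝ))
    (h : ∀ a : Fin m → ℝ, ∃ v : Fin d → ℝ, v ≠ 0 ∧ (M.map (MvPolynomial.eval a)) *ᵥ v = 0) :
    ∃ b : Fin d → MvPolynomial (Fin m) ℝ, b ≠ 0 ∧ M *ᵥ b = 0 := by
  have hdet : (Mᵀ * M).det = 0 := by
    apply MvPolynomial.funext
    intro a
    obtain ⟨v, hv, hMv⟩ := h a
    rw [RingHom.map_det, map_zero]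
    apply Matrix.exists_mulVec_eq_zero_iff.1
    refine ⟨v, hv, ?_⟩
    rw [RingHom.mapMatrix_apply, Matrix.map_mul, ← Matrix.mulVec_mulVec, hMv, Matrix.mulVec_zero]
  obtain ⟨b, hb, hMb⟩ := Matrix.exists_mulVec_eq_zero_iff.2 hdet
  refine ⟨b, hb, ?_⟩
  have h2 : (M *ᵥ b) ⬝ᵥ (M *ᵥ b) = 0 := by
    rw [Matrix.dotProduct_mulVec, Matrix.vecMul_mulVec, ← Matrix.dotProduct_mulVec, hMb]
    simp
  funext l
  apply MvPolynomial.funext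
  intro a
  have h3 := congrArg (MvPolynomial.eval a) h2
  simp only [dotProduct, map_sum, map_mul, map_zero] at h3
  have h4 := (Finset.sum_eq_zero_iff_of_nonneg (fun i _ => mul_self_nonneg _)).1 h3 l
    (Finset.mem_univ l)
  simpa using h4

lemma exists_kernel_testFun [FiniteDimensional ℝ Y] [FiniteDimensional ℝ V]
    [FiniteDimensional ℝ E] {k : ℕ} (A : DiffOperator Y k V E)
    (h : ∀ ξ, ¬ Function.Injective (A.symbol ξ)) :
    ∃ w : Y → V, IsTestFun w ∧ w ≠ 0 ∧ ∀ x, A.app w x = 0 := by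
  let e := stdOrthonormalBasis ℝ Y
  let b := stdOrthonormalBasis ℝ V
  let c := stdOrthonormalBasis ℝ E
  obtain ⟨ρ, hρ⟩ := exists_action (e : Fin _ → Y)
  let coef (r : Fin k → Fin (Module.finrank ℝ Y)) (l : Fin (Module.finrank ℝ E))
    (j : Fin (Module.finrank ℝ V)) : ℝ := inner ℝ (c l) (A (elemMap (fun s => e (r s)) (b j)))
  let M : Matrix (Fin (Module.finrank ℝ E)) (Fin (Module.finrank ℝ V))
      (MvPolynomial (Fin (Module.finrank ℝ Y)) ℝ) := fun l j =>
    ∑ r : Fin k → Fin (Module.finrank ℝ Y), coef r l j • ∏ s, MvPolynomial.X (r s)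
  -- general expansion
  have hexp : ∀ (T : ContinuousMultilinearMap ℝ (fun _ : Fin k => Y) V) (l),
      inner ℝ (c l) (A T) = ∑ r : Fin k → Fin (Module.finrank ℝ Y), ∑ j,
        inner ℝ (b j) (T (fun s => e (r s))) * coef r l j := by
    intro T l
    conv_lhs => rw [multilinear_expand e T]
    rw [map_sum, inner_sum]
    refine Finset.sum_congr rfl fun r _ => ?_
    conv_lhs => rw [← b.sum_repr' (T (fun s => e (r s)))]
    rw [elemMap_sum, map_sum, inner_sum]
    refine Finset.sum_congr rfl fun j _ => ?_
    rw [map_smul, inner_smul_right]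
  obtain ⟨B, hB0, hMB⟩ := exists_poly_kernel M (by
    intro a
    let ξ : Y := ∑ i, a i • e i
    have hξ : ∀ i, inner ℝ ξ (e i) = a i := by
      intro i
      simp [ξ, sum_inner, inner_smul_left, e.inner_eq_ite]
    have hni := h ξ
    rw [injective_iff_map_eq_zero] at hni
    push Not at hni
    obtain ⟨v, hv, hv0⟩ := hni
    refine ⟨fun j => inner ℝ (b j) v, ?_, ?_⟩
    · intro h0
      apply hv0
      rw [← b.sum_repr' v]
      refine Finset.sum_eq_zero fun j _ => ?_
      rw [show inner ℝ (b j) v = 0 from congrFun h0 j, zero_smul]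
    · funext l
      have := hexp (elemMap (fun _ => ξ) v) l
      rw [← symbol_eq, hv, inner_zero_right, Finset.sum_comm] at this
      rw [Pi.zero_apply, this]
      simp only [Matrix.mulVec, dotProduct, Matrix.map_apply]
      refine Finset.sum_congr rfl fun j _ => ?_
      simp only [M, map_sum, Finset.sum_mul]
      refine Finset.sum_congr rfl fun r _ => ?_
      simp only [elemMap_apply, hξ, inner_smul_right, MvPolynomial.smul_eval, map_prod,
        MvPolynomial.eval_X]
      ring)
  obtain ⟨j₀, hj₀⟩ : ∃ j, B j ≠ 0 := by
    by_contra! h0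
    exact hB0 (funext h0)
  obtain ⟨f, hf⟩ := exists_action_ne_zero e ρ hρ (B j₀) hj₀
  let g : Fin (Module.finrank ℝ V) → TestSp Y := fun j => ρ (B j) f
  let w : Y → V := fun x => ∑ j, (g j : Y → ℝ) x • b j
  have hwj : ∀ j x, inner ℝ (b j) (w x) = (g j : Y → ℝ) x := by
    intro j x
    simp [w, inner_sum, inner_smul_right, b.inner_eq_ite]
  have hgs : ∀ j, ContDiff ℝ (⊤ : ℕ∞) (g j : Y → ℝ) := fun j => TestSp.contDiff (g j)
  have hws : ContDiff ℝ (⊤ : ℕ∞) w := ContDiff.sum fun j _ => (hgs j).smul contDiff_const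
  refine ⟨w, ⟨hws, ?_⟩, ?_, ?_⟩
  · have hK : IsCompact (⋃ j, tsupport (g j : Y → ℝ)) := isCompact_iUnion fun j => (g j).2.2
    refine HasCompactSupport.intro hK fun x hx => ?_
    refine Finset.sum_eq_zero fun j _ => ?_
    have : x ∉ tsupport (g j : Y → ℝ) := fun hh => hx (Set.mem_iUnion.2 ⟨j, hh⟩)
    rw [image_eq_zero_of_notMem_tsupport this, zero_smul]
  · intro h0
    apply hf
    ext x
    have := hwj j₀ x
    rw [h0] at this
    simpa [g] using this.symm
  · intro x
    suffices hs : ∀ l, inner ℝ (c l) (A.app w x) = 0 by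
      rw [← c.sum_repr' (A.app w x)]
      refine Finset.sum_eq_zero fun l _ => ?_
      rw [hs l, zero_smul]
    intro l
    unfold DiffOperator.app
    rw [hexp]
    have hin : ∀ (r : Fin k → Fin (Module.finrank ℝ Y)) j,
        inner ℝ (b j) (iteratedFDeriv ℝ k w x (fun s => e (r s)))
          = (ρ ((∏ s, MvPolynomial.X (r s)) * B j) f : Y → ℝ) x := by
      intro r j
      have h1 := (innerSL ℝ (b j)).iteratedFDeriv_comp_left (x := x) (i := k) (f := w) (n := (⊤ : ℕ∞))
        hws.contDiffAt (by exact_mod_cast le_top)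
      have h2 : (⇑(innerSL ℝ (b j)) ∘ w) = (g j : Y → ℝ) := by
        funext y
        exact hwj j y
      rw [h2] at h1
      have h3 := congrArg (fun T => T (fun s => e (r s))) h1
      rw [iteratedFDeriv_eq_action e ρ hρ k r (g j) x] at h3
      rw [map_mul]
      exact h3.symm
    simp only [hin]
    have h5 := congrFun hMB l
    have h6 := congrArg (fun Q => ((ρ Q f : TestSp Y) : Y → ℝ) x) h5
    simp only [Matrix.mulVec, dotProduct, M, Finset.sum_mul, Pi.zero_apply, map_zero, map_sum,
      smul_mul_assoc, map_smul, LinearMap.sum_apply, LinearMap.smul_apply,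
      LinearMap.zero_apply] at h6
    rw [Finset.sum_comm]
    convert! h6 using 1
    simp [mul_comm]

end PartTwo

section PartThree

lemma exists_iteratedFDeriv_ne_zero {Y V : Type*} [NormedAddCommGroup Y] [InnerProductSpace ℝ Y]
    [FiniteDimensional ℝ Y] [Nontrivial Y] [NormedAddCommGroup V] [NormedSpace ℝ V]
    {w : Y → V} (hw : IsTestFun w) (hw0 : w ≠ 0) (j : ℕ) :
    ∃ y, iteratedFDeriv ℝ j w y ≠ 0 := by
  induction j with
  | zero =>
    by_contra! h
    apply hw0
    funext y
    have := congrArg (fun T => T 0) (h y)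
    simpa using this
  | succ j ih =>
    by_contra! h
    obtain ⟨y, hy⟩ := ih
    have hd : Differentiable ℝ (iteratedFDeriv ℝ j w) :=
      hw.1.differentiable_iteratedFDeriv (by exact_mod_cast WithTop.coe_lt_top j)
    have hz : ∀ x, fderiv ℝ (iteratedFDeriv ℝ j w) x = 0 := by
      intro x
      ext v m
      have h1 := iteratedFDeriv_succ_apply_left (𝕜 := ℝ) (f := w) (x := x) (Fin.cons v m)
      rw [h x] at h1
      simpa using h1.symm
    have hc := is_const_of_fderiv_eq_zero hd hz
    have hcs : HasCompactSupport (iteratedFDeriv ℝ j w) := hw.2.iteratedFDeriv j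
    have : tsupport (iteratedFDeriv ℝ j w) = Set.univ := by
      apply Set.eq_univ_of_forall
      intro x
      apply subset_tsupport
      rw [Function.mem_support, hc x y]
      exact hy
    have h3 : IsCompact (Set.univ : Set Y) := this ▸ hcs
    haveI : NoncompactSpace Y := NormedSpace.noncompactSpace ℝ Y
    exact noncompact_univ Y h3

lemma radial_false {F : Type*} [NormedAddCommGroup F] [InnerProductSpace ℝ F]
    [FiniteDimensional ℝ F] [MeasurableSpace F] [BorelSpace F] (p : ℝ) (hp : 1 ≤ p)
    (hd : (Module.finrank ℝ F : ℝ) ≤ p) (K : ℝ) (hK : 0 < K) (C' : ℝ≥0∞) (hC' : C' ≠ ⊤)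
    (h : ∀ R : ℝ, 1 ≤ R → ∫⁻ z in Metric.ball (0 : F) R, ENNReal.ofReal ((K + ‖z‖) ^ (-p))
      ≤ C' * ENNReal.ofReal (R ^ ((Module.finrank ℝ F : ℝ) - p))) : False := by
  have hpos : ∀ z : F, 0 < K + ‖z‖ := fun z => by positivity
  have hcont : Continuous fun z : F => (K + ‖z‖) ^ (-p) :=
    (continuous_const.add continuous_norm).rpow_const fun z => Or.inl (hpos z).ne'
  rcases hd.lt_or_eq with hlt | heq
  · have h0 : ∫⁻ z in Metric.ball (0 : F) 1, ENNReal.ofReal ((K + ‖z‖) ^ (-p)) ≤ 0 := by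
      have ht : Filter.Tendsto
          (fun R : ℝ => C' * ENNReal.ofReal (R ^ ((Module.finrank ℝ F : ℝ) - p)))
          Filter.atTop (nhds (C' * ENNReal.ofReal 0)) := by
        apply ENNReal.Tendsto.const_mul _ (Or.inr hC')
        apply ENNReal.tendsto_ofReal
        have := tendsto_rpow_neg_atTop (sub_pos.2 hlt)
        simpa using this
      rw [ENNReal.ofReal_zero, mul_zero] at ht
      refine ge_of_tendsto ht ?_
      filter_upwards [Filter.eventually_ge_atTop 1] with R hR
      exact (lintegral_mono_set (Metric.ball_subset_ball hR)).trans (h R hR)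
    have h1 := nonpos_iff_eq_zero.1 h0
    rw [lintegral_eq_zero_iff hcont.measurable.ennreal_ofReal] at h1
    have h2 : ∀ᵐ z ∂(volume.restrict (Metric.ball (0 : F) 1)), False := by
      filter_upwards [h1] with z hz
      have : 0 < ENNReal.ofReal ((K + ‖z‖) ^ (-p)) :=
        ENNReal.ofReal_pos.2 (Real.rpow_pos_of_pos (hpos z) _)
      exact this.ne' hz
    rw [Filter.eventually_false_iff_eq_bot, ae_eq_bot, Measure.restrict_eq_zero] at h2
    exact (Metric.measure_ball_pos volume (0 : F) one_pos).ne' h2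
  · have hfr : 0 < Module.finrank ℝ F := by
      have : (0 : ℝ) < Module.finrank ℝ F := by linarith
      exact_mod_cast this
    haveI : Nontrivial F := Module.finrank_pos_iff.1 hfr
    have h1 : ∫⁻ z : F, ENNReal.ofReal ((K + ‖z‖) ^ (-p)) ≤ C' := by
      have hU : (⋃ N : ℕ, Metric.ball (0 : F) ((N : ℝ) + 1)) = Set.univ := by
        apply Set.eq_univ_of_forall
        intro z
        obtain ⟨N, hN⟩ := exists_nat_gt ‖z‖
        refine Set.mem_iUnion.2 ⟨N, ?_⟩
        rw [mem_ball_zero_iff]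
        linarith
      rw [← setLIntegral_univ, ← hU, setLIntegral_iUnion_of_directed]
      · refine iSup_le fun N => ?_
        have := h ((N : ℝ) + 1) (by simp)
        rwa [heq, sub_self, Real.rpow_zero, ENNReal.ofReal_one, mul_one] at this
      · refine Monotone.directed_le fun a b hab => ?_
        apply Metric.ball_subset_ball
        have : (a : ℝ) ≤ b := by exact_mod_cast hab
        linarith
    have h2 : Integrable (fun z : F => (K + ‖z‖) ^ (-p)) := by
      refine ⟨hcont.aestronglyMeasurable, ?_⟩
      rw [hasFiniteIntegral_iff_ofReal (Filter.Eventually.of_forall fun z =>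
        Real.rpow_nonneg (hpos z).le _)]
      exact h1.trans_lt hC'.lt_top
    have h3 := (integrable_fun_norm_addHaar (volume : Measure F)
      (f := fun y : ℝ => (K + y) ^ (-p))).1 h2
    have h4 : IntegrableOn (fun y : ℝ => y⁻¹) (Set.Ioi K) := by
      have h5 := (h3.mono_set (Set.Ioi_subset_Ioi hK.le)).const_mul ((2 : ℝ) ^ p)
      refine h5.mono' measurable_inv.aestronglyMeasurable ?_
      filter_upwards [ae_restrict_mem measurableSet_Ioi] with y hy
      have hy' : K < y := hy
      have hy0 : 0 < y := hK.trans hy'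
      rw [Real.norm_of_nonneg (inv_nonneg.2 hy0.le), smul_eq_mul]
      have e1 : y ^ (Module.finrank ℝ F - 1) = y ^ (p - 1) := by
        rw [← Real.rpow_natCast, Nat.cast_sub hfr, heq, Nat.cast_one]
      have e2 : (2 * y) ^ (-p) ≤ (K + y) ^ (-p) :=
        Real.rpow_le_rpow_of_nonpos (by linarith) (by linarith) (by linarith)
      rw [e1]
      calc y⁻¹ = 2 ^ p * (y ^ (p - 1) * (2 * y) ^ (-p)) := by
            rw [Real.mul_rpow (by norm_num) hy0.le, Real.rpow_neg (by norm_num),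
              Real.rpow_neg hy0.le, Real.rpow_sub_one hy0.ne']
            have := (Real.rpow_pos_of_pos hy0 p).ne'
            have := (Real.rpow_pos_of_pos (two_pos : (0:ℝ) < 2) p).ne'
            field_simp
        _ ≤ _ := by gcongr
    exact not_integrableOn_Ioi_inv h4

end PartThree

section PartFour

lemma exists_bound_iteratedFDeriv {Y V : Type*} [NormedAddCommGroup Y] [NormedSpace ℝ Y]
    [NormedAddCommGroup V] [NormedSpace ℝ V] {w : Y → V} (hw : IsTestFun w) (k : ℕ) :
    ∃ C : ℝ, 0 ≤ C ∧ ∀ i ≤ k, ∀ y, ‖iteratedFDeriv ℝ i w y‖ ≤ C := by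
  have h1 : ∀ i : ℕ, ∃ C : ℝ, ∀ y, ‖iteratedFDeriv ℝ i w y‖ ≤ C := fun i =>
    (hw.2.iteratedFDeriv i).exists_bound_of_continuous
      (hw.1.continuous_iteratedFDeriv (by exact_mod_cast le_top))
  choose C hC using h1
  have h0 : ∀ i, 0 ≤ C i := fun i => (norm_nonneg _).trans (hC i 0)
  refine ⟨∑ i ∈ Finset.range (k + 1), C i, Finset.sum_nonneg fun i _ => h0 i, fun i hi y => ?_⟩
  exact (hC i y).trans (Finset.single_le_sum (f := C) (fun i _ => h0 i)
    (Finset.mem_range.2 (by omega)))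

lemma norm_compCLM_le {X Y V : Type*} [NormedAddCommGroup X] [NormedSpace ℝ X]
    [NormedAddCommGroup Y] [NormedSpace ℝ Y]
    [NormedAddCommGroup V] [NormedSpace ℝ V] {i : ℕ}
    (T : ContinuousMultilinearMap ℝ (fun _ : Fin i => Y) V) (L : X →L[ℝ] Y) :
    ‖T.compContinuousLinearMap (fun _ => L)‖ ≤ ‖T‖ * ‖L‖ ^ i := by
  simpa using T.norm_compContinuousLinearMap_le (fun _ => L)

lemma exists_cutoff {X Y F V E : Type*} [NormedAddCommGroup X] [InnerProductSpace ℝ X]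
    [FiniteDimensional ℝ X]
    [NormedAddCommGroup Y] [InnerProductSpace ℝ Y]
    [NormedAddCommGroup F] [InnerProductSpace ℝ F] [FiniteDimensional ℝ F]
    [NormedAddCommGroup V] [InnerProductSpace ℝ V]
    [NormedAddCommGroup E] [InnerProductSpace ℝ E]
    {k : ℕ} (A : DiffOperator X k V E)
    (P : X →L[ℝ] Y) (Q : X →L[ℝ] F) (J : Y →L[ℝ] X) (hP : ‖P‖ ≤ 1) (hQ : ‖Q‖ ≤ 1) (hJ : ‖J‖ ≤ 1)
    (hPJ : P.comp J = ContinuousLinearMap.id ℝ Y)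
    (hnorm : ∀ x, ‖x‖ ≤ ‖P x‖ + ‖Q x‖)
    {w : Y → V} (hw : IsTestFun w)
    (hA : ∀ y, A ((iteratedFDeriv ℝ k w y).compContinuousLinearMap (fun _ => P)) = 0) :
    ∃ C₁ K₁ : ℝ, 0 ≤ C₁ ∧ 0 ≤ K₁ ∧ ∀ R : ℝ, 1 ≤ R → ∃ u : X → V, IsTestFun u ∧
      (∀ x, ‖A.app u x‖ ≤ C₁ / R) ∧
      (∀ x, A.app u x ≠ 0 → ‖P x‖ ≤ K₁ ∧ ‖Q x‖ ≤ 2 * R) ∧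
      (∀ j x, ‖Q x‖ < R → ‖iteratedFDeriv ℝ j w (P x)‖ ≤ ‖iteratedFDeriv ℝ j u x‖) := by
  let η : ContDiffBump (0 : F) := ⟨1, 2, by norm_num, by norm_num⟩
  have hη : IsTestFun (η : F → ℝ) := ⟨η.contDiff, η.hasCompactSupport⟩
  obtain ⟨Cη, hCη0, hCη⟩ := exists_bound_iteratedFDeriv hη k
  obtain ⟨Cw, hCw0, hCw⟩ := exists_bound_iteratedFDeriv hw k
  obtain ⟨K₀, hK₀⟩ := hw.2.isBounded.exists_norm_le
  have hfs : ContDiff ℝ (⊤ : ℕ∞) (w ∘ P) := hw.1.comp P.contDiff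
  have hDf : ∀ (i : ℕ) x, iteratedFDeriv ℝ i (w ∘ P) x
      = (iteratedFDeriv ℝ i w (P x)).compContinuousLinearMap (fun _ => P) := fun i x =>
    P.iteratedFDeriv_comp_right hw.1 x (by exact_mod_cast le_top)
  have hDfn : ∀ i ≤ k, ∀ x, ‖iteratedFDeriv ℝ i (w ∘ P) x‖ ≤ Cw := by
    intro i hi x
    rw [hDf]
    refine (norm_compCLM_le _ _).trans ?_
    calc _ ≤ Cw * 1 := by
          gcongr
          · exact hCw i hi _
          · exact pow_le_one₀ (norm_nonneg _) hP
      _ = Cw := mul_one _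
  refine ⟨‖A‖ * (2 ^ k * (Cη * Cw)), max K₀ 0, by positivity, le_max_right _ _, fun R hR => ?_⟩
  have hR0 : 0 < R := by linarith
  let L : X →L[ℝ] F := R⁻¹ • Q
  have hLn : ‖L‖ ≤ R⁻¹ := by
    rw [norm_smul, Real.norm_of_nonneg (inv_nonneg.2 hR0.le)]
    exact mul_le_of_le_one_right (inv_nonneg.2 hR0.le) hQ
  have hLx : ∀ x, ‖L x‖ = R⁻¹ * ‖Q x‖ := by
    intro x
    simp [L, norm_smul, abs_of_pos hR0]
  let g : X → ℝ := fun x => η (L x)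
  have hgs : ContDiff ℝ (⊤ : ℕ∞) g := η.contDiff.comp L.contDiff
  let u : X → V := fun x => g x • (w ∘ P) x
  have hus : ContDiff ℝ (⊤ : ℕ∞) u := hgs.smul hfs
  have hS : tsupport u ⊆ {x | ‖P x‖ ≤ max K₀ 0 ∧ ‖Q x‖ ≤ 2 * R} := by
    refine closure_minimal ?_ ?_
    · intro x hx
      have hx' : g x • w (P x) ≠ 0 := hx
      have h1 : g x ≠ 0 := fun h => hx' (by rw [h, zero_smul])
      have h2 : w (P x) ≠ 0 := fun h => hx' (by rw [h, smul_zero])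
      refine ⟨(hK₀ _ (subset_tsupport _ h2)).trans (le_max_left _ _), ?_⟩
      have h3 : L x ∈ Function.support η := h1
      rw [η.support_eq, mem_ball_zero_iff, hLx] at h3
      have h4 : R⁻¹ * ‖Q x‖ < 2 := h3
      rw [inv_mul_lt_iff₀ hR0] at h4
      linarith
    · exact (isClosed_le P.continuous.norm continuous_const).inter
        (isClosed_le Q.continuous.norm continuous_const)
  have hucs : HasCompactSupport u := by
    apply Metric.isCompact_of_isClosed_isBounded (isClosed_tsupport u)
    refine (Metric.isBounded_closedBall (x := (0 : X)) (r := max K₀ 0 + 2 * R)).subset ?_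
    intro x hx
    have := hS hx
    rw [mem_closedBall_zero_iff]
    exact (hnorm x).trans (add_le_add this.1 this.2)
  refine ⟨u, ⟨hus, hucs⟩, ?_, ?_, ?_⟩
  · intro x
    let g₁ : X → ℝ := fun z => g z - g x
    have hg₁ : ContDiff ℝ (⊤ : ℕ∞) g₁ := hgs.sub contDiff_const
    have hk' : ((k : ℕ) : WithTop ℕ∞) ≤ ((⊤ : ℕ∞) : WithTop ℕ∞) := by exact_mod_cast le_top
    have e1 : iteratedFDeriv ℝ k u x = iteratedFDeriv ℝ k (fun z => g₁ z • (w ∘ P) z) x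
        + g x • iteratedFDeriv ℝ k (w ∘ P) x := by
      have : u = (fun z => g₁ z • (w ∘ P) z) + g x • (w ∘ P) := by
        funext z
        simp [u, g₁, sub_smul]
      rw [this, iteratedFDeriv_add_apply, iteratedFDeriv_const_smul_apply]
      · exact (hfs.of_le hk').contDiffAt
      · exact ((hg₁.smul hfs).of_le hk').contDiffAt
      · exact ((hfs.const_smul (g x)).of_le hk').contDiffAt
    have e2 : A.app u x = A (iteratedFDeriv ℝ k (fun z => g₁ z • (w ∘ P) z) x) := by
      unfold DiffOperator.app
      rw [e1, map_add, map_smul, hDf, hA, smul_zero, add_zero]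
    have hDg : ∀ i ≤ k, ‖iteratedFDeriv ℝ i g₁ x‖ ≤ Cη * R⁻¹ := by
      intro i hi
      rcases Nat.eq_zero_or_pos i with rfl | hi0
      · rw [norm_iteratedFDeriv_zero]
        simp only [g₁, sub_self, norm_zero]
        positivity
      · have h1 : g₁ = (fun y : F => η y - g x) ∘ L := rfl
        rw [h1, L.iteratedFDeriv_comp_right (n := (⊤ : ℕ∞)) (η.contDiff.sub contDiff_const) x
          (by exact_mod_cast le_top)]
        have h2 : iteratedFDeriv ℝ i (fun y : F => η y - g x) (L x)
            = iteratedFDeriv ℝ i (η : F → ℝ) (L x) := by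
          have : (fun y : F => η y - g x) = (η : F → ℝ) - fun _ => g x := rfl
          rw [this, iteratedFDeriv_sub_apply η.contDiff.contDiffAt contDiff_const.contDiffAt,
            iteratedFDeriv_const_of_ne hi0.ne']
          simp
        rw [h2]
        refine (norm_compCLM_le _ _).trans ?_
        gcongr
        · exact hCη i hi _
        · calc ‖L‖ ^ i ≤ (R⁻¹) ^ i := by gcongr
            _ ≤ (R⁻¹) ^ 1 := pow_le_pow_of_le_one (by positivity) (inv_le_one_of_one_le₀ hR) hi0
            _ = R⁻¹ := pow_one _
    rw [e2]
    refine (A.le_opNorm _).trans ?_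
    rw [mul_div_assoc]
    gcongr
    refine (norm_iteratedFDeriv_smul_le (hg₁) (hfs) x (n := k) hk').trans ?_
    calc _ ≤ ∑ i ∈ Finset.range (k + 1), (k.choose i : ℝ) * (Cη * R⁻¹) * Cw := by
          refine Finset.sum_le_sum fun i hi => ?_
          have hi' : i ≤ k := by
            have := Finset.mem_range.1 hi
            omega
          gcongr
          · exact hDg i hi'
          · exact hDfn _ (by omega) _
      _ = _ := by
          simp only [mul_assoc]
          rw [← Finset.sum_mul]
          have : ∑ i ∈ Finset.range (k + 1), (k.choose i : ℝ) = 2 ^ k := by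
            exact_mod_cast Nat.sum_range_choose k
          rw [this]
          field_simp
  · intro x hx
    apply hS
    apply support_iteratedFDeriv_subset (𝕜 := ℝ) k
    intro h0
    apply hx
    unfold DiffOperator.app
    rw [h0, map_zero]
  · intro j x hx
    have h1 : u =ᶠ[nhds x] (w ∘ P) := by
      have hopen : IsOpen {z : X | ‖Q z‖ < R} := isOpen_lt (by fun_prop) (by fun_prop)
      filter_upwards [hopen.mem_nhds hx] with z hz
      have h2 : η (L z) = 1 := by
        apply η.one_of_mem_closedBall
        rw [mem_closedBall_zero_iff, hLx]
        change R⁻¹ * ‖Q z‖ ≤ 1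
        rw [inv_mul_le_iff₀ hR0]
        simpa using (le_of_lt hz)
      change η (L z) • w (P z) = w (P z)
      rw [h2, one_smul]
    rw [(h1.iteratedFDeriv ℝ j).eq_of_nhds, hDf]
    have h3 : iteratedFDeriv ℝ j w (P x)
        = ((iteratedFDeriv ℝ j w (P x)).compContinuousLinearMap
          (fun _ => P)).compContinuousLinearMap (fun _ => J) := by
      ext v
      have : ∀ y, P (J y) = y := fun y => DFunLike.congr_fun hPJ y
      simp [this]
    conv_lhs => rw [h3]
    refine (norm_compCLM_le _ _).trans ?_
    exact mul_le_of_le_one_right (norm_nonneg _) (pow_le_one₀ (norm_nonneg _) hJ)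

end PartFour

section PartFive

lemma hardy_false {X Y F V E : Type*} [NormedAddCommGroup X] [InnerProductSpace ℝ X]
    [FiniteDimensional ℝ X] [MeasurableSpace X] [BorelSpace X]
    [NormedAddCommGroup Y] [InnerProductSpace ℝ Y] [FiniteDimensional ℝ Y] [MeasurableSpace Y]
    [BorelSpace Y] [Nontrivial Y]
    [NormedAddCommGroup F] [InnerProductSpace ℝ F] [FiniteDimensional ℝ F] [MeasurableSpace F]
    [BorelSpace F]
    [NormedAddCommGroup V] [InnerProductSpace ℝ V]
    [NormedAddCommGroup E] [InnerProductSpace ℝ E]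
    {k : ℕ} (A : DiffOperator X k V E)
    (P : X →L[ℝ] Y) (Q : X →L[ℝ] F) (J : Y →L[ℝ] X) (hP : ‖P‖ ≤ 1) (hQ : ‖Q‖ ≤ 1) (hJ : ‖J‖ ≤ 1)
    (hPJ : P.comp J = ContinuousLinearMap.id ℝ Y)
    (hnorm : ∀ x, ‖x‖ ≤ ‖P x‖ + ‖Q x‖)
    (hmp : MeasurePreserving (fun x => (P x, Q x)) (volume : Measure X)
      ((volume : Measure Y).prod (volume : Measure F)))
    (p : ℝ) (hp1 : 1 ≤ p) (hd : (Module.finrank ℝ F : ℝ) ≤ p)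
    (C : ℝ)
    (hest : ∀ u : X → V, IsTestFun u →
      ∫⁻ x, (‖iteratedFDeriv ℝ (k - 1) u x‖₊ : ℝ≥0∞) ^ p / (‖x‖₊ : ℝ≥0∞) ^ p
        ≤ ENNReal.ofReal C * ∫⁻ x, (‖A.app u x‖₊ : ℝ≥0∞) ^ p)
    {w : Y → V} (hw : IsTestFun w) (hw0 : w ≠ 0)
    (hA : ∀ y, A ((iteratedFDeriv ℝ k w y).compContinuousLinearMap (fun _ => P)) = 0) :
    False := by
  have hp0 : 0 < p := by linarith
  obtain ⟨C₁, K₁, hC₁, hK₁, hcut⟩ := exists_cutoff A P Q J hP hQ hJ hPJ hnorm hw hA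
  obtain ⟨y₀, hy₀⟩ := exists_iteratedFDeriv_ne_zero hw hw0 (k - 1)
  have hcont : Continuous fun y => ‖iteratedFDeriv ℝ (k - 1) w y‖ :=
    (hw.1.continuous_iteratedFDeriv
      (WithTop.coe_le_coe.2 (le_top : ((k - 1 : ℕ) : ℕ∞) ≤ ⊤))).norm
  let ε : ℝ := ‖iteratedFDeriv ℝ (k - 1) w y₀‖ / 2
  have hn0 : 0 < ‖iteratedFDeriv ℝ (k - 1) w y₀‖ := norm_pos_iff.2 hy₀
  have hε : 0 < ε := half_pos hn0
  obtain ⟨r, hr, hball⟩ : ∃ r > 0, ∀ y ∈ Metric.ball y₀ r,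
      ε ≤ ‖iteratedFDeriv ℝ (k - 1) w y‖ := by
    have : {y | ε < ‖iteratedFDeriv ℝ (k - 1) w y‖} ∈ nhds y₀ :=
      (isOpen_lt continuous_const hcont).mem_nhds (half_lt_self hn0)
    obtain ⟨r, hr, h⟩ := Metric.mem_nhds_iff.1 this
    exact ⟨r, hr, fun y hy => le_of_lt (h hy)⟩
  let K : ℝ := ‖y₀‖ + r
  have hK : 0 < K := by positivity
  let D : ℕ := Module.finrank ℝ F
  -- constants
  let a : ℝ≥0∞ := ENNReal.ofReal (ε ^ p) * volume (Metric.ball y₀ r)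
  have ha0 : a ≠ 0 := mul_ne_zero (ENNReal.ofReal_pos.2 (by positivity)).ne'
    (Metric.measure_ball_pos volume y₀ hr).ne'
  have hat : a ≠ ⊤ := ENNReal.mul_ne_top ENNReal.ofReal_ne_top measure_ball_lt_top.ne
  let c : ℝ≥0∞ := ENNReal.ofReal C * (ENNReal.ofReal (C₁ ^ p * 2 ^ D) *
    (volume (Metric.closedBall (0 : Y) K₁) * volume (Metric.ball (0 : F) 1)))
  have hct : c ≠ ⊤ := ENNReal.mul_ne_top ENNReal.ofReal_ne_top
    (ENNReal.mul_ne_top ENNReal.ofReal_ne_top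
      (ENNReal.mul_ne_top measure_closedBall_lt_top.ne measure_ball_lt_top.ne))
  refine radial_false (F := F) p hp1 hd K hK (a⁻¹ * c)
    (ENNReal.mul_ne_top (ENNReal.inv_ne_top.2 ha0) hct) fun R hR => ?_
  have hR0 : 0 < R := by linarith
  obtain ⟨u, hu, hu1, hu2, hu3⟩ := hcut R hR
  have hφm : Measurable fun z : F => ENNReal.ofReal ((K + ‖z‖) ^ (-p)) := by fun_prop
  -- lower bound
  have hlow : a * ∫⁻ z in Metric.ball (0 : F) R, ENNReal.ofReal ((K + ‖z‖) ^ (-p))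
      ≤ ∫⁻ x, (‖iteratedFDeriv ℝ (k - 1) u x‖₊ : ℝ≥0∞) ^ p / (‖x‖₊ : ℝ≥0∞) ^ p := by
    have hms : MeasurableSet (Metric.ball y₀ r ×ˢ Metric.ball (0 : F) R) :=
      measurableSet_ball.prod measurableSet_ball
    have e1 : a * ∫⁻ z in Metric.ball (0 : F) R, ENNReal.ofReal ((K + ‖z‖) ^ (-p))
        = ∫⁻ q in Metric.ball y₀ r ×ˢ Metric.ball (0 : F) R,
          ENNReal.ofReal (ε ^ p) * ENNReal.ofReal ((K + ‖q.2‖) ^ (-p))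
            ∂((volume : Measure Y).prod (volume : Measure F)) := by
      rw [← Measure.prod_restrict, lintegral_prod_mul (f := fun _ => ENNReal.ofReal (ε ^ p))
        (g := fun z : F => ENNReal.ofReal ((K + ‖z‖) ^ (-p))) aemeasurable_const hφm.aemeasurable]
      simp [a]
    rw [e1, ← hmp.setLIntegral_comp_preimage hms (by fun_prop)]
    refine (setLIntegral_mono' (hmp.measurable hms) ?_).trans (setLIntegral_le_lintegral _ _)
    rintro x ⟨hx1, hx2⟩
    have hx1' : P x ∈ Metric.ball y₀ r := hx1
    have hx2' : ‖Q x‖ < R := by simpa using hx2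
    have hPx : ‖P x‖ ≤ K := by
      have h1 : ‖P x - y₀‖ < r := by simpa [dist_eq_norm] using hx1'
      have h2 := norm_le_norm_add_norm_sub' (P x) y₀
      simp only [K]
      linarith
    have hKQ : 0 < K + ‖Q x‖ := by positivity
    have hxn : ‖x‖ ≤ K + ‖Q x‖ := (hnorm x).trans (by linarith)
    have hD : ε ≤ ‖iteratedFDeriv ℝ (k - 1) u x‖ := (hball _ hx1').trans (hu3 _ x hx2')
    change ENNReal.ofReal (ε ^ p) * ENNReal.ofReal ((K + ‖Q x‖) ^ (-p)) ≤ _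
    rw [Real.rpow_neg hKQ.le, ENNReal.ofReal_inv_of_pos (by positivity), ← div_eq_mul_inv,
      ← ENNReal.ofReal_rpow_of_pos hε, ← ENNReal.ofReal_rpow_of_pos hKQ]
    refine ENNReal.div_le_div ?_ ?_
    · refine ENNReal.rpow_le_rpow ?_ hp0.le
      rw [← enorm_eq_nnnorm, ← ofReal_norm]
      exact ENNReal.ofReal_le_ofReal hD
    · refine ENNReal.rpow_le_rpow ?_ hp0.le
      rw [← enorm_eq_nnnorm, ← ofReal_norm]
      exact ENNReal.ofReal_le_ofReal hxn
  -- upper bound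
  have hup : ENNReal.ofReal C * ∫⁻ x, (‖A.app u x‖₊ : ℝ≥0∞) ^ p
      ≤ c * ENNReal.ofReal (R ^ ((D : ℝ) - p)) := by
    have hms : MeasurableSet (Metric.closedBall (0 : Y) K₁ ×ˢ Metric.closedBall (0 : F) (2 * R)) :=
      measurableSet_closedBall.prod measurableSet_closedBall
    let S : Set X := (fun x => (P x, Q x)) ⁻¹'
      (Metric.closedBall (0 : Y) K₁ ×ˢ Metric.closedBall (0 : F) (2 * R))
    have hSm : MeasurableSet S := hmp.measurable hms
    have hSv : volume S = volume (Metric.closedBall (0 : Y) K₁) *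
        (ENNReal.ofReal ((2 * R) ^ D) * volume (Metric.ball (0 : F) 1)) := by
      rw [hmp.measure_preimage hms.nullMeasurableSet, Measure.prod_prod,
        Measure.addHaar_closedBall volume (0 : F) (by positivity)]
    have hle : ∫⁻ x, (‖A.app u x‖₊ : ℝ≥0∞) ^ p ≤ ENNReal.ofReal ((C₁ / R) ^ p) * volume S := by
      rw [← lintegral_indicator_const hSm]
      refine lintegral_mono fun x => ?_
      by_cases hx : A.app u x = 0
      · simp [hx, hp0]
      · have hxS : x ∈ S := by
          have := hu2 x hx
          exact ⟨by simpa using this.1, by simpa using this.2⟩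
        rw [Set.indicator_of_mem hxS, ← ENNReal.ofReal_rpow_of_nonneg (by positivity) hp0.le]
        refine ENNReal.rpow_le_rpow ?_ hp0.le
        rw [← enorm_eq_nnnorm, ← ofReal_norm]
        exact ENNReal.ofReal_le_ofReal (hu1 x)
    refine (mul_le_mul_right hle _).trans (le_of_eq ?_)
    rw [hSv]
    have e2 : ENNReal.ofReal ((C₁ / R) ^ p) * ENNReal.ofReal ((2 * R) ^ D)
        = ENNReal.ofReal (C₁ ^ p * 2 ^ D) * ENNReal.ofReal (R ^ ((D : ℝ) - p)) := by
      rw [← ENNReal.ofReal_mul (by positivity), ← ENNReal.ofReal_mul (by positivity)]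
      congr 1
      rw [Real.div_rpow hC₁ hR0.le, Real.rpow_sub hR0, Real.rpow_natCast, mul_pow]
      ring
    calc _ = ENNReal.ofReal C * ((ENNReal.ofReal ((C₁ / R) ^ p) * ENNReal.ofReal ((2 * R) ^ D)) *
          (volume (Metric.closedBall (0 : Y) K₁) * volume (Metric.ball (0 : F) 1))) := by ring
      _ = _ := by
        rw [e2]
        simp only [c]
        ring
  have hfin := hlow.trans ((hest u hu).trans hup)
  rw [mul_assoc, ← ENNReal.div_eq_inv_mul, ENNReal.le_div_iff_mul_le (Or.inl ha0) (Or.inl hat),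
    mul_comm]
  exact hfin

end PartFive

/-- Proposition: the non-ellipticity set cannot contain large subspaces.
If `p ∈ [1, n)` and the Hardy inequality
`∫ |D^{k−1}u(x)|^p / |x|^p dx ≤ C ∫ |A(D)u|^p` holds for all `u ∈ C_c^∞(ℝⁿ; V)`,
then every linear subspace `Π ⊆ ℝⁿ` with `dim Π ≥ n − p` contains some `ξ` with `A(ξ)`
injective. -/
theorem statement9
    {V E : Type*} [NormedAddCommGroup V] [InnerProductSpace ℝ V] [FiniteDimensional ℝ V]
    [NormedAddCommGroup E] [InnerProductSpace ℝ E] [FiniteDimensional ℝ E]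
    {n k : ℕ} (hn : 0 < n) (hk : 0 < k)
    (A : DiffOperator (EuclideanSpace ℝ (Fin n)) k V E)
    (p : ℝ) (hp1 : 1 ≤ p) (hpn : p < n)
    (C : ℝ) (hC : 0 < C)
    (hest : ∀ u : EuclideanSpace ℝ (Fin n) → V, IsTestFun u →
      ∫⁻ x, (‖iteratedFDeriv ℝ (k - 1) u x‖₊ : ℝ≥0∞) ^ p / (‖x‖₊ : ℝ≥0∞) ^ p
        ≤ ENNReal.ofReal C * ∫⁻ x, (‖A.app u x‖₊ : ℝ≥0∞) ^ p) :
    ∀ Pi₀ : Submodule ℝ (EuclideanSpace ℝ (Fin n)),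
      (n : ℝ) - p ≤ (Module.finrank ℝ Pi₀ : ℝ) →
      ∃ ξ ∈ Pi₀, Function.Injective (A.symbol ξ) := by
  intro Pi₀ hdim
  by_contra! hno
  have hpos : 0 < Module.finrank ℝ Pi₀ := by
    have : (0 : ℝ) < Module.finrank ℝ Pi₀ := by linarith
    exact_mod_cast this
  have hnt : Nontrivial Pi₀ := Module.finrank_pos_iff.1 hpos
  let P : EuclideanSpace ℝ (Fin n) →L[ℝ] Pi₀ := Pi₀.orthogonalProjectionOnto
  let Q : EuclideanSpace ℝ (Fin n) →L[ℝ] Pi₀ᗮ := Pi₀ᗮ.orthogonalProjectionOnto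
  let A' : DiffOperator Pi₀ k V E :=
    A.comp (ContinuousMultilinearMap.compContinuousLinearMapL (fun _ : Fin k => P))
  have hsym : ∀ ξ : Pi₀, A'.symbol ξ = A.symbol (ξ : EuclideanSpace ℝ (Fin n)) := by
    intro ξ
    ext v
    rw [symbol_eq, symbol_eq]
    change A ((elemMap (fun _ => ξ) v).compContinuousLinearMap (fun _ => P)) = _
    congr 1
    ext x
    rw [ContinuousMultilinearMap.compContinuousLinearMap_apply, elemMap_apply, elemMap_apply]
    congr 1
    refine Finset.prod_congr rfl fun s _ => ?_
    exact Submodule.inner_orthogonalProjectionOnto_eq_of_mem_left ξ (x s)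
  obtain ⟨w, hw, hw0, hAw⟩ := exists_kernel_testFun A' (fun ξ => by
    rw [hsym]
    exact hno ξ ξ.2)
  have hfr : (Module.finrank ℝ Pi₀ᗮ : ℝ) ≤ p := by
    have h1 := Pi₀.finrank_add_finrank_orthogonal
    rw [finrank_euclideanSpace_fin] at h1
    have h2 : (Module.finrank ℝ Pi₀ : ℝ) + Module.finrank ℝ Pi₀ᗮ = n := by exact_mod_cast h1
    linarith
  refine hardy_false A P Q Pi₀.subtypeL Pi₀.orthogonalProjectionOnto_norm_le
    Pi₀ᗮ.orthogonalProjectionOnto_norm_le ?_ ?_ ?_ ?_ p hp1 hfr C hest hw hw0 hAw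
  · exact Pi₀.subtypeₗᵢ.norm_toContinuousLinearMap_le
  · ext y
    simp [P]
  · intro x
    have h1 : ((P x : EuclideanSpace ℝ (Fin n)) + Q x) = x := by
      simp [P, Q]
    calc ‖x‖ = ‖((P x : EuclideanSpace ℝ (Fin n)) + Q x)‖ := by rw [h1]
      _ ≤ ‖P x‖ + ‖Q x‖ := norm_add_le _ _
  · have h1 := (WithLp.volume_preserving_ofLp Pi₀ Pi₀ᗮ).comp
      Pi₀.orthogonalDecomposition.measurePreserving
    convert! h1 using 1
    funext x
    simp [P, Q, Submodule.orthogonalDecomposition_apply]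
end
end

section
/- Let A(D) be a homogeneous linear differential operator of order k on ℝ² from V to E and let p ∈ [1, 2). If there exists a constant C > 0 such that for every u ∈ C_c^∞(ℝ²; V), ∫_{ℝ²} |D^{k−1}u(x)|^p / |x|^p dx ≤ C ∫_{ℝ²} |A(D)u(x)|^p dx, then A(D) is elliptic. -/
open MeasureTheory ENNReal
open scoped NNReal RealInnerProductSpace

noncomputable section

theorem ridge_deriv {X V : Type*} [NormedAddCommGroup X] [InnerProductSpace ℝ X]
    [NormedAddCommGroup V] [NormedSpace ℝ V] (f : ℝ → V) (hf : ContDiff ℝ (⊤ : ℕ∞) f)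
    (e : X) (n : ℕ) (x : X) :
    iteratedFDeriv ℝ n (fun y => f (innerSL ℝ e y)) x =
      ContinuousMultilinearMap.compContinuousLinearMapL (fun _ : Fin n => innerSL ℝ e)
        (ContinuousMultilinearMap.piFieldEquiv ℝ (Fin n) V (iteratedDeriv n f (innerSL ℝ e x))) := by
  have := (innerSL ℝ e).iteratedFDeriv_comp_right hf x (i := n) (by exact_mod_cast le_top)
  rw [show (fun y => f (innerSL ℝ e y)) = f ∘ (innerSL ℝ e) from rfl, this]
  rw [iteratedFDeriv_eq_equiv_comp]
  rfl

theorem symbol_smul_apply {X V E : Type*} [NormedAddCommGroup X] [InnerProductSpace ℝ X]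
    [NormedAddCommGroup V] [NormedSpace ℝ V] [NormedAddCommGroup E] [NormedSpace ℝ E] {k : ℕ}
    (A : DiffOperator X k V E) (c : ℝ) (ξ : X) (v : V) :
    A.symbol (c • ξ) v = c ^ k • A.symbol ξ v := by
  unfold DiffOperator.symbol
  simp only [ContinuousLinearMap.comp_apply]
  rw [← map_smul]
  congr 1
  ext m
  simp [ContinuousMultilinearMap.compContinuousLinearMapL, ContinuousMultilinearMap.piFieldEquiv,
    Finset.prod_mul_distrib, mul_smul]

theorem norm_deriv_comp_le {X V : Type*} [NormedAddCommGroup X] [InnerProductSpace ℝ X]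
    [NormedAddCommGroup V] [NormedSpace ℝ V] (f : ℝ → V) (hf : ContDiff ℝ (⊤ : ℕ∞) f)
    (l : X →L[ℝ] ℝ) (n : ℕ) (x : X) :
    ‖iteratedFDeriv ℝ n (fun y => f (l y)) x‖ ≤ ‖iteratedFDeriv ℝ n f (l x)‖ * ‖l‖ ^ n := by
  have := l.iteratedFDeriv_comp_right hf x (i := n) (by exact_mod_cast le_top)
  rw [show (fun y => f (l y)) = f ∘ l from rfl, this]
  refine (ContinuousMultilinearMap.norm_compContinuousLinearMap_le _ _).trans ?_
  simp

theorem bounded_derivs {V : Type*} [NormedAddCommGroup V] [NormedSpace ℝ V] (f : ℝ → V)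
    (hf : ContDiff ℝ (⊤ : ℕ∞) f) (hc : HasCompactSupport f) (n : ℕ) :
    ∃ M : ℝ, 0 ≤ M ∧ ∀ j ≤ n, ∀ s, ‖iteratedFDeriv ℝ j f s‖ ≤ M := by
  have h : ∀ j, ∃ C, ∀ s, ‖iteratedFDeriv ℝ j f s‖ ≤ C := fun j =>
    (hc.iteratedFDeriv j).exists_bound_of_continuous
      (hf.continuous_iteratedFDeriv (by exact_mod_cast le_top))
  choose C hC using h
  refine ⟨∑ j ∈ Finset.range (n + 1), C j, ?_, ?_⟩
  · exact Finset.sum_nonneg fun j _ => (norm_nonneg _).trans (hC j 0)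
  · intro j hj s
    exact (hC j s).trans (Finset.single_le_sum (f := C)
      (fun j _ => (norm_nonneg _).trans (hC j 0)) (Finset.mem_range.2 (by omega)))

theorem upper_bound {X V E : Type*} [NormedAddCommGroup X] [InnerProductSpace ℝ X]
    [NormedAddCommGroup V] [NormedSpace ℝ V] [NormedAddCommGroup E] [NormedSpace ℝ E] {k : ℕ}
    (A : DiffOperator X k V E) (e ew : X) (he : ‖e‖ = 1) (hew : ‖ew‖ = 1)
    (f : ℝ → V) (hf : ContDiff ℝ (⊤ : ℕ∞) f) (hfc : HasCompactSupport f)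
    (h : ℝ → ℝ) (hh : ContDiff ℝ (⊤ : ℕ∞) h) (hhc : HasCompactSupport h)
    (hA : ∀ s, A.symbol e (iteratedDeriv k f s) = 0) :
    ∃ M : ℝ, 0 ≤ M ∧ ∀ R : ℝ, 1 ≤ R → ∀ x,
      ‖A.app (fun y => h ((R⁻¹ • innerSL ℝ ew) y) • f (innerSL ℝ e y)) x‖ ≤ M / R := by
  obtain ⟨M1, hM1, hf1⟩ := bounded_derivs f hf hfc k
  obtain ⟨M2, hM2, hh2⟩ := bounded_derivs h hh hhc k
  refine ⟨‖A‖ * ∑ i ∈ Finset.range (k + 1), (k.choose i : ℝ) * M2 * M1, by positivity, ?_⟩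
  intro R hR x
  have hR0 : 0 < R := by linarith
  set l := R⁻¹ • innerSL ℝ ew with hl
  have hln : ‖l‖ = R⁻¹ := by
    rw [hl, norm_smul, innerSL_apply_norm, hew, Real.norm_of_nonneg (by positivity), mul_one]
  set c := h (l x) with hc
  set a : X → V := fun y => f (innerSL ℝ e y) with ha
  have has : ContDiff ℝ (⊤ : ℕ∞) a := hf.comp (innerSL ℝ e).contDiff
  set g : X → ℝ := fun y => (fun t => h t - c) (l y) with hg
  have hhs : ContDiff ℝ (⊤ : ℕ∞) (fun t => h t - c) := hh.sub contDiff_const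
  have hgs : ContDiff ℝ (⊤ : ℕ∞) g := hhs.comp l.contDiff
  have hsplit : (fun y => h (l y) • f (innerSL ℝ e y)) = (c • a) + fun y => g y • a y := by
    funext y
    simp [hg, ha, sub_smul]
  have hk : ((k : ℕ) : WithTop ℕ∞) ≤ ((⊤ : ℕ∞) : WithTop ℕ∞) := by exact_mod_cast le_top
  have hca : A (iteratedFDeriv ℝ k (c • a) x) = 0 := by
    rw [iteratedFDeriv_const_smul_apply (has.of_le hk).contDiffAt, map_smul, ha, ridge_deriv f hf]
    have := hA (innerSL ℝ e x)
    unfold DiffOperator.symbol at this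
    simp only [ContinuousLinearMap.comp_apply] at this
    erw [this]
    simp
  unfold DiffOperator.app
  have hadd : iteratedFDeriv ℝ k ((c • a) + fun y => g y • a y) x =
      iteratedFDeriv ℝ k (c • a) x + iteratedFDeriv ℝ k (fun y => g y • a y) x :=
    iteratedFDeriv_add_apply ((has.const_smul c).of_le hk).contDiffAt
      ((hgs.smul has).of_le hk).contDiffAt
  rw [hsplit, hadd, map_add, hca, zero_add]
  refine (A.le_opNorm _).trans ?_
  rw [mul_div_assoc]
  gcongr
  refine (norm_iteratedFDeriv_smul_le hgs has x hk).trans ?_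
  rw [Finset.sum_div]
  gcongr with i hi
  have hik : i ≤ k := by simpa [Nat.lt_succ_iff] using hi
  have h1 : ‖iteratedFDeriv ℝ (k - i) a x‖ ≤ M1 := by
    refine (norm_deriv_comp_le f hf _ _ _).trans ?_
    rw [innerSL_apply_norm, he, one_pow, mul_one]
    exact hf1 _ (by omega) _
  have h2 : ‖iteratedFDeriv ℝ i g x‖ ≤ M2 / R := by
    rcases Nat.eq_zero_or_pos i with rfl | hi0
    · rw [norm_iteratedFDeriv_zero]
      simp only [hg, hc, sub_self, norm_zero]
      positivity
    · refine (norm_deriv_comp_le _ hhs l i x).trans ?_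
      have : iteratedFDeriv ℝ i (fun t => h t - c) (l x) = iteratedFDeriv ℝ i h (l x) := by
        have hile : ((i : ℕ) : WithTop ℕ∞) ≤ ((⊤ : ℕ∞) : WithTop ℕ∞) := by exact_mod_cast le_top
        have := iteratedFDeriv_sub_apply (x := l x) (hh.of_le hile).contDiffAt
          (contDiff_const (c := c) (𝕜 := ℝ) (E := ℝ) (n := i)).contDiffAt
        rw [iteratedFDeriv_const_of_ne (by omega)] at this
        simp only [Pi.zero_apply, sub_zero] at this
        exact this
      rw [this, hln, div_eq_mul_inv]
      gcongr
      · exact hh2 i hik _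
      · exact pow_le_of_le_one (by positivity) (inv_le_one_of_one_le₀ hR) (by omega)
  calc _ ≤ (k.choose i : ℝ) * (M2 / R) * M1 := by gcongr
    _ = _ := by ring

theorem lower_bound {X V : Type*} [NormedAddCommGroup X] [InnerProductSpace ℝ X]
    [NormedAddCommGroup V] [NormedSpace ℝ V] (n : ℕ) (e : X) (he : ‖e‖ = 1)
    (f : ℝ → V) (hf : ContDiff ℝ (⊤ : ℕ∞) f) (u : X → V) (x : X)
    (hu : u =ᶠ[nhds x] fun y => f (innerSL ℝ e y)) :
    ‖iteratedDeriv n f (innerSL ℝ e x)‖ ≤ ‖iteratedFDeriv ℝ n u x‖ := by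
  rw [(hu.iteratedFDeriv ℝ n).self_of_nhds, ridge_deriv f hf]
  have := ContinuousMultilinearMap.le_opNorm
    (ContinuousMultilinearMap.compContinuousLinearMapL (fun _ : Fin n => innerSL ℝ e)
        (ContinuousMultilinearMap.piFieldEquiv ℝ (Fin n) V (iteratedDeriv n f (innerSL ℝ e x))))
      (fun _ => e)
  simpa [ContinuousMultilinearMap.compContinuousLinearMapL, ContinuousMultilinearMap.piFieldEquiv,
    he] using this

theorem coords_preserving (b : OrthonormalBasis (Fin 2) ℝ (EuclideanSpace ℝ (Fin 2))) :
    MeasurePreserving (fun x => ((innerSL ℝ (b 0) x, innerSL ℝ (b 1) x) : ℝ × ℝ)) volume volume := by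
  have h := (volume_preserving_finTwoArrow ℝ).comp
    ((PiLp.volume_preserving_ofLp (Fin 2)).comp b.measurePreserving_repr)
  convert h using 1
  funext x
  simp [MeasurableEquiv.finTwoArrow, b.repr_apply_apply]

theorem norm_le_coords (b : OrthonormalBasis (Fin 2) ℝ (EuclideanSpace ℝ (Fin 2)))
    (x : EuclideanSpace ℝ (Fin 2)) :
    ‖x‖ ≤ |innerSL ℝ (b 0) x| + |innerSL ℝ (b 1) x| := by
  have h := b.sum_repr' x
  rw [Fin.sum_univ_two] at h
  calc ‖x‖ = ‖inner ℝ (b 0) x • b 0 + inner ℝ (b 1) x • b 1‖ := by rw [h]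
    _ ≤ _ := norm_add_le _ _
    _ = _ := by simp [norm_smul]

theorem lintegral_inv (R : ℝ) (hR : 1 ≤ R) :
    ∫⁻ t in Set.Ioo 1 R, ENNReal.ofReal t⁻¹ = ENNReal.ofReal (Real.log R) := by
  rw [← ofReal_integral_eq_lintegral_ofReal]
  · rw [← integral_Ioc_eq_integral_Ioo, ← intervalIntegral.integral_of_le hR,
      integral_inv_of_pos one_pos (by linarith), div_one]
  · have : IntervalIntegrable (fun t : ℝ => t⁻¹) volume 1 R :=
      intervalIntegral.intervalIntegrable_inv (fun x hx => by
        rw [Set.uIcc_of_le hR] at hx; linarith [hx.1]) continuousOn_id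
    rw [intervalIntegrable_iff_integrableOn_Ioo_of_le hR] at this
    exact this
  · refine (ae_restrict_iff' measurableSet_Ioo).2 (Filter.Eventually.of_forall fun t ht => ?_)
    have := ht.1
    show (0:ℝ) ≤ t⁻¹
    have : 0 < t := by linarith
    positivity

theorem lintegral_strip (b : OrthonormalBasis (Fin 2) ℝ (EuclideanSpace ℝ (Fin 2)))
    (R : ℝ) (hR : 1 ≤ R) (c : ℝ≥0∞) (F : EuclideanSpace ℝ (Fin 2) → ℝ≥0∞)
    (hF : ∀ x, innerSL ℝ (b 0) x ∈ Set.Ioo (0 : ℝ) 1 → innerSL ℝ (b 1) x ∈ Set.Ioo (1 : ℝ) R →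
      c * ENNReal.ofReal (innerSL ℝ (b 1) x)⁻¹ ≤ F x) :
    c * ENNReal.ofReal (Real.log R) ≤ ∫⁻ x, F x := by
  have hT := coords_preserving b
  set T := (fun x => ((innerSL ℝ (b 0) x, innerSL ℝ (b 1) x) : ℝ × ℝ)) with hTdef
  have hS : MeasurableSet ((Set.Ioo (0 : ℝ) 1) ×ˢ (Set.Ioo (1 : ℝ) R)) :=
    measurableSet_Ioo.prod measurableSet_Ioo
  have hm : Measurable fun z : ℝ × ℝ => c * ENNReal.ofReal (z.2)⁻¹ := by fun_prop
  have h1 := hT.setLIntegral_comp_preimage hS hm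
  have h2 : ∫⁻ z in (Set.Ioo (0 : ℝ) 1) ×ˢ (Set.Ioo (1 : ℝ) R), c * ENNReal.ofReal (z.2)⁻¹
      = c * ENNReal.ofReal (Real.log R) := by
    rw [Measure.volume_eq_prod, ← Measure.prod_restrict,
      lintegral_prod_mul (f := fun _ => c) (g := fun t : ℝ => ENNReal.ofReal t⁻¹)
        (by fun_prop) (by fun_prop), lintegral_inv R hR]
    simp
  rw [← h2, ← h1]
  refine (setLIntegral_mono_ae' (hT.measurable hS) ?_).trans (setLIntegral_le_lintegral _ _)
  exact Filter.Eventually.of_forall fun x hx => hF x hx.1 hx.2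

theorem lintegral_box (b : OrthonormalBasis (Fin 2) ℝ (EuclideanSpace ℝ (Fin 2)))
    (R : ℝ) (c : ℝ≥0∞) (F : EuclideanSpace ℝ (Fin 2) → ℝ≥0∞)
    (hF : ∀ x, F x ≤ c)
    (hF0 : ∀ x, ¬ (innerSL ℝ (b 0) x ∈ Set.Icc (-2 : ℝ) 2 ∧
      innerSL ℝ (b 1) x ∈ Set.Icc (-(2 * R)) (2 * R)) → F x = 0) :
    ∫⁻ x, F x ≤ c * ENNReal.ofReal (16 * R) := by
  have hT := coords_preserving b
  set T := (fun x => ((innerSL ℝ (b 0) x, innerSL ℝ (b 1) x) : ℝ × ℝ)) with hTdef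
  have hS : MeasurableSet ((Set.Icc (-2 : ℝ) 2) ×ˢ (Set.Icc (-(2 * R)) (2 * R))) :=
    measurableSet_Icc.prod measurableSet_Icc
  have hvol := hT.measure_preimage hS.nullMeasurableSet
  rw [Measure.volume_eq_prod, Measure.prod_prod, Real.volume_Icc, Real.volume_Icc,
    ← ENNReal.ofReal_mul (by norm_num)] at hvol
  have : ∀ x, F x ≤ (T ⁻¹' ((Set.Icc (-2 : ℝ) 2) ×ˢ (Set.Icc (-(2 * R)) (2 * R)))).indicator
      (fun _ => c) x := by
    intro x
    by_cases hx : x ∈ T ⁻¹' ((Set.Icc (-2 : ℝ) 2) ×ˢ (Set.Icc (-(2 * R)) (2 * R)))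
    · rw [Set.indicator_of_mem hx]; exact hF x
    · rw [hF0 x hx]; exact zero_le
  refine (lintegral_mono this).trans ?_
  rw [lintegral_indicator (hT.measurable hS), setLIntegral_const, hvol]
  apply le_of_eq
  congr 2
  ring

/-- In dimension 2 the Hardy inequality forces ellipticity.
If `p ∈ [1, 2)` and `∫ |D^{k−1}u(x)|^p / |x|^p dx ≤ C ∫ |A(D)u|^p` for every
`u ∈ C_c^∞(ℝ²; V)`, then `A(D)` is elliptic. -/
theorem statement10
    {V E : Type*} [NormedAddCommGroup V] [InnerProductSpace ℝ V] [FiniteDimensional ℝ V]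
    [NormedAddCommGroup E] [InnerProductSpace ℝ E] [FiniteDimensional ℝ E]
    {k : ℕ} (hk : 0 < k)
    (A : DiffOperator (EuclideanSpace ℝ (Fin 2)) k V E)
    (p : ℝ) (hp1 : 1 ≤ p) (hp2 : p < 2)
    (C : ℝ) (hC : 0 < C)
    (hest : ∀ u : EuclideanSpace ℝ (Fin 2) → V, IsTestFun u →
      ∫⁻ x, (‖iteratedFDeriv ℝ (k - 1) u x‖₊ : ℝ≥0∞) ^ p / (‖x‖₊ : ℝ≥0∞) ^ p
        ≤ ENNReal.ofReal C * ∫⁻ x, (‖A.app u x‖₊ : ℝ≥0∞) ^ p) :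
    A.IsElliptic := by
  intro ξ hξ
  rw [injective_iff_map_eq_zero]
  intro v hv
  by_contra hv0
  have hξn : ‖ξ‖ ≠ 0 := norm_ne_zero_iff.2 hξ
  obtain ⟨b, hb⟩ : ∃ b : OrthonormalBasis (Fin 2) ℝ (EuclideanSpace ℝ (Fin 2)), b 0 = ‖ξ‖⁻¹ • ξ := by
    have hon : Orthonormal ℝ (({0} : Set (Fin 2)).domRestrict fun _ => ‖ξ‖⁻¹ • ξ) := by
      refine ⟨fun i => ?_, fun i j hij => (hij (Subsingleton.elim _ _)).elim⟩
      simp [norm_smul, hξn]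
    obtain ⟨b, hb⟩ := hon.exists_orthonormalBasis_extension_of_card_eq (by simp)
    exact ⟨b, hb 0 rfl⟩
  have hsym : A.symbol (b 0) v = 0 := by rw [hb, symbol_smul_apply, hv, smul_zero]
  have hb0 : ‖b 0‖ = 1 := b.norm_eq_one 0
  have hb1 : ‖b 1‖ = 1 := b.norm_eq_one 1
  let h : ContDiffBump (0 : ℝ) := ⟨1, 2, one_pos, one_lt_two⟩
  have hhs : ContDiff ℝ (⊤ : ℕ∞) h := h.contDiff
  have hhc : HasCompactSupport h := h.hasCompactSupport
  have hh0 : ∀ t : ℝ, 2 ≤ |t| → h t = 0 := fun t ht => h.zero_of_le_dist (by simpa using ht)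
  have hh1 : ∀ t : ℝ, |t| ≤ 1 → h t = 1 := fun t ht =>
    h.one_of_mem_closedBall (by simpa using ht)
  set φ : ℝ → ℝ := fun s => h s * Real.exp s with hφ
  have hφs : ContDiff ℝ (⊤ : ℕ∞) φ := hhs.mul Real.contDiff_exp
  set f : ℝ → V := fun s => φ s • v with hf
  have hfs : ContDiff ℝ (⊤ : ℕ∞) f := hφs.smul contDiff_const
  have hfc : HasCompactSupport f := (hhc.mul_right (f' := Real.exp)).smul_right
  have hfd : ∀ n s, iteratedDeriv n f s = iteratedDeriv n φ s • v := by
    intro n s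
    have hn : ((n : ℕ) : WithTop ℕ∞) ≤ ((⊤ : ℕ∞) : WithTop ℕ∞) := by exact_mod_cast le_top
    rw [iteratedDeriv_eq_iteratedFDeriv, iteratedDeriv_eq_iteratedFDeriv, hf,
      iteratedFDeriv_smul_const_apply (hφs.of_le hn).contDiffAt]
    simp
  have hφd : ∀ n s, |s| < 1 → iteratedDeriv n φ s = Real.exp s := by
    intro n s hs
    have : φ =ᶠ[nhds s] Real.exp := by
      filter_upwards [(isOpen_lt continuous_abs continuous_const).mem_nhds hs] with t ht
      rw [hφ]
      simp only
      rw [hh1 t (le_of_lt ht), one_mul]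
    rw [this.iteratedDeriv_eq n, iteratedDeriv_eq_iterate, Real.iter_deriv_exp]
  obtain ⟨M, hM, hMb⟩ := upper_bound A (b 0) (b 1) hb0 hb1 f hfs hfc h hhs hhc
    (fun s => by rw [hfd, map_smul, hsym, smul_zero])
  have hvn : 0 < ‖v‖ := norm_pos_iff.2 hv0
  have key : ∀ R : ℝ, 1 ≤ R → (‖v‖ / 2) ^ p * Real.log R ≤ 16 * C * M ^ p := by
    intro R hR
    have hR0 : 0 < R := by linarith
    set u : EuclideanSpace ℝ (Fin 2) → V := fun y => h ((R⁻¹ • innerSL ℝ (b 1)) y) • f (innerSL ℝ (b 0) y) with hu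
    have hus : ContDiff ℝ (⊤ : ℕ∞) u :=
      (hhs.comp (R⁻¹ • innerSL ℝ (b 1)).contDiff).smul (hfs.comp (innerSL ℝ (b 0)).contDiff)
    have hu0 : ∀ x, ¬ (innerSL ℝ (b 0) x ∈ Set.Icc (-2 : ℝ) 2 ∧
        innerSL ℝ (b 1) x ∈ Set.Icc (-(2 * R)) (2 * R)) → u x = 0 := by
      intro x hx
      rw [Set.mem_Icc, Set.mem_Icc, ← abs_le, ← abs_le, not_and_or, not_le, not_le] at hx
      rcases hx with hx | hx
      · have : f (innerSL ℝ (b 0) x) = 0 := by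
          simp only [hf, hφ]
          rw [hh0 _ hx.le, zero_mul, zero_smul]
        simp only [hu]
        rw [this, smul_zero]
      · have : h ((R⁻¹ • innerSL ℝ (b 1)) x) = 0 := by
          apply hh0
          rw [_root_.smul_apply, smul_eq_mul, abs_mul, abs_of_pos (inv_pos.2 hR0),
            inv_mul_eq_div, le_div_iff₀ hR0]
          exact hx.le
        simp only [hu]
        rw [this, zero_smul]
    have huc : HasCompactSupport u := by
      refine HasCompactSupport.intro (isCompact_closedBall (0 : EuclideanSpace ℝ (Fin 2)) (2 + 2 * R)) fun x hx => ?_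
      apply hu0
      rintro ⟨h1, h2⟩
      rw [Set.mem_Icc, ← abs_le] at h1 h2
      apply hx
      rw [mem_closedBall_zero_iff]
      exact (norm_le_coords b x).trans (add_le_add h1 h2)
    have hE := hest u ⟨hus, huc⟩
    have hup : ∫⁻ x, (‖A.app u x‖₊ : ℝ≥0∞) ^ p ≤
        ENNReal.ofReal ((M / R) ^ p) * ENNReal.ofReal (16 * R) := by
      refine lintegral_box b R _ _ (fun x => ?_) (fun x hx => ?_)
      · rw [← ENNReal.ofReal_rpow_of_nonneg (by positivity) (by linarith)]
        refine ENNReal.rpow_le_rpow ?_ (by linarith)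
        rw [← enorm_eq_nnnorm, ← ofReal_norm]
        exact ENNReal.ofReal_le_ofReal (hMb R hR x)
      · have hcl : IsClosed {x : EuclideanSpace ℝ (Fin 2) | innerSL ℝ (b 0) x ∈ Set.Icc (-2 : ℝ) 2 ∧
            innerSL ℝ (b 1) x ∈ Set.Icc (-(2 * R)) (2 * R)} :=
          (isClosed_Icc.preimage (innerSL ℝ (b 0)).continuous).inter
            (isClosed_Icc.preimage (innerSL ℝ (b 1)).continuous)
        have hts : tsupport u ⊆ {x : EuclideanSpace ℝ (Fin 2) | innerSL ℝ (b 0) x ∈ Set.Icc (-2 : ℝ) 2 ∧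
            innerSL ℝ (b 1) x ∈ Set.Icc (-(2 * R)) (2 * R)} :=
          closure_minimal (fun y hy => by
            by_contra hc
            exact hy (hu0 y hc)) hcl
        have hz : iteratedFDeriv ℝ k u x = 0 := by
          by_contra hne
          exact hx (hts (support_iteratedFDeriv_subset k hne))
        unfold DiffOperator.app
        rw [hz, map_zero, nnnorm_zero, ENNReal.coe_zero, ENNReal.zero_rpow_of_pos (by linarith)]
    have hlow : ENNReal.ofReal ((‖v‖ / 2) ^ p * R ^ (1 - p)) * ENNReal.ofReal (Real.log R) ≤
        ∫⁻ x, (‖iteratedFDeriv ℝ (k - 1) u x‖₊ : ℝ≥0∞) ^ p / (‖x‖₊ : ℝ≥0∞) ^ p := by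
      refine lintegral_strip b R hR _ _ fun x hx0 hx1 => ?_
      set s := innerSL ℝ (b 0) x with hs
      set t := innerSL ℝ (b 1) x with ht
      have ht0 : 0 < t := by linarith [hx1.1]
      have hlow1 : ‖v‖ ≤ ‖iteratedFDeriv ℝ (k - 1) u x‖ := by
        have hev : u =ᶠ[nhds x] fun y => f (innerSL ℝ (b 0) y) := by
          have ho : IsOpen {y : EuclideanSpace ℝ (Fin 2) | |innerSL ℝ (b 1) y| < R} :=
            isOpen_lt (innerSL ℝ (b 1)).continuous.abs continuous_const
          have hmem : x ∈ {y : EuclideanSpace ℝ (Fin 2) | |innerSL ℝ (b 1) y| < R} := by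
            show |t| < R
            rw [abs_of_pos ht0]; exact hx1.2
          filter_upwards [ho.mem_nhds hmem] with y hy
          simp only [hu]
          rw [hh1, one_smul]
          rw [_root_.smul_apply, smul_eq_mul, abs_mul, abs_of_pos (inv_pos.2 hR0),
            inv_mul_eq_div, div_le_iff₀ hR0, one_mul]
          exact le_of_lt hy
        refine le_trans ?_ (lower_bound (k - 1) (b 0) hb0 f hfs u x hev)
        rw [← hs, hfd, hφd _ _ (by rw [abs_of_pos hx0.1]; exact hx0.2), norm_smul,
          Real.norm_of_nonneg (Real.exp_pos _).le]
        exact le_mul_of_one_le_left hvn.le (Real.one_le_exp hx0.1.le)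
      have hxn : ‖x‖ ≤ 2 * t := by
        refine (norm_le_coords b x).trans ?_
        rw [← hs, ← ht, abs_of_pos hx0.1, abs_of_pos ht0]
        linarith [hx0.2, hx1.1]
      have hreal : (‖v‖ / 2) ^ p * R ^ (1 - p) * t⁻¹ ≤ ‖v‖ ^ p / (2 * t) ^ p := by
        have e1 : R ^ (1 - p) ≤ t ^ (1 - p) :=
          Real.rpow_le_rpow_of_nonpos ht0 hx1.2.le (by linarith)
        have e2 : t ^ (1 - p) * t⁻¹ = (t ^ p)⁻¹ := by
          rw [← Real.rpow_neg_one t, ← Real.rpow_add ht0, ← Real.rpow_neg ht0.le]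
          congr 1; ring
        calc _ ≤ (‖v‖ / 2) ^ p * t ^ (1 - p) * t⁻¹ := by gcongr
          _ = (‖v‖ / 2) ^ p * (t ^ p)⁻¹ := by rw [mul_assoc, e2]
          _ = _ := by
            rw [Real.div_rpow hvn.le (by norm_num), Real.mul_rpow (by norm_num) ht0.le]
            field_simp
      rw [← ENNReal.ofReal_mul (by positivity)]
      refine (ENNReal.ofReal_le_ofReal hreal).trans ?_
      rw [ENNReal.ofReal_div_of_pos (by positivity),
        ← ENNReal.ofReal_rpow_of_nonneg hvn.le (by linarith),
        ← ENNReal.ofReal_rpow_of_nonneg (by positivity) (by linarith)]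
      refine ENNReal.div_le_div (ENNReal.rpow_le_rpow ?_ (by linarith))
        (ENNReal.rpow_le_rpow ?_ (by linarith))
      · rw [← enorm_eq_nnnorm, ← ofReal_norm]
        exact ENNReal.ofReal_le_ofReal hlow1
      · rw [← enorm_eq_nnnorm, ← ofReal_norm]
        exact ENNReal.ofReal_le_ofReal hxn
    have hfin := hlow.trans (hE.trans (mul_le_mul_right hup _))
    rw [← ENNReal.ofReal_mul (by positivity), ← ENNReal.ofReal_mul (by positivity),
      ← ENNReal.ofReal_mul (by positivity), ENNReal.ofReal_le_ofReal_iff (by positivity)] at hfin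
    have e3 : (M / R) ^ p * (16 * R) = 16 * M ^ p * R ^ (1 - p) := by
      rw [Real.div_rpow hM hR0.le, Real.rpow_sub hR0, Real.rpow_one]
      field_simp
    rw [e3] at hfin
    have hRp : 0 < R ^ (1 - p) := by positivity
    refine le_of_mul_le_mul_right ?_ hRp
    linarith
  have hvp : 0 < (‖v‖ / 2) ^ p := by positivity
  have hK : 0 ≤ 16 * C * M ^ p / (‖v‖ / 2) ^ p := by positivity
  have := key (Real.exp (16 * C * M ^ p / (‖v‖ / 2) ^ p + 1)) (Real.one_le_exp (by linarith))
  rw [Real.log_exp, mul_add, mul_div_cancel₀ _ hvp.ne'] at this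
  linarith
end
end
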